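/- Let A_0,A_1,A_2 be C^∞ m×m matrix-valued functions on ℝ² supported in B_R. Then there exist matrix-valued functions c₊(x,t) and c₋(x,t) with the following properties: (a) c₊ solves ζ(t)·∂c₊/∂x = (A₁(x)ζ₁(t)+A₂(x)ζ₂(t)+A₀(x))c₊ for all (x,t) in closure(B_{2R})×closure(D⁺), and c₋ solves the same equation for all (x,t) in closure(B_{2R})×closure(D⁻); (b) c₊ is smooth on closure(B_{2R})×closure(D⁺) with det c₊(x,t)≠0 everywhere there, and c₋ is smooth on closure(B_{2R})×closure(D⁻) with det c₋(x,t)≠0 everywhere there; (c) for each fixed x, c₊(x,t) is analytic in t on D⁺ and analytic at t=∞ with det c₊(x,∞)≠0, and c₋(x,t) is analytic in t on D⁻ including t=0 with det c₋(x,0)≠0. -/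

import Mathlib

noncomputable section

open MeasureTheory Filter Topology Complex Matrix

abbrev R2 : Type := EuclideanSpace ℝ (Fin 2)
abbrev Mat (m : ℕ) : Type := Matrix (Fin m) (Fin m) ℂ
abbrev Vec (m : ℕ) : Type := Fin m → ℂ

/-- the point (a,b) ∈ ℝ² -/
def mk2 (a b : ℝ) : R2 := (WithLp.equiv 2 (Fin 2 → ℝ)).symm ![a, b]
def e1 : R2 := mk2 1 0
def e2 : R2 := mk2 0 1

/-- partial derivative of a scalar function in direction v -/
def pdv (v : R2) (f : R2 → ℂ) (x : R2) : ℂ := fderiv ℝ f x v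

def zeta1 (t : ℂ) : ℂ := (t + t⁻¹) / 2
def zeta2 (t : ℂ) : ℂ := (t - t⁻¹) / (2 * Complex.I)

/-- z = x₁ + i x₂ -/
def zOf (x : R2) : ℂ := (x 0 : ℂ) + Complex.I * (x 1 : ℂ)

/-- the kernel denominator t(z−z′)+t⁻¹(z̄−z̄′) -/
def ker (t : ℂ) (x y : R2) : ℂ :=
  t * (zOf x - zOf y) + t⁻¹ * (starRingEnd ℂ) (zOf x - zOf y)

/-- ζ·∂c/∂x for a matrix-valued function, entrywise -/
def zDirM {m : ℕ} (z1 z2 : ℂ) (c : R2 → Mat m) (x : R2) : Mat m :=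
  Matrix.of fun i j => z1 * pdv e1 (fun y => c y i j) x + z2 * pdv e2 (fun y => c y i j) x

def zDirV {m : ℕ} (z1 z2 : ℂ) (u : R2 → Vec m) (x : R2) : Vec m :=
  fun i => z1 * pdv e1 (fun y => u y i) x + z2 * pdv e2 (fun y => u y i) x

/-- ∂/∂z̄ of a matrix-valued function -/
def dzbarM {m : ℕ} (c : R2 → Mat m) (x : R2) : Mat m :=
  Matrix.of fun i j =>
    (pdv e1 (fun y => c y i j) x + Complex.I * pdv e2 (fun y => c y i j) x) / 2

def dzbarV {m : ℕ} (u : R2 → Vec m) (x : R2) : Vec m :=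
  fun i => (pdv e1 (fun y => u y i) x + Complex.I * pdv e2 (fun y => u y i) x) / 2

def dzM {m : ℕ} (c : R2 → Mat m) (x : R2) : Mat m :=
  Matrix.of fun i j =>
    (pdv e1 (fun y => c y i j) x - Complex.I * pdv e2 (fun y => c y i j) x) / 2

/-- the operator Π(t), matrix-valued version -/
def PiTM {m : ℕ} (t : ℂ) (f : R2 → Mat m) (x : R2) : Mat m :=
  Matrix.of fun i j => (Real.pi : ℂ)⁻¹ * ∫ y : R2, f y i j / ker t x y

def PiTV {m : ℕ} (t : ℂ) (f : R2 → Vec m) (x : R2) : Vec m :=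
  fun i => (Real.pi : ℂ)⁻¹ * ∫ y : R2, f y i / ker t x y

/-- the Cauchy transform S -/
def CauchyM {m : ℕ} (f : R2 → Mat m) (x : R2) : Mat m :=
  Matrix.of fun i j => (Real.pi : ℂ)⁻¹ * ∫ y : R2, f y i j / (zOf x - zOf y)

def CauchyV {m : ℕ} (f : R2 → Vec m) (x : R2) : Vec m :=
  fun i => (Real.pi : ℂ)⁻¹ * ∫ y : R2, f y i / (zOf x - zOf y)

/-- the contour integral ∮_{|t|=ρ} F(t) dt -/
def circIntM {m : ℕ} (F : ℂ → Mat m) (ρ : ℝ) : Mat m :=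
  Matrix.of fun i j => ∫ φ in (0:ℝ)..(2*Real.pi),
    F ((ρ:ℂ) * Complex.exp (Complex.I * φ)) i j * (Complex.I * ρ * Complex.exp (Complex.I * φ))

def circIntV {m : ℕ} (F : ℂ → Vec m) (ρ : ℝ) : Vec m :=
  fun i => ∫ φ in (0:ℝ)..(2*Real.pi),
    F ((ρ:ℂ) * Complex.exp (Complex.I * φ)) i * (Complex.I * ρ * Complex.exp (Complex.I * φ))

def MatSmooth {m : ℕ} (c : R2 → Mat m) : Prop := ∀ i j, ContDiff ℝ (⊤ : ℕ∞) (fun x => c x i j)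

def SuppIn {m : ℕ} (A : R2 → Mat m) (R : ℝ) : Prop := ∀ x : R2, R ≤ ‖x‖ → A x = 0

/-- A(x,ζ) = ζ₁A₁(x)+ζ₂A₂(x)+A₀(x) -/
def Acomb {m : ℕ} (A0 A1 A2 : R2 → Mat m) (z1 z2 : ℂ) (x : R2) : Mat m :=
  z1 • A1 x + z2 • A2 x + A0 x

/-- c solves θ·∂c/∂x = M(x)c along every line in direction θ -/
def Transport {m : ℕ} (M : R2 → Mat m) (θ : R2) (c : R2 → Mat m) : Prop :=
  ∀ x : R2, ∀ i j, HasDerivAt (fun s : ℝ => c (x + s • θ) i j) ((M x * c x) i j) 0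

open Classical in
/-- extension at infinity: `extInf F L` equals `F (1/s)` for `s ≠ 0` and `L` at `s = 0`;
analyticity of this at `0` encodes analyticity of `F` at `t = ∞` with value `L`. -/
def extInf {m : ℕ} (F : ℂ → Mat m) (L : Mat m) (s : ℂ) : Mat m := if s = 0 then L else F s⁻¹

set_option linter.unusedSectionVars false

namespace PlanarTransport

section Torus
open UnitAddTorus
variable {E : Type*} [NormedAddCommGroup E] [NormedSpace ℂ E]

local instance : MeasureSpace UnitAddCircle := ⟨AddCircle.haarAddCircle⟩
local instance : Measure.IsAddHaarMeasure (volume : Measure UnitAddCircle) :=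
  inferInstanceAs (Measure.IsAddHaarMeasure AddCircle.haarAddCircle)
local instance : IsProbabilityMeasure (volume : Measure UnitAddCircle) :=
  inferInstanceAs (IsProbabilityMeasure AddCircle.haarAddCircle)

/-- The projection of `ℝ^d` onto the torus. -/
def torusMk {d : Type*} (x : d → ℝ) : UnitAddTorus d := fun i => (x i : UnitAddCircle)

/-- Periodicity with respect to the integer lattice. -/
def LatticePeriodic {d F : Type*} (f : (d → ℝ) → F) : Prop :=
  ∀ (x : d → ℝ) (m : d → ℤ), f (fun i => x i + m i) = f x

/-- The function on the torus induced by a lattice-periodic function. -/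
def torusLift {d F : Type*} (f : (d → ℝ) → F) (t : UnitAddTorus d) : F :=
  f fun i => (AddCircle.equivIoc (1 : ℝ) 0 (t i)).1

lemma torusLift_mk {d F : Type*} {f : (d → ℝ) → F} (hf : LatticePeriodic f) (x : d → ℝ) :
    torusLift f (torusMk x) = f x := by
  have h : ∀ i, ∃ m : ℤ, (AddCircle.equivIoc (1 : ℝ) 0 (x i : UnitAddCircle)).1 = x i + m := by
    intro i
    have h1 : (((AddCircle.equivIoc (1 : ℝ) 0 (x i : UnitAddCircle)).1 : ℝ) : UnitAddCircle)
        = (x i : UnitAddCircle) := (AddCircle.equivIoc (1 : ℝ) 0).symm_apply_apply _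
    rw [QuotientAddGroup.eq] at h1
    obtain ⟨m, hm⟩ := AddSubgroup.mem_zmultiples_iff.1 h1
    refine ⟨-m, ?_⟩
    simp at hm
    push_cast
    linarith
  choose m hm using h
  unfold torusLift torusMk
  simp_rw [hm]
  exact hf x m

lemma isOpenQuotientMap_torusMk {d : Type*} : IsOpenQuotientMap (torusMk (d := d)) := by
  have : ∀ i : d, IsOpenQuotientMap (fun x : ℝ => (x : UnitAddCircle)) := fun _ =>
    QuotientAddGroup.isOpenQuotientMap_mk
  exact IsOpenQuotientMap.piMap this

lemma continuous_torusLift {d F : Type*} [TopologicalSpace F] {f : (d → ℝ) → F}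
    (hf : LatticePeriodic f) (hc : Continuous f) : Continuous (torusLift f) := by
  rw [isOpenQuotientMap_torusMk.isQuotientMap.continuous_iff]
  convert hc using 1
  funext x
  exact torusLift_mk hf x

variable {d : Type*} [Fintype d]

lemma mFourier_torusMk (n : d → ℤ) (x : d → ℝ) :
    mFourier n (torusMk x) = Complex.exp (2 * Real.pi * I * ∑ i, n i * x i) := by
  simp only [mFourier, torusMk, ContinuousMap.coe_mk, fourier_coe_apply]
  rw [← Complex.exp_sum]
  congr 1
  push_cast
  rw [Finset.mul_sum]
  refine Finset.sum_congr rfl fun i _ => ?_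
  ring

lemma mFourier_add_apply (n : d → ℤ) (s t : UnitAddTorus d) :
    mFourier n (s + t) = mFourier n s * mFourier n t := by
  simp only [mFourier, ContinuousMap.coe_mk, ← Finset.prod_mul_distrib, Pi.add_apply]
  refine Finset.prod_congr rfl fun i _ => ?_
  rw [fourier_apply, fourier_apply, fourier_apply, smul_add, AddCircle.toCircle_add]
  simp

lemma mFourierCoeff_translate (F : UnitAddTorus d → E) (n : d → ℤ) (a : UnitAddTorus d) :
    mFourierCoeff (fun t => F (t + a)) n = mFourier n a • mFourierCoeff F n := by
  have h : mFourierCoeff (fun t => F (t + a)) n =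
      ∫ t, (fun t => (mFourier n a * mFourier (-n) t) • F t) (t + a) := by
    unfold mFourierCoeff
    congr 1
    funext t
    simp only
    rw [mFourier_add_apply (-n) t a, mFourier_neg (n := n) (x := a), mul_left_comm]
    have : mFourier n a * (starRingEnd ℂ) (mFourier n a) = 1 := by
      rw [Complex.mul_conj]
      have : ‖mFourier n a‖ = 1 := by
        simp [mFourier, fourier_apply, norm_prod, Circle.norm_coe]
      rw [Complex.normSq_eq_norm_sq, this]; simp
    rw [this, mul_one]
  rw [h, integral_add_right_eq_self (fun t => (mFourier n a * mFourier (-n) t) • F t) a]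
  simp_rw [mul_smul]
  rw [integral_smul]
  rfl

lemma mFourierCoeff_norm_le (F : UnitAddTorus d → E) (n : d → ℤ) {C : ℝ} (hC : ∀ t, ‖F t‖ ≤ C) :
    ‖mFourierCoeff F n‖ ≤ C := by
  have := norm_integral_le_of_norm_le_const (μ := (volume : Measure (UnitAddTorus d)))
    (f := fun t => mFourier (-n) t • F t) (C := C) (.of_forall fun t => by
      rw [norm_smul]
      have : ‖mFourier (-n) t‖ = 1 := by
        simp [mFourier, fourier_apply, norm_prod, Circle.norm_coe]
      rw [this, one_mul]; exact hC t)
  rw [mFourierCoeff]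
  simpa using this

lemma LatticePeriodic.bounded {f : (d → ℝ) → E} (hf : LatticePeriodic f) (hc : Continuous f) :
    ∃ C, ∀ x, ‖f x‖ ≤ C := by
  obtain ⟨C, hC⟩ := (isCompact_univ (X := UnitAddTorus d)).exists_bound_of_continuousOn
    (continuous_torusLift hf hc).continuousOn
  exact ⟨C, fun x => by simpa [torusLift_mk hf] using hC (torusMk x) (Set.mem_univ _)⟩

/-- The partial derivative along the `i`-th coordinate. -/
def coordDeriv [DecidableEq d] (i : d) (f : (d → ℝ) → E) (x : d → ℝ) : E :=
  fderiv ℝ f x (Pi.single i 1)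

lemma LatticePeriodic.coordDeriv [DecidableEq d] {f : (d → ℝ) → E} (hf : LatticePeriodic f)
    (i : d) : LatticePeriodic (coordDeriv i f) := by
  intro x m
  unfold PlanarTransport.coordDeriv
  have : f = fun y => f (y + fun i => (m i : ℝ)) := by
    funext y; exact (hf y m).symm
  conv_rhs => rw [this]
  rw [fderiv_comp_add_right]
  rfl

lemma contDiff_coordDeriv [DecidableEq d] {f : (d → ℝ) → E} (hf : ContDiff ℝ (⊤ : ℕ∞) f) (i : d) :
    ContDiff ℝ (⊤ : ℕ∞) (coordDeriv i f) :=
  (hf.fderiv_right (m := ((⊤ : ℕ∞) : WithTop ℕ∞)) (by simp)).clm_apply contDiff_const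

lemma mFourierCoeff_coordDeriv [CompleteSpace E] [DecidableEq d] {f : (d → ℝ) → E}
    (hp : LatticePeriodic f)
    (hf : ContDiff ℝ (⊤ : ℕ∞) f) (i : d) (n : d → ℤ) :
    mFourierCoeff (torusLift (coordDeriv i f)) n =
      (2 * Real.pi * I * n i) • mFourierCoeff (torusLift f) n := by
  have hc := continuous_torusLift hp hf.continuous
  have hc' := continuous_torusLift (hp.coordDeriv i) (contDiff_coordDeriv hf i).continuous
  obtain ⟨C, hC⟩ := (hp.coordDeriv i).bounded (contDiff_coordDeriv hf i).continuous
  set a : ℝ → UnitAddTorus d := fun h => torusMk (h • Pi.single i 1) with ha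
  have hadd : ∀ (x : d → ℝ) h, torusMk x + a h = torusMk (x + h • Pi.single i 1) := by
    intro x h; funext j; simp [ha, torusMk]
  have hder : ∀ t h, HasDerivAt (fun h => torusLift f (t + a h))
      (torusLift (coordDeriv i f) (t + a h)) h := by
    intro t h
    obtain ⟨x, rfl⟩ := isOpenQuotientMap_torusMk.surjective t
    simp_rw [hadd, torusLift_mk hp, torusLift_mk (hp.coordDeriv i)]
    have h1 : HasDerivAt (fun h : ℝ => x + h • Pi.single i (1 : ℝ)) (Pi.single i (1 : ℝ)) h := by
      simpa using ((hasDerivAt_id h).smul_const (Pi.single i (1 : ℝ))).const_add x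
    exact ((hf.differentiable (by simp)) _).hasFDerivAt.comp_hasDerivAt h h1
  have hcont : ∀ (g : UnitAddTorus d → E), Continuous g → ∀ h,
      Continuous fun t => mFourier (-n) t • g (t + a h) := by
    intro g hg h
    exact (map_continuous _).smul (hg.comp (continuous_id.add continuous_const))
  have key := hasDerivAt_integral_of_dominated_loc_of_deriv_le
    (μ := (volume : Measure (UnitAddTorus d))) (𝕜 := ℝ)
    (F := fun h t => mFourier (-n) t • torusLift f (t + a h))
    (F' := fun h t => mFourier (-n) t • torusLift (coordDeriv i f) (t + a h))
    (x₀ := (0 : ℝ)) (bound := fun _ => C) (s := Set.univ) Filter.univ_mem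
    (.of_forall fun h => (hcont _ hc h).aestronglyMeasurable)
    ((hcont _ hc 0).integrable_of_hasCompactSupport (HasCompactSupport.of_compactSpace _))
    (hcont _ hc' 0).aestronglyMeasurable
    (.of_forall fun t h _ => by
      rw [norm_smul]
      have : ‖mFourier (-n) t‖ = 1 := by
        simp [mFourier, fourier_apply, norm_prod, Circle.norm_coe]
      rw [this, one_mul]
      obtain ⟨x, hx⟩ := isOpenQuotientMap_torusMk.surjective (t + a h)
      rw [← hx, torusLift_mk (hp.coordDeriv i)]
      exact hC x)
    (integrable_const _)
    (.of_forall fun t h _ => (hder t h).const_smul _)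
  have h0 : a 0 = 0 := by funext j; simp [ha, torusMk]
  have e1 : (fun h => ∫ t, mFourier (-n) t • torusLift f (t + a h)) =
      fun h : ℝ => Complex.exp (2 * Real.pi * I * n i * h) • mFourierCoeff (torusLift f) n := by
    funext h
    have := mFourierCoeff_translate (torusLift f) n (a h)
    rw [mFourierCoeff] at this
    rw [this, ha, mFourier_torusMk]
    congr 2
    rw [mul_assoc _ (n i : ℂ)]
    congr 1
    rw [Finset.sum_eq_single i]
    · simp
    · intro j _ hj; simp [Pi.single_eq_of_ne hj]
    · simp
  have key2 := key.2
  rw [e1] at key2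
  have h3 : HasDerivAt (fun h : ℝ => Complex.exp (2 * Real.pi * I * n i * h))
      (2 * Real.pi * I * n i) 0 := by
    have := ((hasDerivAt_id (0 : ℂ)).const_mul (2 * Real.pi * I * n i)).cexp
    have := this.comp_ofReal (z := 0)
    simpa using this
  have h4 := h3.smul_const (mFourierCoeff (torusLift f) n)
  have := key2.unique h4
  rw [← this]
  simp only [h0, add_zero]
  rfl

/-- The `ℓ¹` size of a frequency. -/
def freqSize (n : d → ℤ) : ℝ := ∑ i, |(n i : ℝ)|

lemma mFourierCoeff_decay [CompleteSpace E] {f : (d → ℝ) → E} (hp : LatticePeriodic f)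
    (hf : ContDiff ℝ (⊤ : ℕ∞) f) (i : d) (k : ℕ) :
    ∃ C, ∀ n : d → ℤ, |(n i : ℝ)| ^ k * ‖mFourierCoeff (torusLift f) n‖ ≤ C := by
  classical
  induction k generalizing f with
  | zero =>
    obtain ⟨C, hC⟩ := hp.bounded hf.continuous
    exact ⟨C, fun n => by 
      simpa using mFourierCoeff_norm_le (torusLift f) n (C := C) (fun t => hC _)⟩
  | succ k ih =>
    obtain ⟨C, hC⟩ := ih (hp.coordDeriv i) (contDiff_coordDeriv hf i)
    refine ⟨C, fun n => le_trans ?_ (hC n)⟩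
    rw [mFourierCoeff_coordDeriv hp hf, norm_smul, pow_succ, mul_assoc]
    have : |(n i : ℝ)| ≤ ‖(2 * Real.pi * I * n i : ℂ)‖ := by
      simp only [norm_mul, Complex.norm_ofNat, Complex.norm_real, Complex.norm_I, mul_one,
        Complex.norm_intCast, Real.norm_eq_abs, abs_of_pos Real.pi_pos]
      nlinarith [Real.pi_gt_three, abs_nonneg (n i : ℝ)]
    gcongr

lemma freqSize_nonneg (n : d → ℤ) : 0 ≤ freqSize n :=
  Finset.sum_nonneg fun _ _ => abs_nonneg _

lemma summable_freqSize :
    Summable fun n : Fin 4 → ℤ => ((1 + freqSize n) ^ 8)⁻¹ := by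
  have h1 : Summable fun k : ℤ => ((1 + |(k : ℝ)|) ^ 2)⁻¹ := by
    have := (Real.summable_one_div_int_pow (p := 2)).2 one_lt_two
    refine (((summable_of_ne_finset_zero (f := fun k : ℤ => if k = 0 then (1 : ℝ) else 0)
      (s := {0}) (by intro b hb; simp at hb; simp [hb]))).add this).of_nonneg_of_le
      (fun k => by positivity) (fun k => ?_)
    by_cases hk : k = 0
    · simp [hk]
    · have : (0 : ℝ) < |(k : ℝ)| := by positivity
      simp only [hk, if_false, zero_add, one_div]
      rw [← sq_abs (k : ℝ)]
      gcongr
      linarith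
  have h2 := h1.mul_of_nonneg (h1.mul_of_nonneg (h1.mul_of_nonneg h1 (fun k => by positivity)
    (fun k => by positivity)) (fun k => by positivity) (fun k => by
      simp only [Pi.zero_apply]; positivity)) (fun k => by positivity) (fun k => by
      simp only [Pi.zero_apply]; positivity)
  let e : (Fin 4 → ℤ) → ℤ × ℤ × ℤ × ℤ := fun n => (n 0, n 1, n 2, n 3)
  have he : Function.Injective e := by
    intro a b h
    simp only [e, Prod.mk.injEq] at h
    funext i
    fin_cases i <;> simp [h]
  refine (h2.comp_injective he).of_nonneg_of_le (fun n => ?_) (fun n => ?_)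
  · have := freqSize_nonneg n; positivity
  · simp only [Function.comp, e]
    have hf : freqSize n = |(n 0 : ℝ)| + |(n 1 : ℝ)| + |(n 2 : ℝ)| + |(n 3 : ℝ)| := by
      simp [freqSize, Fin.sum_univ_four]
    have a0 := abs_nonneg (n 0 : ℝ)
    have a1 := abs_nonneg (n 1 : ℝ)
    have a2 := abs_nonneg (n 2 : ℝ)
    have a3 := abs_nonneg (n 3 : ℝ)
    rw [← mul_inv, ← mul_inv, ← mul_inv]
    have e8 : (1 + freqSize n) ^ 8 = (1 + freqSize n) ^ 2 * ((1 + freqSize n) ^ 2 *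
      ((1 + freqSize n) ^ 2 * (1 + freqSize n) ^ 2)) := by ring
    rw [e8]
    gcongr <;> linarith

lemma freqSize_pow_decay [CompleteSpace E] {f : (Fin 4 → ℝ) → E} (hp : LatticePeriodic f)
    (hf : ContDiff ℝ (⊤ : ℕ∞) f) (k : ℕ) :
    ∃ C, ∀ n : Fin 4 → ℤ, (1 + freqSize n) ^ k * ‖mFourierCoeff (torusLift f) n‖ ≤ C := by
  obtain ⟨C0, hC0⟩ := mFourierCoeff_decay hp hf 0 0
  have := fun i => mFourierCoeff_decay hp hf i k
  choose C hC using this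
  refine ⟨5 ^ k * (C0 + ∑ i, C i), fun n => ?_⟩
  set A := ‖mFourierCoeff (torusLift f) n‖ with hA
  have hA0 : 0 ≤ A := norm_nonneg _
  have hCi : ∀ i, 0 ≤ C i := fun i => le_trans (by positivity) (hC i n)
  have hC00 : 0 ≤ C0 := le_trans (by positivity) (hC0 n)
  have hsum : ∀ i, C i ≤ ∑ i, C i := fun i =>
    Finset.single_le_sum (fun j _ => hCi j) (Finset.mem_univ i)
  have hs0 : 0 ≤ ∑ i, C i := Finset.sum_nonneg fun j _ => hCi j
  have hf : freqSize n = |(n 0 : ℝ)| + |(n 1 : ℝ)| + |(n 2 : ℝ)| + |(n 3 : ℝ)| := by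
    simp [freqSize, Fin.sum_univ_four]
  have hmax : ∃ b : ℝ, 0 ≤ b ∧ 1 + freqSize n ≤ 5 * b ∧ b ^ k * A ≤ C0 + ∑ i, C i := by
    by_cases h : ∃ i, ∀ j, |(n j : ℝ)| ≤ |(n i : ℝ)| ∧ 1 ≤ |(n i : ℝ)|
    · obtain ⟨i, hi⟩ := h
      refine ⟨|(n i : ℝ)|, abs_nonneg _, ?_, (hC i n).trans ((hsum i).trans (by linarith))⟩
      have := hi 0; have := hi 1; have := hi 2; have := hi 3
      rw [hf]; linarith
    · refine ⟨1, zero_le_one, ?_, ?_⟩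
      · obtain ⟨i, hi⟩ := Finite.exists_max (fun i => |(n i : ℝ)|)
        have h1 : |(n i : ℝ)| < 1 := by
          by_contra hcon
          exact h ⟨i, fun j => ⟨hi j, not_lt.1 hcon⟩⟩
        have := hi 0; have := hi 1; have := hi 2; have := hi 3
        rw [hf]; linarith
      · have := hC0 n
        rw [pow_zero, one_mul] at this
        rw [one_pow, one_mul]; linarith
  obtain ⟨b, hb, h1, h2⟩ := hmax
  calc (1 + freqSize n) ^ k * A ≤ (5 * b) ^ k * A := by
        have := freqSize_nonneg n
        gcongr
    _ = 5 ^ k * (b ^ k * A) := by rw [mul_pow]; ring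
    _ ≤ _ := by gcongr

/-- Smooth lattice-periodic functions are sums of rapidly convergent Fourier series. -/
theorem exists_fourier_series [CompleteSpace E] {f : (Fin 4 → ℝ) → E} (hp : LatticePeriodic f)
    (hf : ContDiff ℝ (⊤ : ℕ∞) f) :
    ∃ c : (Fin 4 → ℤ) → E, (∀ N : ℕ, Summable fun n => (1 + freqSize n) ^ N * ‖c n‖) ∧
      ∀ x : Fin 4 → ℝ,
        HasSum (fun n => Complex.exp (2 * Real.pi * I * ∑ i, n i * x i) • c n) (f x) := by
  have hs : ∀ N : ℕ, Summable fun n : Fin 4 → ℤ =>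
      (1 + freqSize n) ^ N * ‖mFourierCoeff (torusLift f) n‖ := by
    intro N
    obtain ⟨C, hC⟩ := freqSize_pow_decay hp hf (N + 8)
    refine (summable_freqSize.mul_left C).of_nonneg_of_le (fun n => ?_) (fun n => ?_)
    · have := freqSize_nonneg n; positivity
    · have h0 : 0 < 1 + freqSize n := by have := freqSize_nonneg n; linarith
      rw [← div_eq_mul_inv, le_div_iff₀ (by positivity)]
      refine le_trans (le_of_eq ?_) (hC n)
      ring
  refine ⟨mFourierCoeff (torusLift f), hs, fun x => ?_⟩
  have hs0 : Summable fun n => ‖mFourierCoeff (torusLift f) n‖ := by simpa using hs 0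
  have hsum : Summable fun n : Fin 4 → ℤ =>
      Complex.exp (2 * Real.pi * I * ∑ i, n i * x i) • mFourierCoeff (torusLift f) n := by
    refine Summable.of_norm_bounded hs0 fun n => ?_
    rw [norm_smul, ← mFourier_torusMk]
    have : ‖mFourier n (torusMk x)‖ = 1 := by
      simp [mFourier, fourier_apply, norm_prod, Circle.norm_coe]
    rw [this, one_mul]
  convert hsum.hasSum using 1
  refine (SeparatingDual.eq_iff_forall_dual_eq (R := ℂ)).2 fun ℓ => ?_
  have hcont := continuous_torusLift hp hf.continuous
  let G : C(UnitAddTorus (Fin 4), ℂ) := ⟨fun t => ℓ (torusLift f t), ℓ.continuous.comp hcont⟩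
  have hG : ∀ n, mFourierCoeff G n = ℓ (mFourierCoeff (torusLift f) n) := by
    intro n
    unfold mFourierCoeff
    rw [← ContinuousLinearMap.integral_comp_comm]
    · simp [G]
    · exact ((map_continuous _).smul hcont).integrable_of_hasCompactSupport
        (HasCompactSupport.of_compactSpace _)
  have hGs : Summable (mFourierCoeff G) := by
    refine Summable.of_norm_bounded (hs0.mul_left ‖ℓ‖) fun n => ?_
    rw [hG]; exact ℓ.le_opNorm _
  have h1 := hasSum_mFourier_series_apply_of_summable hGs (torusMk x)
  have h2 := ℓ.hasSum hsum.hasSum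
  have h3 : G (torusMk x) = ℓ (f x) := by simp [G, torusLift_mk hp]
  rw [← h3]
  have h4 : (fun n => mFourierCoeff G n • mFourier n (torusMk x)) = fun n =>
      ℓ (Complex.exp (2 * Real.pi * I * ∑ i, n i * x i) • mFourierCoeff (torusLift f) n) := by
    funext n
    simp [hG, mFourier_torusMk, mul_comm]
  rw [h4] at h1
  exact h1.unique h2

/-- Absolutely convergent Fourier series are determined by their sum. -/
theorem fourier_series_unique [CompleteSpace E] {c : (d → ℤ) → E} (hc : Summable fun n => ‖c n‖)
    (h : ∀ x : d → ℝ,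
      HasSum (fun n => Complex.exp (2 * Real.pi * I * ∑ i, n i * x i) • c n) 0) : c = 0 := by
  classical
  funext m
  have hn1 : ∀ (n : d → ℤ) t, ‖mFourier n t‖ = 1 := fun n t => by
    simp [mFourier, fourier_apply, norm_prod, Circle.norm_coe]
  have hcont : ∀ n, Continuous fun t => mFourier (-m) t • mFourier n t • c n := fun n =>
    (map_continuous _).smul ((map_continuous _).smul continuous_const)
  have hsum := hasSum_integral_of_summable_integral_norm
    (μ := (volume : Measure (UnitAddTorus d)))
    (F := fun n t => mFourier (-m) t • mFourier n t • c n)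
    (fun n => (hcont n).integrable_of_hasCompactSupport (HasCompactSupport.of_compactSpace _))
    (by simpa [norm_smul, hn1] using hc)
  have hz : ∀ t, (∑' n, mFourier (-m) t • mFourier n t • c n) = 0 := by
    intro t
    obtain ⟨x, rfl⟩ := isOpenQuotientMap_torusMk.surjective t
    have := (h x).const_smul (mFourier (-m) (torusMk x))
    simp_rw [← mFourier_torusMk, smul_zero] at this
    exact this.tsum_eq
  simp_rw [hz, integral_zero] at hsum
  have hval : ∀ n, (∫ t, mFourier (-m) t • mFourier n t • c n) = if n = m then c m else 0 := by
    intro n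
    simp_rw [← mul_smul]
    rw [integral_smul_const]
    have ho := (orthonormal_iff_ite.mp (orthonormal_mFourier (d := d))) m n
    simp only [ContinuousMap.inner_toLp, ← mFourier_neg] at ho
    have : (∫ t, mFourier (-m) t * mFourier n t) = if m = n then 1 else 0 := by
      rw [← ho]; congr 1; funext t; rw [mul_comm]
    rw [this]
    by_cases hmn : n = m
    · simp [hmn]
    · simp [hmn, Ne.symm hmn]
  simp_rw [hval] at hsum
  exact (hasSum_ite_eq m (c m)).unique hsum

end Torus

section Hardy
variable {E : Type*} [NormedAddCommGroup E] [NormedSpace ℂ E] [CompleteSpace E]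

lemma circleIntegral_zpow_smul (j : ℤ) (v : E) :
    (∮ s in C(0, 1), s ^ j • v) = if j = -1 then (2 * Real.pi * I : ℂ) • v else 0 := by
  rw [circleIntegral.integral_smul_const]
  split_ifs with h
  · subst h
    have := circleIntegral.integral_sub_center_inv (0 : ℂ) (R := 1) one_ne_zero
    simp only [sub_zero] at this
    simp only [_root_.zpow_neg_one, this]
  · have := circleIntegral.integral_sub_zpow_of_ne h (0 : ℂ) 0 1
    simp only [sub_zero] at this
    rw [this, zero_smul]

/-- A function in the disc algebra with absolutely convergent boundary Fourier series is the sum of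
its power series on the closed disc. -/
theorem hardy {h : ℂ → E} (hc : ContinuousOn h (Metric.closedBall 0 1))
    (hd : DifferentiableOn ℂ h (Metric.ball 0 1)) {a : ℤ → E} (ha : Summable fun k => ‖a k‖)
    (hs : ∀ s : ℂ, ‖s‖ = 1 → HasSum (fun k : ℤ => s ^ k • a k) (h s)) :
    (∀ k < 0, a k = 0) ∧
      ∀ s : ℂ, ‖s‖ ≤ 1 → HasSum (fun k : ℕ => s ^ k • a k) (h s) := by
  have hneg : ∀ k < 0, a k = 0 := by
    intro k hk
    obtain ⟨j, rfl⟩ : ∃ j : ℕ, k = -1 - j := ⟨(-1 - k).toNat, by omega⟩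
    have hz : (∮ s in C(0, 1), s ^ j • h s) = 0 := by
      refine Complex.circleIntegral_eq_zero_of_differentiable_on_off_countable zero_le_one
        Set.countable_empty ?_ ?_
      · exact (continuous_pow j).continuousOn.smul hc
      · intro z hz
        exact (differentiableAt_pow j).smul
          ((hd z hz.1).differentiableAt (Metric.isOpen_ball.mem_nhds hz.1))
    have hsum : HasSum (fun k : ℤ => ∮ s in C(0, 1), s ^ ((j : ℤ) + k) • a k)
        (∮ s in C(0, 1), s ^ j • h s) := by
      refine intervalIntegral.hasSum_integral_of_dominated_convergence
        (bound := fun k _ => ‖a k‖) (fun k => ?_) (fun k => ?_) ?_ ?_ ?_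
      · refine Continuous.aestronglyMeasurable ?_
        have : ∀ θ, circleMap 0 1 θ ≠ 0 := fun θ => circleMap_ne_center one_ne_zero
        simp only [deriv_circleMap]
        exact ((continuous_circleMap 0 1).mul continuous_const).smul
          (((continuous_circleMap 0 1).zpow₀ _ (fun θ => Or.inl (this θ))).smul continuous_const)
      · refine .of_forall fun θ _ => ?_
        simp [norm_smul, deriv_circleMap, circleMap]
      · exact .of_forall fun θ _ => ha
      · exact continuous_const.intervalIntegrable _ _
      · refine .of_forall fun θ _ => ?_
        refine HasSum.const_smul _ ?_
        have h1 : ‖circleMap 0 1 θ‖ = 1 := by simp [circleMap]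
        have h0 : circleMap 0 1 θ ≠ 0 := circleMap_ne_center one_ne_zero
        have := (hs _ h1).const_smul (circleMap 0 1 θ ^ j)
        convert this using 2 with k
        simp only
        rw [zpow_add₀ h0, mul_smul, zpow_natCast]
    rw [hz] at hsum
    simp_rw [circleIntegral_zpow_smul] at hsum
    have h2 : HasSum (fun k : ℤ => if (j : ℤ) + k = -1 then (2 * Real.pi * I : ℂ) • a k else 0)
        ((2 * Real.pi * I : ℂ) • a (-1 - j)) := by
      convert hasSum_ite_eq (-1 - (j : ℤ)) ((2 * Real.pi * I : ℂ) • a (-1 - j)) using 2 with k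
      by_cases hk : k = -1 - j
      · subst hk; simp
      · rw [if_neg hk, if_neg (by omega)]
    have h3 := h2.unique hsum
    exact (smul_eq_zero.1 h3).resolve_left Complex.two_pi_I_ne_zero
  refine ⟨hneg, ?_⟩
  have hnat : Summable fun k : ℕ => ‖a k‖ := ha.comp_injective Nat.cast_injective
  have hsm : ∀ s : ℂ, ‖s‖ ≤ 1 → Summable fun k : ℕ => s ^ k • a k := fun s hs1 =>
    Summable.of_norm_bounded hnat fun k => by
      rw [norm_smul, norm_pow]
      exact mul_le_of_le_one_left (norm_nonneg _) (pow_le_one₀ (norm_nonneg _) hs1)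
  set g : ℂ → E := fun s => ∑' k : ℕ, s ^ k • a k with hg
  have hgc : ContinuousOn g (Metric.closedBall 0 1) :=
    continuousOn_tsum (fun k => ((continuous_pow k).smul continuous_const).continuousOn) hnat
      fun k s hs1 => by
        rw [norm_smul, norm_pow]
        exact mul_le_of_le_one_left (norm_nonneg _)
          (pow_le_one₀ (norm_nonneg _) (by simpa using hs1))
  have hgd : DifferentiableOn ℂ g (Metric.ball 0 1) :=
    differentiableOn_tsum_of_summable_norm hnat
      (fun k => ((differentiable_pow k).smul_const _).differentiableOn) Metric.isOpen_ball
      fun k s hs1 => by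
        rw [norm_smul, norm_pow]
        exact mul_le_of_le_one_left (norm_nonneg _)
          (pow_le_one₀ (norm_nonneg _) (by simpa using (mem_ball_zero_iff.1 hs1).le))
  have hcl : closure (Metric.ball (0 : ℂ) 1) = Metric.closedBall 0 1 :=
    closure_ball 0 one_ne_zero
  have heq : Set.EqOn h g (closure (Metric.ball 0 1)) := by
    refine Complex.eqOn_closure_of_eqOn_frontier Metric.isBounded_ball
      ⟨hd, by rwa [hcl]⟩ ⟨hgd, by rwa [hcl]⟩ fun s hs1 => ?_
    rw [frontier_ball _ one_ne_zero] at hs1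
    have hs1 : ‖s‖ = 1 := by simpa using hs1
    have h1 := hs s hs1
    have h2 : HasSum (fun k : ℕ => s ^ (k : ℤ) • a k) (h s) := by
      refine (Function.Injective.hasSum_iff (f := fun k : ℤ => s ^ k • a k)
        Nat.cast_injective ?_).2 h1
      intro k hk
      have : k < 0 := by
        by_contra hcon
        exact hk ⟨k.toNat, by simp; omega⟩
      simp [hneg k this]
    simpa [hg] using h2.tsum_eq.symm
  intro s hs1
  rw [heq (by rw [hcl]; simpa using hs1)]
  exact (hsm s hs1).hasSum

end Hardy

section Operators
variable {E F : Type*} [NormedAddCommGroup E] [NormedSpace ℂ E]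
  [NormedAddCommGroup F] [NormedSpace ℂ F]
  {A : Type*} [NormedRing A] [NormedAlgebra ℂ A]

/-- A first-order differential operator with two frozen directions. -/
def firstOrder (a b : ℂ) (v w : ℂ × ℂ) (u : ℂ × ℂ → E) (p : ℂ × ℂ) : E :=
  a • fderiv ℝ u p v + b • fderiv ℝ u p w

/-- The operator `∂/∂z̄ + s² ∂/∂z`. -/
def Lop (u : ℂ × ℂ → E) (p : ℂ × ℂ) : E :=
  firstOrder ((1 + p.2 ^ 2) / 2) (I * (1 - p.2 ^ 2) / 2) (1, 0) (I, 0) u p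

/-- The Cauchy-Riemann operator in the second variable. -/
def Sbar (u : ℂ × ℂ → E) (p : ℂ × ℂ) : E :=
  firstOrder 1 (-I) (0, I) (0, 1) u p

section firstOrder
variable {a b : ℂ} {v w : ℂ × ℂ} {u u' : ℂ × ℂ → E} {p : ℂ × ℂ}

lemma firstOrder_congr (h : fderiv ℝ u p = fderiv ℝ u' p) :
    firstOrder a b v w u p = firstOrder a b v w u' p := by
  unfold firstOrder; rw [h]

lemma firstOrder_add (hu : DifferentiableAt ℝ u p) (hu' : DifferentiableAt ℝ u' p) :
    firstOrder a b v w (fun q => u q + u' q) p =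
      firstOrder a b v w u p + firstOrder a b v w u' p := by
  unfold firstOrder
  rw [fderiv_fun_add hu hu']
  simp only [_root_.add_apply, smul_add]
  abel

lemma firstOrder_const (c : E) : firstOrder a b v w (fun _ => c) p = 0 := by
  simp [firstOrder]

lemma firstOrder_sub (hu : DifferentiableAt ℝ u p) (hu' : DifferentiableAt ℝ u' p) :
    firstOrder a b v w (fun q => u q - u' q) p =
      firstOrder a b v w u p - firstOrder a b v w u' p := by
  unfold firstOrder
  rw [fderiv_fun_sub hu hu']
  simp only [_root_.sub_apply, smul_sub]
  abel

lemma firstOrder_smul {f : ℂ × ℂ → ℂ} (hf : DifferentiableAt ℝ f p) (hu : DifferentiableAt ℝ u p) :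
    firstOrder a b v w (fun q => f q • u q) p =
      firstOrder a b v w f p • u p + f p • firstOrder a b v w u p := by
  unfold firstOrder
  rw [fderiv_fun_smul hf hu]
  simp only [_root_.add_apply, _root_.smul_apply,
    ContinuousLinearMap.smulRight_apply, smul_add, add_smul, smul_smul, smul_eq_mul,
    mul_comm (f p)]
  abel

lemma firstOrder_mul {f g : ℂ × ℂ → A} (hf : DifferentiableAt ℝ f p)
    (hg : DifferentiableAt ℝ g p) :
    firstOrder a b v w (fun q => f q * g q) p =
      firstOrder a b v w f p * g p + f p * firstOrder a b v w g p := by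
  unfold firstOrder
  rw [fderiv_fun_mul' hf hg]
  simp only [_root_.add_apply, _root_.smul_apply, smul_add, add_mul,
    mul_add, smul_mul_assoc, mul_smul_comm, smul_eq_mul, MulOpposite.smul_eq_mul_unop,
    MulOpposite.unop_op]
  abel

lemma firstOrder_comp {Φ : E → F} {Φ' : E →L[ℂ] F} (hΦ : HasFDerivAt Φ Φ' (u p))
    (hu : DifferentiableAt ℝ u p) :
    firstOrder a b v w (fun q => Φ (u q)) p = Φ' (firstOrder a b v w u p) := by
  have h := (hΦ.restrictScalars ℝ).comp p hu.hasFDerivAt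
  unfold firstOrder
  rw [show (fun q => Φ (u q)) = Φ ∘ u from rfl, h.fderiv]
  simp

end firstOrder

lemma fderiv_eq_of_eqOn {u u' : ℂ × ℂ → E} {U : Set ℂ} (hU : IsOpen U) {z s : ℂ} (hz : z ∈ U)
    (hs : ‖s‖ ≤ 1) (hu : DifferentiableAt ℝ u (z, s)) (hu' : DifferentiableAt ℝ u' (z, s))
    (h : ∀ z ∈ U, ∀ s, ‖s‖ ≤ 1 → u (z, s) = u' (z, s)) :
    fderiv ℝ u (z, s) = fderiv ℝ u' (z, s) := by
  have hun : UniqueDiffWithinAt ℝ (U ×ˢ Metric.closedBall (0 : ℂ) 1) (z, s) := by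
    refine (hU.uniqueDiffWithinAt hz).prod ?_
    refine uniqueDiffOn_convex (convex_closedBall (0 : ℂ) 1) ?_ s (by simpa using hs)
    rw [interior_closedBall _ one_ne_zero]
    exact ⟨0, by simp⟩
  rw [← hu.fderivWithin hun, ← hu'.fderivWithin hun]
  refine fderivWithin_congr (fun q hq => h q.1 hq.1 q.2 (by simpa using hq.2)) ?_
  exact h z hz s hs

lemma Lop_eq_of_eqOn {u u' : ℂ × ℂ → E} {U : Set ℂ} (hU : IsOpen U) {z s : ℂ} (hz : z ∈ U)
    (hs : ‖s‖ ≤ 1) (hu : DifferentiableAt ℝ u (z, s)) (hu' : DifferentiableAt ℝ u' (z, s))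
    (h : ∀ z ∈ U, ∀ s, ‖s‖ ≤ 1 → u (z, s) = u' (z, s)) : Lop u (z, s) = Lop u' (z, s) :=
  firstOrder_congr (fderiv_eq_of_eqOn hU hz hs hu hu' h)

/-- Functions smooth near every point of `U × closedBall 0 1` and holomorphic in the second
variable there. -/
def SmH (U : Set ℂ) (u : ℂ × ℂ → E) : Prop :=
  ∀ z ∈ U, ∀ s : ℂ, ‖s‖ ≤ 1 → ContDiffAt ℝ (⊤ : ℕ∞) u (z, s) ∧ Sbar u (z, s) = 0

namespace SmH
variable {U : Set ℂ} {u u' : ℂ × ℂ → E}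

lemma contDiffAt (h : SmH U u) {z s : ℂ} (hz : z ∈ U) (hs : ‖s‖ ≤ 1) :
    ContDiffAt ℝ (⊤ : ℕ∞) u (z, s) := (h z hz s hs).1

lemma diff (h : SmH U u) {z s : ℂ} (hz : z ∈ U) (hs : ‖s‖ ≤ 1) :
    DifferentiableAt ℝ u (z, s) := (h z hz s hs).1.differentiableAt (by simp)

lemma mono (h : SmH U u) {V : Set ℂ} (hV : V ⊆ U) : SmH V u := fun z hz => h z (hV hz)

lemma const (c : E) : SmH U (fun _ => c) := fun _ _ _ _ =>
  ⟨contDiffAt_const, firstOrder_const c⟩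

lemma add (h : SmH U u) (h' : SmH U u') : SmH U (fun p => u p + u' p) := fun z hz s hs =>
  ⟨(h.contDiffAt hz hs).add (h'.contDiffAt hz hs), by
    unfold Sbar
    rw [firstOrder_add (h.diff hz hs) (h'.diff hz hs)]
    have h1 := (h z hz s hs).2
    have h2 := (h' z hz s hs).2
    unfold Sbar at h1 h2
    rw [h1, h2, add_zero]⟩

lemma sub (h : SmH U u) (h' : SmH U u') : SmH U (fun p => u p - u' p) := fun z hz s hs =>
  ⟨(h.contDiffAt hz hs).sub (h'.contDiffAt hz hs), by
    unfold Sbar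
    rw [firstOrder_sub (h.diff hz hs) (h'.diff hz hs)]
    have h1 := (h z hz s hs).2
    have h2 := (h' z hz s hs).2
    unfold Sbar at h1 h2
    rw [h1, h2, sub_zero]⟩

lemma smul {f : ℂ × ℂ → ℂ} (hf : SmH U f) (h : SmH U u) : SmH U (fun p => f p • u p) :=
  fun z hz s hs =>
  ⟨(hf.contDiffAt hz hs).smul (h.contDiffAt hz hs), by
    unfold Sbar
    rw [firstOrder_smul (hf.diff hz hs) (h.diff hz hs)]
    have h1 := (h z hz s hs).2
    have h2 := (hf z hz s hs).2
    unfold Sbar at h1 h2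
    rw [h1, h2, zero_smul, smul_zero, add_zero]⟩

lemma mul {f g : ℂ × ℂ → A} (hf : SmH U f) (hg : SmH U g) : SmH U (fun p => f p * g p) :=
  fun z hz s hs =>
  ⟨(hf.contDiffAt hz hs).mul (hg.contDiffAt hz hs), by
    unfold Sbar
    rw [firstOrder_mul (hf.diff hz hs) (hg.diff hz hs)]
    have h1 := (hf z hz s hs).2
    have h2 := (hg z hz s hs).2
    unfold Sbar at h1 h2
    rw [h1, h2, zero_mul, mul_zero, add_zero]⟩

lemma comp {Φ : E → F} (h : SmH U u)
    (hΦ : ∀ z ∈ U, ∀ s : ℂ, ‖s‖ ≤ 1 → ContDiffAt ℂ (⊤ : ℕ∞) Φ (u (z, s))) :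
    SmH U (fun p => Φ (u p)) := fun z hz s hs =>
  ⟨((hΦ z hz s hs).restrict_scalars ℝ).comp (z, s) (h.contDiffAt hz hs), by
    unfold Sbar
    rw [firstOrder_comp ((hΦ z hz s hs).differentiableAt (by simp)).hasFDerivAt (h.diff hz hs)]
    have h1 := (h z hz s hs).2
    unfold Sbar at h1
    rw [h1, map_zero]⟩

lemma inverse [CompleteSpace A] {f : ℂ × ℂ → A} (hf : SmH U f)
    (hu : ∀ z ∈ U, ∀ s : ℂ, ‖s‖ ≤ 1 → IsUnit (f (z, s))) :
    SmH U (fun p => Ring.inverse (f p)) :=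
  hf.comp fun z hz s hs => by
    obtain ⟨x, hx⟩ := hu z hz s hs
    rw [← hx]
    exact contDiffAt_ringInverse ℂ x

lemma of_fst {g : ℂ → E} (hg : ContDiff ℝ (⊤ : ℕ∞) g) : SmH U (fun p => g p.1) :=
  fun z hz s hs => ⟨(hg.comp contDiff_fst).contDiffAt, by
    have h1 : HasFDerivAt (fun p : ℂ × ℂ => g p.1)
        ((fderiv ℝ g z).comp (ContinuousLinearMap.fst ℝ ℂ ℂ)) (z, s) :=
      HasFDerivAt.comp (z, s) ((hg.differentiable (by simp) z).hasFDerivAt) hasFDerivAt_fst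
    simp [Sbar, firstOrder, h1.fderiv]⟩

lemma congr_of_eventuallyEq (h : SmH U u)
    (he : ∀ z ∈ U, ∀ s : ℂ, ‖s‖ ≤ 1 → u' =ᶠ[𝓝 (z, s)] u) : SmH U u' := fun z hz s hs =>
  ⟨(h.contDiffAt hz hs).congr_of_eventuallyEq (he z hz s hs), by
    unfold Sbar
    rw [firstOrder_congr (he z hz s hs).fderiv_eq]
    exact (h z hz s hs).2⟩

lemma congr (hU : IsOpen U) (h : SmH U u) (he : ∀ z ∈ U, ∀ s, u' (z, s) = u (z, s)) : SmH U u' :=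
  h.congr_of_eventuallyEq fun z hz s _ => by
    filter_upwards [(hU.preimage continuous_fst).mem_nhds (show (z, s).1 ∈ U from hz)] with q hq
    exact he q.1 hq q.2

lemma union {V : Set ℂ} (h : SmH U u) (h' : SmH V u) : SmH (U ∪ V) u := by
  rintro z (hz | hz) s hs
  · exact h z hz s hs
  · exact h' z hz s hs

/-- Multiplication by a cutoff extends functions by zero. -/
lemma cutoff (h : SmH U u) {χ : ℂ → ℝ} (hχ : ContDiff ℝ (⊤ : ℕ∞) χ) (hs : tsupport χ ⊆ U) :
    SmH Set.univ (fun p => (χ p.1 : ℂ) • u p) := by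
  have h1 : SmH (U ∪ (tsupport χ)ᶜ) (fun p => (χ p.1 : ℂ) • u p) := by
    refine union ((of_fst (g := fun z => (χ z : ℂ)) ?_).smul h) ?_
    · exact Complex.ofRealCLM.contDiff.comp hχ
    · refine (const (0 : E)).congr (isClosed_tsupport χ).isOpen_compl fun z hz s => ?_
      simp [image_eq_zero_of_notMem_tsupport hz]
  refine h1.mono fun z _ => ?_
  by_cases hz : z ∈ tsupport χ
  · exact Or.inl (hs hz)
  · exact Or.inr hz

/-- Affine substitution in the first variable. -/
lemma affine (h : SmH U u) (c l : ℂ) :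
    SmH ((fun z => c + l * z) ⁻¹' U) (fun p => u (c + l * p.1, p.2)) := by
  intro z hz s hs
  have h1 : HasFDerivAt (fun p : ℂ × ℂ => (c + l * p.1, p.2))
      (((l • ContinuousLinearMap.fst ℝ ℂ ℂ)).prod (ContinuousLinearMap.snd ℝ ℂ ℂ)) (z, s) := by
    refine HasFDerivAt.prodMk ?_ hasFDerivAt_snd
    exact (hasFDerivAt_fst.const_mul l).const_add c
  have h2 := HasFDerivAt.comp (z, s) (h.diff (z := c + l * z) hz hs).hasFDerivAt h1
  refine ⟨(h.contDiffAt (z := c + l * z) hz hs).comp (z, s) ?_, ?_⟩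
  · exact ((contDiff_const.add (contDiff_const.mul contDiff_fst)).prodMk contDiff_snd).contDiffAt
  · have h3 := (h _ hz s hs).2
    unfold Sbar firstOrder at h3 ⊢
    rw [show (fun p : ℂ × ℂ => u (c + l * p.1, p.2)) = u ∘ fun p => (c + l * p.1, p.2) from rfl,
      h2.fderiv]
    simpa using h3

end SmH

lemma Lop_affine {U : Set ℂ} {u : ℂ × ℂ → E} (h : SmH U u) (c : ℂ) (l : ℝ) {z s : ℂ}
    (hz : c + l * z ∈ U) (hs : ‖s‖ ≤ 1) :
    Lop (fun p => u (c + l * p.1, p.2)) (z, s) = (l : ℂ) • Lop u (c + l * z, s) := by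
  have h1 : HasFDerivAt (fun p : ℂ × ℂ => (c + l * p.1, p.2))
      ((((l : ℂ) • ContinuousLinearMap.fst ℝ ℂ ℂ)).prod (ContinuousLinearMap.snd ℝ ℂ ℂ)) (z, s) := by
    refine HasFDerivAt.prodMk ?_ hasFDerivAt_snd
    exact (hasFDerivAt_fst.const_mul (l : ℂ)).const_add c
  have h2 := HasFDerivAt.comp (z, s) (h.diff hz hs).hasFDerivAt h1
  have key : ∀ v : ℂ, fderiv ℝ u (c + l * z, s) ((l : ℂ) * v, 0) =
      (l : ℂ) • fderiv ℝ u (c + l * z, s) (v, 0) := by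
    intro v
    have h3 := (fderiv ℝ u (c + l * z, s)).map_smul l (v, 0)
    rw [Prod.smul_mk, smul_zero, Complex.real_smul] at h3
    rw [h3, Complex.coe_smul]
  unfold Lop firstOrder
  rw [show (fun p : ℂ × ℂ => u (c + l * p.1, p.2)) = u ∘ fun p => (c + l * p.1, p.2) from rfl,
    h2.fderiv]
  have k1 := key 1
  have k2 := key I
  rw [mul_one] at k1
  simp only [ContinuousLinearMap.comp_apply, ContinuousLinearMap.prod_apply,
    _root_.smul_apply, ContinuousLinearMap.coe_fst', ContinuousLinearMap.coe_snd',
    smul_eq_mul, mul_one, k1, k2, smul_add, smul_smul]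
  simp only [mul_comm]

end Operators

section Wiener
open scoped ENNReal
variable {E : Type*} [NormedAddCommGroup E] [NormedSpace ℂ E]

lemma summable_norm_iff_enorm {J : Type*} {c : J → E} :
    (Summable fun j => ‖c j‖) ↔ ∑' j, ‖c j‖ₑ ≠ ∞ := by
  simp only [enorm, ENNReal.tsum_coe_ne_top_iff_summable, ← NNReal.summable_coe, coe_nnnorm]

/-- Push-forward of a summable family along a map of index sets. -/
def push {J K : Type*} (φ : J → K) (c : J → E) (n : K) : E := ∑' j : {j // φ j = n}, c j

lemma tsum_push_le {J K : Type*} (φ : J → K) (c : J → E) (ω : K → ℝ≥0∞) :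
    ∑' n, ω n * ‖push φ c n‖ₑ ≤ ∑' j, ω (φ j) * ‖c j‖ₑ := by
  calc ∑' n, ω n * ‖push φ c n‖ₑ ≤ ∑' n, ∑' j : {j // φ j = n}, ω (φ j) * ‖c j‖ₑ := by
        refine ENNReal.tsum_le_tsum fun n => ?_
        calc ω n * ‖push φ c n‖ₑ ≤ ω n * ∑' j : {j // φ j = n}, ‖c j‖ₑ := by
              gcongr
              exact enorm_tsum_le_tsum_enorm
          _ = ∑' j : {j // φ j = n}, ω n * ‖c j‖ₑ := ENNReal.tsum_mul_left.symm
          _ = _ := tsum_congr fun j => by rw [j.2]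
    _ = ∑' j, ω (φ j) * ‖c j‖ₑ := by
        rw [← ENNReal.tsum_sigma (fun n (j : {j // φ j = n}) => ω (φ j) * ‖c j‖ₑ)]
        exact (Equiv.sigmaFiberEquiv φ).tsum_eq fun j => ω (φ j) * ‖c j‖ₑ

lemma hasSum_push [CompleteSpace E] {J K : Type*} {φ : J → K} {c : J → E}
    (hc : ∑' j, ‖c j‖ₑ ≠ ∞) {g : K → ℂ} {f : E} (h : HasSum (fun j => g (φ j) • c j) f) :
    HasSum (fun n => g n • push φ c n) f := by
  have h1 : HasSum (fun x : Σ n, {j // φ j = n} => g (φ x.2) • c x.2) f :=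
    (Equiv.sigmaFiberEquiv φ).hasSum_iff (f := fun j => g (φ j) • c j) |>.mpr h
  have h2 : ∀ n, HasSum (fun j : {j // φ j = n} => g (φ j) • c j) (g n • push φ c n) := by
    intro n
    have h3 : Summable fun j : {j // φ j = n} => c j :=
      (Summable.of_enorm hc).comp_injective Subtype.val_injective
    have h4 : (fun j : {j // φ j = n} => g (φ j) • c j) =
        fun j : {j // φ j = n} => g n • c j :=
      funext fun j => by
        have h5 : φ j.1 = n := j.2
        simp only [h5]
    rw [h4]
    exact h3.hasSum.const_smul (g n)
  exact HasSum.sigma h1 h2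

/-- Frequencies: two integers for the plane, one natural number for the disc. -/
abbrev Idx := ℤ × ℤ × ℕ

/-- The monomials `exp(2πi(p x + q y)) s^k`. -/
def em (n : Idx) (p : ℂ × ℂ) : ℂ :=
  Complex.exp (2 * Real.pi * I * ((n.1 * p.1.re + n.2.1 * p.1.im : ℝ) : ℂ)) * p.2 ^ n.2.2

/-- Size of a frequency. -/
def sz (n : Idx) : ℕ := 1 + n.1.natAbs + n.2.1.natAbs + n.2.2

lemma one_le_sz (n : Idx) : 1 ≤ sz n := by unfold sz; omega

lemma norm_exp_two_pi (x : ℝ) : ‖Complex.exp (2 * Real.pi * I * (x : ℂ))‖ = 1 := by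
  rw [show 2 * Real.pi * I * (x : ℂ) = ((2 * Real.pi * x : ℝ) : ℂ) * I by push_cast; ring,
    Complex.norm_exp_ofReal_mul_I]

lemma norm_em_le (n : Idx) {p : ℂ × ℂ} (hp : ‖p.2‖ ≤ 1) : ‖em n p‖ ≤ 1 := by
  unfold em
  rw [norm_mul, norm_exp_two_pi, one_mul, norm_pow]
  exact pow_le_one₀ (norm_nonneg _) hp

lemma em_add (n n' : Idx) (p : ℂ × ℂ) : em (n + n') p = em n p * em n' p := by
  simp only [em, Prod.fst_add, Prod.snd_add]
  rw [pow_add, mul_mul_mul_comm, ← Complex.exp_add]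
  congr 2
  push_cast
  ring

/-- Weighted `ℓ¹` norms. -/
def wnorm (ω : Idx → ℝ≥0∞) (V : Idx → E) : ℝ≥0∞ := ∑' n, ω n * ‖V n‖ₑ

/-- The `ℓ¹` norm. -/
def l1 (V : Idx → E) : ℝ≥0∞ := ∑' n, ‖V n‖ₑ

/-- Rapidly decreasing families. -/
def Rapid (V : Idx → E) : Prop := ∀ N : ℕ, wnorm (fun n => (sz n : ℝ≥0∞) ^ N) V ≠ ∞

lemma l1_eq_wnorm (V : Idx → E) : l1 V = wnorm (fun _ => 1) V := by simp [l1, wnorm]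

lemma Rapid.l1_ne_top {V : Idx → E} (h : Rapid V) : l1 V ≠ ∞ := by
  have := h 0
  simpa [wnorm, l1] using this

lemma wnorm_mono {ω ω' : Idx → ℝ≥0∞} (h : ∀ n, ω n ≤ ω' n) (V : Idx → E) :
    wnorm ω V ≤ wnorm ω' V := ENNReal.tsum_le_tsum fun n => by gcongr; exact h n

lemma wnorm_mono_right {ω : Idx → ℝ≥0∞} {V : Idx → E} {V' : Idx → E} (h : ∀ n, ‖V n‖ ≤ ‖V' n‖) :
    wnorm ω V ≤ wnorm ω V' := ENNReal.tsum_le_tsum fun n => by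
  gcongr
  exact enorm_le_iff_norm_le.mpr (h n)

lemma wnorm_add_le (ω : Idx → ℝ≥0∞) (V V' : Idx → E) :
    wnorm ω (fun n => V n + V' n) ≤ wnorm ω V + wnorm ω V' := by
  unfold wnorm
  rw [← ENNReal.tsum_add]
  refine ENNReal.tsum_le_tsum fun n => ?_
  rw [← mul_add]
  gcongr
  exact enorm_add_le _ _

lemma wnorm_neg (ω : Idx → ℝ≥0∞) (V : Idx → E) : wnorm ω (fun n => -V n) = wnorm ω V := by
  simp [wnorm]

/-- The fundamental square. -/
def Qs : Set ℂ := {z | |z.re| ≤ 1 / 2 ∧ |z.im| ≤ 1 / 2}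

/-- `f` is the sum of the series with coefficients `V` over the square times the disc. -/
def Rep (V : Idx → E) (f : ℂ × ℂ → E) : Prop :=
  ∀ z ∈ Qs, ∀ s : ℂ, ‖s‖ ≤ 1 → HasSum (fun n => em n (z, s) • V n) (f (z, s))

lemma summable_em_smul [CompleteSpace E] {V : Idx → E} (h : l1 V ≠ ∞) {p : ℂ × ℂ}
    (hp : ‖p.2‖ ≤ 1) : Summable fun n => em n p • V n := by
  refine Summable.of_norm_bounded (summable_norm_iff_enorm.mpr h) fun n => ?_
  rw [norm_smul]
  exact mul_le_of_le_one_left (norm_nonneg _) (norm_em_le n hp)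

lemma Rep.norm_le {V : Idx → E} {f : ℂ × ℂ → E} (hr : Rep V f) {ν : ℝ≥0∞} (hV : l1 V ≤ ν)
    {z s : ℂ} (hz : z ∈ Qs) (hs : ‖s‖ ≤ 1) : ‖f (z, s)‖ₑ ≤ ν := by
  rw [← (hr z hz s hs).tsum_eq]
  refine enorm_tsum_le_tsum_enorm.trans (le_trans ?_ hV)
  refine ENNReal.tsum_le_tsum fun n => ?_
  rw [enorm_smul]
  refine mul_le_of_le_one_left zero_le ?_
  rw [← enorm_one (G := ℂ)]
  exact enorm_le_iff_norm_le.mpr (by simpa using norm_em_le n (p := (z, s)) hs)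

lemma Rep.congr {V : Idx → E} {f g : ℂ × ℂ → E} (hr : Rep V f)
    (h : ∀ z ∈ Qs, ∀ s : ℂ, ‖s‖ ≤ 1 → g (z, s) = f (z, s)) : Rep V g :=
  fun z hz s hs => by rw [h z hz s hs]; exact hr z hz s hs

lemma Rep.add {V V' : Idx → E} {f g : ℂ × ℂ → E} (hf : Rep V f) (hg : Rep V' g) :
    Rep (fun n => V n + V' n) (fun p => f p + g p) := fun z hz s hs => by
  simpa only [smul_add] using (hf z hz s hs).add (hg z hz s hs)

lemma Rep.sub {V V' : Idx → E} {f g : ℂ × ℂ → E} (hf : Rep V f) (hg : Rep V' g) :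
    Rep (fun n => V n - V' n) (fun p => f p - g p) := fun z hz s hs => by
  simpa only [smul_sub] using (hf z hz s hs).sub (hg z hz s hs)

lemma Rep.neg {V : Idx → E} {f : ℂ × ℂ → E} (hf : Rep V f) :
    Rep (fun n => -V n) (fun p => -f p) := fun z hz s hs => by
  simpa only [smul_neg] using (hf z hz s hs).neg

section conv
variable {R : Type*} [NormedRing R] [NormedAlgebra ℂ R] [Module R E] [IsBoundedSMul R E]
  [IsScalarTower ℂ R E] [SMulCommClass ℂ R E]

/-- Convolution of coefficient families. -/
def conv (a : Idx → R) (b : Idx → E) : Idx → E :=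
  push (fun x : Idx × Idx => x.1 + x.2) (fun x => a x.1 • b x.2)

lemma tsum_conv_le (a : Idx → R) (b : Idx → E) (ω : Idx → ℝ≥0∞)
    (hω : ∀ n n', ω (n + n') ≤ ω n * ω n') :
    ∑' x : Idx × Idx, ω (x.1 + x.2) * ‖a x.1 • b x.2‖ₑ ≤ wnorm ω a * wnorm ω b := by
  calc _ ≤ ∑' x : Idx × Idx, (ω x.1 * ‖a x.1‖ₑ) * (ω x.2 * ‖b x.2‖ₑ) := by
        refine ENNReal.tsum_le_tsum fun x => ?_
        rw [mul_mul_mul_comm]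
        gcongr
        · exact hω _ _
        · exact enorm_smul_le
    _ = wnorm ω a * wnorm ω b := by
        rw [ENNReal.tsum_prod (f := fun n n' => (ω n * ‖a n‖ₑ) * (ω n' * ‖b n'‖ₑ))]
        simp only [ENNReal.tsum_mul_left, ENNReal.tsum_mul_right]
        rfl

lemma wnorm_conv_le (a : Idx → R) (b : Idx → E) (ω : Idx → ℝ≥0∞)
    (hω : ∀ n n', ω (n + n') ≤ ω n * ω n') : wnorm ω (conv a b) ≤ wnorm ω a * wnorm ω b :=
  (tsum_push_le _ _ ω).trans (tsum_conv_le a b ω hω)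

lemma l1_conv_le (a : Idx → R) (b : Idx → E) : l1 (conv a b) ≤ l1 a * l1 b := by
  simpa only [l1_eq_wnorm] using wnorm_conv_le a b (fun _ => 1) (by simp)

lemma Rep.conv [CompleteSpace E] {a : Idx → R} {b : Idx → E} {f : ℂ × ℂ → R}
    {g : ℂ × ℂ → E} (hf : Rep a f) (hg : Rep b g) (ha : l1 a ≠ ∞) (hb : l1 b ≠ ∞) :
    Rep (conv a b) (fun p => f p • g p) := fun z hz s hs => by
  have hab : ∑' x : Idx × Idx, ‖a x.1 • b x.2‖ₑ ≠ ∞ := by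
    have h1 := tsum_conv_le a b (fun _ => 1) (by simp)
    simp only [one_mul, ← l1_eq_wnorm] at h1
    exact ne_top_of_le_ne_top (ENNReal.mul_ne_top ha hb) h1
  have h2 : (fun x : Idx × Idx => em (x.1 + x.2) (z, s) • a x.1 • b x.2) =
      fun x : Idx × Idx => (em x.1 (z, s) • a x.1) • (em x.2 (z, s) • b x.2) := by
    ext x
    rw [em_add, mul_smul, smul_assoc, smul_comm (a x.1) (em x.2 (z, s)) (b x.2)]
  have h3 : Summable fun x : Idx × Idx => em (x.1 + x.2) (z, s) • a x.1 • b x.2 := by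
    refine Summable.of_norm_bounded (summable_norm_iff_enorm.mpr hab) fun x => ?_
    rw [norm_smul]
    exact mul_le_of_le_one_left (norm_nonneg _) (norm_em_le _ hs)
  have h4 : HasSum (fun x : Idx × Idx => em (x.1 + x.2) (z, s) • a x.1 • b x.2)
      (f (z, s) • g (z, s)) := by
    have h5 := (hf z hz s hs).smul (hg z hz s hs) (h2 ▸ h3)
    exact h2 ▸ h5
  exact hasSum_push (φ := fun x : Idx × Idx => x.1 + x.2) (g := fun n => em n (z, s)) hab h4

end conv

/-- `f` has a series over the square times the disc with `ℓ¹` norm at most `ν`. -/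
def Bd (f : ℂ × ℂ → E) (ν : ℝ≥0∞) : Prop := ∃ V, l1 V ≤ ν ∧ l1 V ≠ ∞ ∧ Rep V f

namespace Bd
variable {f g : ℂ × ℂ → E} {ν μ : ℝ≥0∞}

lemma mono (h : Bd f ν) (hν : ν ≤ μ) : Bd f μ := by
  obtain ⟨V, h1, h2, h3⟩ := h
  exact ⟨V, h1.trans hν, h2, h3⟩

lemma congr (h : Bd f ν) (he : ∀ z ∈ Qs, ∀ s : ℂ, ‖s‖ ≤ 1 → g (z, s) = f (z, s)) : Bd g ν := by
  obtain ⟨V, h1, h2, h3⟩ := h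
  exact ⟨V, h1, h2, h3.congr he⟩

lemma norm_le (h : Bd f ν) {z s : ℂ} (hz : z ∈ Qs) (hs : ‖s‖ ≤ 1) : ‖f (z, s)‖ₑ ≤ ν := by
  obtain ⟨V, h1, h2, h3⟩ := h
  exact h3.norm_le h1 hz hs

lemma tsum [CompleteSpace E] {J : Type*} {F : J → ℂ × ℂ → E} {ν : J → ℝ≥0∞}
    (h : ∀ j, Bd (F j) (ν j)) (hν : ∑' j, ν j ≠ ∞)
    (hf : ∀ z ∈ Qs, ∀ s : ℂ, ‖s‖ ≤ 1 → HasSum (fun j => F j (z, s)) (f (z, s))) :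
    Bd f (∑' j, ν j) := by
  choose V h1 h2 h3 using h
  have h4 : ∑' x : J × Idx, ‖V x.1 x.2‖ₑ ≤ ∑' j, ν j := by
    rw [ENNReal.tsum_prod (f := fun j n => ‖V j n‖ₑ)]
    exact ENNReal.tsum_le_tsum h1
  have h5 : l1 (push Prod.snd fun x : J × Idx => V x.1 x.2) ≤ ∑' j, ν j := by
    have := tsum_push_le (Prod.snd) (fun x : J × Idx => V x.1 x.2) (fun _ => 1)
    simp only [one_mul] at this
    exact this.trans h4
  refine ⟨_, h5, ne_top_of_le_ne_top hν h5, fun z hz s hs => ?_⟩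
  have h6 : Summable fun x : J × Idx => em x.2 (z, s) • V x.1 x.2 := by
    refine Summable.of_norm_bounded
      (summable_norm_iff_enorm.mpr (ne_top_of_le_ne_top hν h4)) fun x => ?_
    rw [norm_smul]
    exact mul_le_of_le_one_left (norm_nonneg _) (norm_em_le _ hs)
  have h7 : HasSum (fun x : J × Idx => em x.2 (z, s) • V x.1 x.2) (f (z, s)) := by
    have h8 := h6.hasSum.prod_fiberwise fun j => h3 j z hz s hs
    rw [(hf z hz s hs).unique h8]
    exact h6.hasSum
  exact hasSum_push (φ := Prod.snd) (g := fun n => em n (z, s))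
    (ne_top_of_le_ne_top hν h4) h7

lemma zero : Bd (fun _ => (0 : E)) 0 :=
  ⟨fun _ => 0, by simp [l1], by simp [l1], fun z _ s _ => by simp⟩

lemma const (c : E) : Bd (fun _ => c) ‖c‖ₑ := by
  have h : l1 (fun n : Idx => if n = 0 then c else 0) = ‖c‖ₑ := by
    unfold l1
    rw [tsum_eq_single 0 (by intro n hn; simp [hn])]
    simp
  refine ⟨_, h.le, by rw [h]; exact enorm_ne_top, fun z _ s _ => ?_⟩
  have := hasSum_single (f := fun n : Idx => em n (z, s) • if n = 0 then c else 0) 0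
    (by intro n hn; simp [hn])
  simpa [em] using this

lemma add (hf : Bd f ν) (hg : Bd g μ) : Bd (fun p => f p + g p) (ν + μ) := by
  obtain ⟨V, h1, h2, h3⟩ := hf
  obtain ⟨W, k1, k2, k3⟩ := hg
  have h := wnorm_add_le (fun _ => 1) V W
  simp only [← l1_eq_wnorm] at h
  exact ⟨_, h.trans (add_le_add h1 k1), ne_top_of_le_ne_top (ENNReal.add_ne_top.mpr ⟨h2, k2⟩) h,
    h3.add k3⟩

lemma neg (hf : Bd f ν) : Bd (fun p => -f p) ν := by
  obtain ⟨V, h1, h2, h3⟩ := hf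
  exact ⟨_, by simpa [l1] using h1, by simpa [l1] using h2, h3.neg⟩

lemma sub (hf : Bd f ν) (hg : Bd g μ) : Bd (fun p => f p - g p) (ν + μ) := by
  simpa only [sub_eq_add_neg] using hf.add hg.neg

lemma smul {R : Type*} [NormedRing R] [NormedAlgebra ℂ R] [Module R E] [IsBoundedSMul R E]
    [IsScalarTower ℂ R E] [SMulCommClass ℂ R E] [CompleteSpace E] {f : ℂ × ℂ → R}
    (hf : Bd f ν) (hg : Bd g μ) : Bd (fun p => f p • g p) (ν * μ) := by
  obtain ⟨V, h1, h2, h3⟩ := hf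
  obtain ⟨W, k1, k2, k3⟩ := hg
  exact ⟨_, (l1_conv_le V W).trans (mul_le_mul' h1 k1),
    ne_top_of_le_ne_top (ENNReal.mul_ne_top h2 k2) (l1_conv_le V W), h3.conv k3 h2 k2⟩

lemma mul {A : Type*} [NormedRing A] [NormedAlgebra ℂ A] [CompleteSpace A] {f g : ℂ × ℂ → A}
    (hf : Bd f ν) (hg : Bd g μ) : Bd (fun p => f p * g p) (ν * μ) := hf.smul hg

lemma const_smul [CompleteSpace E] (c : ℂ) (hf : Bd f ν) : Bd (fun p => c • f p) (‖c‖ₑ * ν) :=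
  (const c).smul hf

end Bd

end Wiener

section Realize
open scoped ENNReal

/-- A smooth step function equal to `1` on `(-∞, 1/2]` and to `0` on `[1, ∞)`. -/
def stepFn (t : ℝ) : ℝ := Real.smoothTransition (2 * (1 - t))

lemma contDiff_stepFn : ContDiff ℝ (⊤ : ℕ∞) stepFn :=
  Real.smoothTransition.contDiff.comp (contDiff_const.mul (contDiff_const.sub contDiff_id))

lemma stepFn_eq_one {t : ℝ} (h : t ≤ 1 / 2) : stepFn t = 1 :=
  Real.smoothTransition.one_of_one_le (by linarith)

lemma stepFn_eq_zero {t : ℝ} (h : 1 ≤ t) : stepFn t = 0 :=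
  Real.smoothTransition.zero_of_nonpos (by linarith)

lemma stepFn_bound (j : ℕ) : ∃ C, ∀ t, ‖iteratedFDeriv ℝ j stepFn t‖ ≤ C := by
  cases j with
  | zero =>
    refine ⟨1, fun t => ?_⟩
    rw [norm_iteratedFDeriv_zero, Real.norm_eq_abs, abs_le]
    have h : 0 ≤ stepFn t := Real.smoothTransition.nonneg _
    exact ⟨by linarith,
      Real.smoothTransition.le_one _⟩
  | succ j =>
    have h1 : HasCompactSupport (fderiv ℝ stepFn) := by
      refine HasCompactSupport.intro (isCompact_Icc (a := (1 : ℝ) / 2) (b := 1)) fun t ht => ?_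
      rcases lt_or_ge t (1 / 2) with h | h
      · have : stepFn =ᶠ[𝓝 t] fun _ => 1 := by
          filter_upwards [Iio_mem_nhds h] with x hx using stepFn_eq_one (le_of_lt hx)
        rw [this.fderiv_eq]; simp
      · have h' : 1 < t := by
          by_contra h'
          exact ht ⟨h, not_lt.mp h'⟩
        have : stepFn =ᶠ[𝓝 t] fun _ => 0 := by
          filter_upwards [Ioi_mem_nhds h'] with x hx using stepFn_eq_zero (le_of_lt hx)
        rw [this.fderiv_eq]; simp
    have h2 : ContDiff ℝ (⊤ : ℕ∞) (fderiv ℝ stepFn) := contDiff_stepFn.fderiv_right (by simp)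
    obtain ⟨C, hC⟩ := (h2.continuous_iteratedFDeriv (m := j)
      (by exact_mod_cast le_top)).bounded_above_of_compact_support (h1.iteratedFDeriv j)
    exact ⟨C, fun t => by rw [← norm_iteratedFDeriv_fderiv]; exact hC t⟩

lemma norm_iteratedFDeriv_comp_clm_le {X Y F : Type*} [NormedAddCommGroup X] [NormedSpace ℝ X]
    [NormedAddCommGroup Y] [NormedSpace ℝ Y] [NormedAddCommGroup F] [NormedSpace ℝ F]
    (g : X →L[ℝ] Y) {f : Y → F} (hf : ContDiff ℝ (⊤ : ℕ∞) f) (x : X) (j : ℕ) :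
    ‖iteratedFDeriv ℝ j (fun x => f (g x)) x‖ ≤ ‖iteratedFDeriv ℝ j f (g x)‖ * ‖g‖ ^ j := by
  have h := g.iteratedFDeriv_comp_right hf x (i := j) (by exact_mod_cast le_top)
  rw [show (fun x => f (g x)) = f ∘ g from rfl, h]
  refine (ContinuousMultilinearMap.norm_compContinuousLinearMap_le _ _).trans ?_
  simp

/-- Cutoff of width `1/k` around the unit circle. -/
def cutK (k : ℕ) (p : ℂ × ℂ) : ℝ := stepFn (k * (Complex.normSq p.2 - 1))

lemma contDiff_normSq : ContDiff ℝ (⊤ : ℕ∞) Complex.normSq := by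
  have : (fun z : ℂ => Complex.normSq z) = fun z => Complex.reCLM z * Complex.reCLM z +
      Complex.imCLM z * Complex.imCLM z := by
    ext z; simp [Complex.normSq_apply]
  show ContDiff ℝ _ (fun z : ℂ => Complex.normSq z)
  rw [this]
  exact (Complex.reCLM.contDiff.mul Complex.reCLM.contDiff).add
    (Complex.imCLM.contDiff.mul Complex.imCLM.contDiff)

lemma contDiff_cutK (k : ℕ) : ContDiff ℝ (⊤ : ℕ∞) (cutK k) :=
  contDiff_stepFn.comp (contDiff_const.mul
    ((contDiff_normSq.comp contDiff_snd).sub contDiff_const))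

lemma cutK_bound (j : ℕ) : ∃ C, 0 ≤ C ∧ ∀ (k : ℕ) (p : ℂ × ℂ), ‖p.2‖ ≤ 2 →
    ∀ i ≤ j, ‖iteratedFDeriv ℝ i (cutK k) p‖ ≤ C * (1 + k : ℝ) ^ i := by
  choose T hT using stepFn_bound
  have hq : ContDiff ℝ (⊤ : ℕ∞) fun s : ℂ => Complex.normSq s - 1 :=
    contDiff_normSq.sub contDiff_const
  have hM : ∀ i : ℕ, ∃ M, ∀ s : ℂ, ‖s‖ ≤ 2 →
      ‖iteratedFDeriv ℝ i (fun s : ℂ => Complex.normSq s - 1) s‖ ≤ M := by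
    intro i
    obtain ⟨M, hM⟩ := (isCompact_closedBall (0 : ℂ) 2).exists_bound_of_continuousOn
      (hq.continuous_iteratedFDeriv (m := i) (by exact_mod_cast le_top)).continuousOn
    exact ⟨M, fun s hs => hM s (by simpa using hs)⟩
  choose M hM using hM
  have hT0 : ∀ i, 0 ≤ T i := fun i => (norm_nonneg _).trans (hT i 0)
  have hM0 : ∀ i, 0 ≤ M i := fun i => (norm_nonneg _).trans (hM i 0 (by simp))
  set D : ℝ := 1 + ∑ i ∈ Finset.range (j + 1), M i with hD
  set S : ℝ := ∑ i ∈ Finset.range (j + 1), T i with hS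
  have hS0 : 0 ≤ S := Finset.sum_nonneg fun i _ => hT0 i
  have hD1 : 1 ≤ D := by
    have : 0 ≤ ∑ i ∈ Finset.range (j + 1), M i := Finset.sum_nonneg fun i _ => hM0 i
    linarith
  refine ⟨j.factorial * S * D ^ j, by positivity, fun k p hp i hi => ?_⟩
  have hk : (1 : ℝ) ≤ 1 + k := by have : (0 : ℝ) ≤ k := k.cast_nonneg; linarith
  have hg : ContDiff ℝ (⊤ : ℕ∞) fun t : ℝ => stepFn (k * t) :=
    contDiff_stepFn.comp (contDiff_const.mul contDiff_id)
  have h1 : ∀ l ≤ i, ∀ t : ℝ, ‖iteratedFDeriv ℝ l (fun t : ℝ => stepFn (k * t)) t‖ ≤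
      S * (1 + k) ^ i := by
    intro l hl t
    have h2 := norm_iteratedFDeriv_comp_clm_le ((k : ℝ) • ContinuousLinearMap.id ℝ ℝ)
      contDiff_stepFn t l
    have h3 : ‖(k : ℝ) • ContinuousLinearMap.id ℝ ℝ‖ ≤ 1 + k := by
      rw [norm_smul]
      have : ‖ContinuousLinearMap.id ℝ ℝ‖ ≤ 1 := ContinuousLinearMap.norm_id_le
      have h4 : ‖(k : ℝ)‖ = k := by simp
      rw [h4]
      nlinarith [k.cast_nonneg (α := ℝ)]
    refine (show ‖iteratedFDeriv ℝ l (fun t : ℝ => stepFn (k * t)) t‖ ≤ _ from h2).trans ?_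
    refine mul_le_mul ((hT l _).trans ?_) ?_ (by positivity) hS0
    · exact Finset.single_le_sum (f := T) (fun i _ => hT0 i) (Finset.mem_range.mpr (by omega))
    · exact (pow_le_pow_left₀ (norm_nonneg _) h3 l).trans (pow_le_pow_right₀ hk hl)
  have h5 := norm_iteratedFDeriv_comp_le (n := i) hg hq (by exact_mod_cast le_top) p.2
    (C := S * (1 + k) ^ i) (D := D) (fun l hl => h1 l hl _) (fun l hl1 hl2 => by
      refine (hM l _ hp).trans ?_
      have h6 : M l ≤ D := by
        have := Finset.single_le_sum (f := M) (fun i _ => hM0 i)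
          (Finset.mem_range.mpr (show l < j + 1 by omega))
        linarith
      exact h6.trans (le_self_pow₀ hD1 (by omega)))
  have h7 := norm_iteratedFDeriv_comp_clm_le (ContinuousLinearMap.snd ℝ ℂ ℂ) (hg.comp hq) p i
  refine (show ‖iteratedFDeriv ℝ i (cutK k) p‖ ≤ _ from h7).trans ?_
  have h8 : ‖ContinuousLinearMap.snd ℝ ℂ ℂ‖ ^ i ≤ 1 :=
    pow_le_one₀ (norm_nonneg _) (ContinuousLinearMap.norm_snd_le ℝ ℂ ℂ)
  refine (mul_le_of_le_one_right (norm_nonneg _) h8).trans (h5.trans ?_)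
  have h9 : (i.factorial : ℝ) ≤ j.factorial := by exact_mod_cast Nat.factorial_le hi
  have h10 : D ^ i ≤ D ^ j := pow_le_pow_right₀ hD1 hi
  calc (i.factorial : ℝ) * (S * (1 + k) ^ i) * D ^ i
      ≤ j.factorial * (S * (1 + k) ^ i) * D ^ j := by gcongr
    _ = _ := by ring

lemma pow_bound (j : ℕ) : ∀ (k : ℕ) (p : ℂ × ℂ),
    ‖iteratedFDeriv ℝ j (fun p : ℂ × ℂ => p.2 ^ k) p‖ ≤ (k : ℝ) ^ j * (max 1 ‖p.2‖) ^ k := by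
  induction j with
  | zero =>
    intro k p
    rw [norm_iteratedFDeriv_zero, norm_pow, pow_zero, one_mul]
    gcongr
    exact le_max_right _ _
  | succ j ih =>
    intro k p
    rw [← norm_iteratedFDeriv_fderiv]
    set L : ℂ →L[ℝ] (ℂ × ℂ →L[ℝ] ℂ) :=
      (ContinuousLinearMap.id ℝ ℂ).smulRight (ContinuousLinearMap.snd ℝ ℂ ℂ)
    have hL : ‖L‖ ≤ 1 := by
      refine ContinuousLinearMap.opNorm_le_bound _ zero_le_one fun c => ?_
      refine (norm_smul_le c (ContinuousLinearMap.snd ℝ ℂ ℂ)).trans ?_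
      have := ContinuousLinearMap.norm_snd_le ℝ ℂ ℂ
      nlinarith [norm_nonneg c]
    have h1 : fderiv ℝ (fun p : ℂ × ℂ => p.2 ^ k) =
        L ∘ ((k : ℝ) • fun p : ℂ × ℂ => p.2 ^ (k - 1)) := by
      ext1 p
      rw [(hasFDerivAt_snd.pow k).fderiv]
      simp [L]
    have h2 : ContDiff ℝ (⊤ : ℕ∞) fun p : ℂ × ℂ => p.2 ^ (k - 1) := contDiff_snd.pow _
    have h3 : ContDiff ℝ (⊤ : ℕ∞) ((k : ℝ) • fun p : ℂ × ℂ => p.2 ^ (k - 1)) :=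
      contDiff_const.smul h2
    rw [h1]
    refine (L.norm_iteratedFDeriv_comp_left (n := j) h3.contDiffAt
      (by exact_mod_cast le_top)).trans ?_
    refine (mul_le_of_le_one_left (norm_nonneg _) hL).trans ?_
    rw [iteratedFDeriv_const_smul_apply (h2.contDiffAt.of_le (by exact_mod_cast le_top)), norm_smul]
    have h4 := ih (k - 1) p
    have h5 : ‖(k : ℝ)‖ = k := by simp
    rw [h5, pow_succ', mul_assoc]
    refine mul_le_mul_of_nonneg_left (h4.trans ?_) k.cast_nonneg
    have h6 : ((k - 1 : ℕ) : ℝ) ≤ k := by exact_mod_cast Nat.sub_le _ _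
    refine mul_le_mul ?_ ?_ (by positivity) (by positivity)
    · exact pow_le_pow_left₀ (by positivity) h6 j
    · exact pow_le_pow_right₀ (le_max_left _ _) (Nat.sub_le _ _)

/-- The linear phase of a frequency. -/
def phase (n : Idx) : ℂ × ℂ →L[ℝ] ℂ :=
  (2 * Real.pi * I : ℂ) • (Complex.ofRealCLM.comp
    (((n.1 : ℝ) • Complex.reCLM + (n.2.1 : ℝ) • Complex.imCLM).comp
      (ContinuousLinearMap.fst ℝ ℂ ℂ)))

lemma phase_apply (n : Idx) (p : ℂ × ℂ) :
    phase n p = 2 * Real.pi * I * ((n.1 * p.1.re + n.2.1 * p.1.im : ℝ) : ℂ) := by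
  simp [phase]
  ring

lemma norm_phase_le (n : Idx) : ‖phase n‖ ≤ 7 * sz n := by
  refine ContinuousLinearMap.opNorm_le_bound _ (by positivity) fun p => ?_
  rw [phase_apply]
  have h1 : ‖(2 * Real.pi * I : ℂ)‖ ≤ 7 := by
    simp only [norm_mul, Complex.norm_I, mul_one, Complex.norm_real, Complex.norm_ofNat]
    rw [Real.norm_of_nonneg Real.pi_pos.le]
    linarith [Real.pi_lt_d2]
  have h2 : ‖((n.1 * p.1.re + n.2.1 * p.1.im : ℝ) : ℂ)‖ ≤ sz n * ‖p‖ := by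
    rw [Complex.norm_real]
    have h3 : ‖p.1‖ ≤ ‖p‖ := norm_fst_le p
    have h4 := Complex.abs_re_le_norm p.1
    have h5 := Complex.abs_im_le_norm p.1
    have h6 : |(n.1 : ℝ)| + |(n.2.1 : ℝ)| ≤ sz n := by
      have : (sz n : ℝ) = 1 + |(n.1 : ℝ)| + |(n.2.1 : ℝ)| + n.2.2 := by
        simp [sz, Nat.cast_natAbs]
      rw [this]
      have : (0 : ℝ) ≤ n.2.2 := Nat.cast_nonneg _
      linarith
    calc ‖(n.1 * p.1.re + n.2.1 * p.1.im : ℝ)‖ ≤ |(n.1 : ℝ)| * |p.1.re| + |(n.2.1 : ℝ)| * |p.1.im| := by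
          rw [← abs_mul, ← abs_mul]; exact norm_add_le _ _
      _ ≤ |(n.1 : ℝ)| * ‖p‖ + |(n.2.1 : ℝ)| * ‖p‖ := by
          gcongr
          · exact h4.trans h3
          · exact h5.trans h3
      _ = (|(n.1 : ℝ)| + |(n.2.1 : ℝ)|) * ‖p‖ := by ring
      _ ≤ _ := by gcongr
  rw [norm_mul, mul_assoc (7 : ℝ)]
  exact mul_le_mul h1 h2 (norm_nonneg _) (by norm_num)

lemma phase_bound (n : Idx) (j : ℕ) : ∀ p : ℂ × ℂ,
    ‖iteratedFDeriv ℝ j (fun p => Complex.exp (phase n p)) p‖ ≤ (7 * sz n : ℝ) ^ j := by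
  have h0 : ContDiff ℝ (⊤ : ℕ∞) fun p => Complex.exp (phase n p) := (phase n).contDiff.cexp
  induction j with
  | zero =>
    intro p
    rw [norm_iteratedFDeriv_zero, pow_zero, phase_apply, norm_exp_two_pi]
  | succ j ih =>
    intro p
    rw [← norm_iteratedFDeriv_fderiv]
    set L : ℂ →L[ℝ] (ℂ × ℂ →L[ℝ] ℂ) := (ContinuousLinearMap.id ℝ ℂ).smulRight (phase n)
    have hL : ‖L‖ ≤ 7 * sz n := by
      refine ContinuousLinearMap.opNorm_le_bound _ (by positivity) fun c => ?_
      refine (norm_smul_le c (phase n)).trans ?_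
      rw [mul_comm]
      exact mul_le_mul_of_nonneg_right (norm_phase_le n) (norm_nonneg _)
    have h1 : fderiv ℝ (fun p => Complex.exp (phase n p)) = L ∘ fun p => Complex.exp (phase n p) := by
      ext1 p
      rw [((phase n).hasFDerivAt.cexp).fderiv]
      rfl
    rw [h1]
    refine (L.norm_iteratedFDeriv_comp_left (n := j) h0.contDiffAt
      (by exact_mod_cast le_top)).trans ?_
    rw [pow_succ']
    exact mul_le_mul hL (ih p) (norm_nonneg _) (by positivity)

end Realize

section Realize
open scoped ENNReal

/-- A smooth function on the whole space which agrees with `em n` near `|s| ≤ 1`. -/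
def rt (n : Idx) (p : ℂ × ℂ) : ℂ :=
  Complex.exp (phase n p) * (p.2 ^ n.2.2 * (cutK (n.2.2 + 1) p : ℂ))

lemma contDiff_rt (n : Idx) : ContDiff ℝ (⊤ : ℕ∞) (rt n) :=
  (phase n).contDiff.cexp.mul ((contDiff_snd.pow _).mul
    (Complex.ofRealCLM.contDiff.comp (contDiff_cutK _)))

lemma rt_eventuallyEq (n : Idx) {p : ℂ × ℂ} (hp : ‖p.2‖ ≤ 1) : rt n =ᶠ[𝓝 p] em n := by
  have h1 : ∀ᶠ q : ℂ × ℂ in 𝓝 p,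
      (((n.2.2 + 1 : ℕ) : ℝ) * (Complex.normSq q.2 - 1)) < 1 / 2 := by
    have hc : Continuous fun q : ℂ × ℂ => (((n.2.2 + 1 : ℕ) : ℝ) * (Complex.normSq q.2 - 1)) :=
      continuous_const.mul ((Complex.continuous_normSq.comp continuous_snd).sub continuous_const)
    refine hc.continuousAt.eventually_lt continuousAt_const ?_
    have h2 : Complex.normSq p.2 ≤ 1 := by
      rw [Complex.normSq_eq_norm_sq]; exact pow_le_one₀ (norm_nonneg _) hp
    have h3 : (((n.2.2 + 1 : ℕ) : ℝ) * (Complex.normSq p.2 - 1)) ≤ 0 :=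
      mul_nonpos_of_nonneg_of_nonpos (Nat.cast_nonneg _) (by linarith)
    linarith
  filter_upwards [h1] with q hq
  unfold rt em
  rw [show cutK (n.2.2 + 1) q = 1 from stepFn_eq_one hq.le, phase_apply]
  simp

lemma rt_eq_em (n : Idx) {p : ℂ × ℂ} (hp : ‖p.2‖ ≤ 1) : rt n p = em n p :=
  (rt_eventuallyEq n hp).self_of_nhds

lemma norm_iteratedFDeriv_mul_le_pow {f g : ℂ × ℂ → ℂ} (hf : ContDiff ℝ (⊤ : ℕ∞) f)
    (hg : ContDiff ℝ (⊤ : ℕ∞) g) {p : ℂ × ℂ} {j : ℕ} {A B S : ℝ} (hA : 0 ≤ A)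
    (hS : 0 ≤ S)
    (h1 : ∀ i ≤ j, ‖iteratedFDeriv ℝ i f p‖ ≤ A * S ^ i)
    (h2 : ∀ i ≤ j, ‖iteratedFDeriv ℝ i g p‖ ≤ B * S ^ i) :
    ∀ i ≤ j, ‖iteratedFDeriv ℝ i (fun p => f p * g p) p‖ ≤ (2 ^ j * A * B) * S ^ i := by
  intro i hi
  have hB : 0 ≤ B := by simpa using (norm_nonneg _).trans (h2 0 (Nat.zero_le _))
  refine (norm_iteratedFDeriv_mul_le hf hg p (n := i) (by exact_mod_cast le_top)).trans ?_
  calc ∑ l ∈ Finset.range (i + 1), (i.choose l : ℝ) * ‖iteratedFDeriv ℝ l f p‖ *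
        ‖iteratedFDeriv ℝ (i - l) g p‖
      ≤ ∑ l ∈ Finset.range (i + 1), (i.choose l : ℝ) * (A * B * S ^ i) := by
        refine Finset.sum_le_sum fun l hl => ?_
        have hl' : l ≤ i := Nat.lt_succ_iff.mp (Finset.mem_range.mp hl)
        rw [mul_assoc]
        refine mul_le_mul_of_nonneg_left ?_ (Nat.cast_nonneg _)
        calc _ ≤ (A * S ^ l) * (B * S ^ (i - l)) :=
              mul_le_mul (h1 l (hl'.trans hi)) (h2 _ ((Nat.sub_le _ _).trans hi))
                (norm_nonneg _) (by positivity)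
          _ = A * B * S ^ i := by
              rw [mul_mul_mul_comm, ← pow_add, Nat.add_sub_cancel' hl']
    _ = 2 ^ i * (A * B * S ^ i) := by
        rw [← Finset.sum_mul]
        congr 1
        exact_mod_cast Nat.sum_range_choose i
    _ ≤ 2 ^ j * (A * B * S ^ i) := by
        refine mul_le_mul_of_nonneg_right ?_ (by positivity)
        exact pow_le_pow_right₀ one_le_two hi
    _ = _ := by ring

lemma rt_bound (j : ℕ) : ∃ C, 0 ≤ C ∧ ∀ (n : Idx) (p : ℂ × ℂ),
    ‖iteratedFDeriv ℝ j (rt n) p‖ ≤ C * (sz n : ℝ) ^ j := by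
  obtain ⟨C, hC0, hC⟩ := cutK_bound j
  refine ⟨2 ^ j * 1 * (2 ^ j * 3 * C) * 7 ^ j, by positivity, fun n p => ?_⟩
  set k := n.2.2 with hk
  have hsz : (k : ℝ) + 1 ≤ sz n := by
    have : k + 1 ≤ sz n := by unfold sz; omega
    exact_mod_cast this
  have hk0 : (0 : ℝ) ≤ k := Nat.cast_nonneg _
  rcases lt_or_ge 1 (((k + 1 : ℕ) : ℝ) * (Complex.normSq p.2 - 1)) with h | h
  · have h0 : rt n =ᶠ[𝓝 p] fun _ => 0 := by
      have hc : Continuous fun q : ℂ × ℂ => (((k + 1 : ℕ) : ℝ) * (Complex.normSq q.2 - 1)) :=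
        continuous_const.mul ((Complex.continuous_normSq.comp continuous_snd).sub continuous_const)
      filter_upwards [continuousAt_const.eventually_lt hc.continuousAt h] with q hq
      unfold rt
      rw [show cutK (n.2.2 + 1) q = 0 from stepFn_eq_zero hq.le]
      simp
    rw [(h0.iteratedFDeriv ℝ j).self_of_nhds]
    have : iteratedFDeriv ℝ j (fun _ : ℂ × ℂ => (0 : ℂ)) p = 0 := by
      rw [iteratedFDeriv_fun_zero]; rfl
    rw [this, norm_zero]
    positivity
  · have hn2 : Complex.normSq p.2 ≤ 1 + 1 / ((k : ℝ) + 1) := by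
      push_cast at h
      have : Complex.normSq p.2 - 1 ≤ 1 / ((k : ℝ) + 1) := by
        rw [le_div_iff₀ (by positivity)]; linarith
      linarith
    have h1k : 1 / ((k : ℝ) + 1) ≤ 1 := by
      rw [div_le_one (by positivity)]; linarith
    rw [Complex.normSq_eq_norm_sq] at hn2
    have hp2 : ‖p.2‖ ≤ 2 := by nlinarith [norm_nonneg p.2]
    have hm : max 1 ‖p.2‖ ≤ 1 + 1 / ((k : ℝ) + 1) := by
      have h3 : (0 : ℝ) ≤ 1 / ((k : ℝ) + 1) := by positivity
      refine max_le (by linarith) ?_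
      by_contra hcon
      nlinarith [norm_nonneg p.2]
    have hpow : (max 1 ‖p.2‖) ^ k ≤ 3 := by
      calc (max 1 ‖p.2‖) ^ k ≤ (1 + 1 / ((k : ℝ) + 1)) ^ k :=
            pow_le_pow_left₀ (by positivity) hm k
        _ ≤ (Real.exp (1 / ((k : ℝ) + 1))) ^ k := by
            refine pow_le_pow_left₀ (by positivity) ?_ k
            rw [add_comm]; exact Real.add_one_le_exp _
        _ = Real.exp (k / (k + 1)) := by rw [← Real.exp_nat_mul]; congr 1; ring
        _ ≤ Real.exp 1 := by
            refine Real.exp_le_exp.mpr ?_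
            rw [div_le_one (by positivity)]; linarith
        _ ≤ 3 := by linarith [Real.exp_one_lt_d9]
    have hb1 : ∀ i ≤ j, ‖iteratedFDeriv ℝ i (fun p => Complex.exp (phase n p)) p‖ ≤
        1 * (7 * sz n : ℝ) ^ i := fun i _ => by
      rw [one_mul]; exact phase_bound n i p
    have hb2 : ∀ i ≤ j, ‖iteratedFDeriv ℝ i (fun p : ℂ × ℂ => p.2 ^ k) p‖ ≤
        3 * (7 * sz n : ℝ) ^ i := fun i _ => by
      refine (pow_bound i k p).trans ?_
      rw [mul_comm]
      exact mul_le_mul hpow (pow_le_pow_left₀ hk0 (by linarith) i) (by positivity) (by norm_num)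
    have hb3 : ∀ i ≤ j, ‖iteratedFDeriv ℝ i (fun p : ℂ × ℂ => (cutK (k + 1) p : ℂ)) p‖ ≤
        C * (7 * sz n : ℝ) ^ i := fun i hi => by
      have h4 := Complex.ofRealCLM.norm_iteratedFDeriv_comp_left (n := i) (x := p)
        (contDiff_cutK (k + 1)).contDiffAt (by exact_mod_cast le_top)
      refine (show ‖iteratedFDeriv ℝ i (fun p : ℂ × ℂ => (cutK (k + 1) p : ℂ)) p‖ ≤ _
        from h4).trans ?_
      rw [Complex.ofRealCLM_norm, one_mul]
      refine (hC (k + 1) p hp2 i hi).trans ?_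
      refine mul_le_mul_of_nonneg_left (pow_le_pow_left₀ (by positivity) ?_ i) hC0
      push_cast
      linarith
    have hck : ContDiff ℝ (⊤ : ℕ∞) fun p : ℂ × ℂ => (cutK (k + 1) p : ℂ) :=
      Complex.ofRealCLM.contDiff.comp (contDiff_cutK _)
    have hpk : ContDiff ℝ (⊤ : ℕ∞) fun p : ℂ × ℂ => p.2 ^ k := contDiff_snd.pow _
    have hb4 := norm_iteratedFDeriv_mul_le_pow hpk hck (by norm_num) (by positivity) hb2 hb3
    have hb5 := norm_iteratedFDeriv_mul_le_pow (phase n).contDiff.cexp (hpk.mul hck)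
      zero_le_one (by positivity) hb1 hb4 j le_rfl
    refine (show ‖iteratedFDeriv ℝ j (rt n) p‖ ≤ _ from hb5).trans ?_
    rw [mul_pow, ← mul_assoc]

variable {E : Type*} [NormedAddCommGroup E] [NormedSpace ℂ E]

/-- The sum of a rapidly decreasing series of monomials, as a smooth function on the
whole space. -/
def realize (V : Idx → E) (p : ℂ × ℂ) : E := ∑' n, rt n p • V n

lemma Rapid.summable {V : Idx → E} (hV : Rapid V) (j : ℕ) :
    Summable fun n => (sz n : ℝ) ^ j * ‖V n‖ := by
  have h := hV j
  unfold wnorm at h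
  simpa using ENNReal.summable_toReal h

lemma norm_iteratedFDeriv_rt_smul_le (n : Idx) (v : E) (j : ℕ) (p : ℂ × ℂ) :
    ‖iteratedFDeriv ℝ j (fun p => rt n p • v) p‖ ≤ ‖iteratedFDeriv ℝ j (rt n) p‖ * ‖v‖ := by
  set L : ℂ →L[ℝ] E := (ContinuousLinearMap.id ℝ ℂ).smulRight v
  have hL : ‖L‖ ≤ ‖v‖ := by
    refine ContinuousLinearMap.opNorm_le_bound _ (norm_nonneg _) fun c => ?_
    rw [mul_comm]
    exact norm_smul_le c v
  refine (L.norm_iteratedFDeriv_comp_left (n := j) (contDiff_rt n).contDiffAt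
      (by exact_mod_cast le_top)).trans ?_
  rw [mul_comm]
  exact mul_le_mul_of_nonneg_left hL (norm_nonneg _)

lemma contDiff_realize [CompleteSpace E] {V : Idx → E} (hV : Rapid V) :
    ContDiff ℝ (⊤ : ℕ∞) (realize V) := by
  choose C hC0 hC using rt_bound
  refine contDiff_tsum (v := fun j n => C j * ((sz n : ℝ) ^ j * ‖V n‖))
    (fun n => (contDiff_rt n).smul contDiff_const) (fun j _ => (hV.summable j).mul_left _)
    fun j n p _ => ?_
  refine (norm_iteratedFDeriv_rt_smul_le n (V n) j p).trans ?_
  rw [← mul_assoc]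
  exact mul_le_mul_of_nonneg_right (hC j n p) (norm_nonneg _)

lemma norm_fderiv_rt_smul_le : ∃ C : ℝ, 0 ≤ C ∧ ∀ (n : Idx) (v : E) (p : ℂ × ℂ),
    ‖fderiv ℝ (fun p => rt n p • v) p‖ ≤ C * (sz n * ‖v‖) := by
  obtain ⟨C, hC0, hC⟩ := rt_bound 1
  refine ⟨C, hC0, fun n v p => ?_⟩
  have h := norm_iteratedFDeriv_rt_smul_le n v 1 p
  rw [norm_iteratedFDeriv_one, norm_iteratedFDeriv_one] at h
  have h2 := hC n p
  rw [norm_iteratedFDeriv_one, pow_one] at h2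
  refine h.trans ?_
  rw [← mul_assoc]
  exact mul_le_mul_of_nonneg_right h2 (norm_nonneg _)

lemma norm_rt_le : ∃ C : ℝ, 0 ≤ C ∧ ∀ (n : Idx) (p : ℂ × ℂ), ‖rt n p‖ ≤ C := by
  obtain ⟨C, hC0, hC⟩ := rt_bound 0
  exact ⟨C, hC0, fun n p => by simpa using hC n p⟩

lemma hasSum_fderiv_realize [CompleteSpace E] {V : Idx → E} (hV : Rapid V) (p : ℂ × ℂ) :
    HasSum (fun n => fderiv ℝ (fun p => rt n p • V n) p) (fderiv ℝ (realize V) p) := by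
  obtain ⟨C, hC0, hC⟩ := norm_fderiv_rt_smul_le (E := E)
  obtain ⟨C', hC0', hC'⟩ := norm_rt_le
  have hs : Summable fun n => C * (sz n * ‖V n‖) := by
    simpa using (hV.summable 1).mul_left C
  have h := fderiv_tsum_apply hs
    (fun n => ((contDiff_rt n).smul contDiff_const).differentiable (by simp))
    (fun n p => hC n (V n) p) (x₀ := p) ?_ p
  · rw [show fderiv ℝ (realize V) p = _ from h]
    exact (Summable.of_norm_bounded hs fun n => hC n (V n) p).hasSum
  · refine Summable.of_norm_bounded ((by simpa using hV.summable 0 : Summable _).mul_left C')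
      fun n => ?_
    rw [show (rt n • fun _ => V n) p = rt n p • V n from rfl, norm_smul]
    exact mul_le_mul_of_nonneg_right (hC' n p) (norm_nonneg _)

lemma norm_fderiv_realize_le [CompleteSpace E] : ∃ C : ℝ, 0 ≤ C ∧ ∀ (V : Idx → E), Rapid V →
    ∀ p, ‖fderiv ℝ (realize V) p‖ ≤ C * ∑' n, (sz n : ℝ) * ‖V n‖ := by
  obtain ⟨C, hC0, hC⟩ := norm_fderiv_rt_smul_le (E := E)
  refine ⟨C, hC0, fun V hV p => ?_⟩
  have hs : Summable fun n => (sz n * ‖V n‖) := by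
    simpa using hV.summable 1
  rw [← (hasSum_fderiv_realize hV p).tsum_eq, ← tsum_mul_left]
  exact tsum_of_norm_bounded (hs.mul_left C).hasSum fun n => hC n (V n) p

lemma hasFDerivAt_em (n : Idx) (p : ℂ × ℂ) : HasFDerivAt (em n)
    (Complex.exp (phase n p) • (((n.2.2 : ℂ) * p.2 ^ (n.2.2 - 1)) • ContinuousLinearMap.snd ℝ ℂ ℂ) +
      p.2 ^ n.2.2 • (Complex.exp (phase n p) • phase n)) p := by
  have h : em n = fun p => Complex.exp (phase n p) * p.2 ^ n.2.2 := by
    ext p; rw [phase_apply]; rfl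
  rw [h]
  have h1 := ((phase n).hasFDerivAt (x := p)).cexp
  have h2 : HasFDerivAt (fun p : ℂ × ℂ => p.2 ^ n.2.2) _ p :=
    (hasFDerivAt_snd (𝕜 := ℝ) (E := ℂ) (F := ℂ) (p := p)).pow n.2.2
  have h3 := h1.mul h2
  rw [nsmul_eq_mul] at h3
  exact h3

lemma Sbar_em (n : Idx) (p : ℂ × ℂ) : Sbar (em n) p = 0 := by
  unfold Sbar firstOrder
  rw [(hasFDerivAt_em n p).fderiv]
  generalize Complex.exp (phase n p) = X
  simp [phase_apply]
  ring

/-- The `z̄`-symbol. -/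
def symB (n : Idx) : ℂ := Real.pi * (I * n.1 - n.2.1)

/-- The `z`-symbol. -/
def symA (n : Idx) : ℂ := Real.pi * (I * n.1 + n.2.1)

lemma Lop_em (n : Idx) (p : ℂ × ℂ) : Lop (em n) p = (symB n + p.2 ^ 2 * symA n) * em n p := by
  unfold Lop firstOrder
  rw [(hasFDerivAt_em n p).fderiv]
  have h : em n p = Complex.exp (phase n p) * p.2 ^ n.2.2 := by
    rw [phase_apply]; rfl
  rw [h]
  generalize Complex.exp (phase n p) = X
  simp [phase_apply, symA, symB]
  linear_combination X * p.2 ^ n.2.2 * Real.pi * n.2.1 * (1 - p.2 ^ 2) * I_sq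

lemma hasSum_firstOrder_realize [CompleteSpace E] {V : Idx → E} (hV : Rapid V) (p : ℂ × ℂ)
    (hp : ‖p.2‖ ≤ 1) (a b : ℂ) (v w : ℂ × ℂ) :
    HasSum (fun n => firstOrder a b v w (em n) p • V n) (firstOrder a b v w (realize V) p) := by
  have h1 := hasSum_fderiv_realize hV p
  have h2 := ((h1.mapL (ContinuousLinearMap.apply ℝ E v)).const_smul a).add
    ((h1.mapL (ContinuousLinearMap.apply ℝ E w)).const_smul b)
  refine h2.congr_fun fun n => ?_
  have h3 : fderiv ℝ (fun p => rt n p • V n) p = (fderiv ℝ (em n) p).smulRight (V n) := by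
    have h4 : (fun p => rt n p • V n) =ᶠ[𝓝 p] fun p => em n p • V n := by
      filter_upwards [rt_eventuallyEq n hp] with q hq
      rw [hq]
    rw [h4.fderiv_eq, fderiv_smul_const (hasFDerivAt_em n p).differentiableAt]
  simp [h3, firstOrder, add_smul, mul_smul]

lemma realize_eq_tsum {V : Idx → E} {p : ℂ × ℂ} (hp : ‖p.2‖ ≤ 1) :
    realize V p = ∑' n, em n p • V n := tsum_congr fun n => by rw [rt_eq_em n hp]

lemma hasSum_realize [CompleteSpace E] {V : Idx → E} (hV : l1 V ≠ ∞) {p : ℂ × ℂ}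
    (hp : ‖p.2‖ ≤ 1) : HasSum (fun n => em n p • V n) (realize V p) := by
  rw [realize_eq_tsum hp]
  exact (summable_em_smul hV hp).hasSum

lemma rep_realize [CompleteSpace E] {V : Idx → E} (hV : l1 V ≠ ∞) : Rep V (realize V) :=
  fun _ _ _ hs => hasSum_realize hV hs

lemma smH_realize [CompleteSpace E] {V : Idx → E} (hV : Rapid V) (U : Set ℂ) :
    SmH U (realize V) := fun z _ s hs => by
  refine ⟨(contDiff_realize hV).contDiffAt, ?_⟩
  have h := hasSum_firstOrder_realize hV (z, s) hs 1 (-I) (0, I) (0, 1)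
  refine h.unique ?_
  have h2 : (fun n => firstOrder 1 (-I) (0, I) (0, 1) (em n) (z, s) • V n) = fun _ => (0 : E) := by
    ext n
    rw [show firstOrder 1 (-I) (0, I) (0, 1) (em n) (z, s) = 0 from Sbar_em n _, zero_smul]
  rw [h2]
  exact hasSum_zero

lemma hasSum_Lop_realize [CompleteSpace E] {V : Idx → E} (hV : Rapid V) {p : ℂ × ℂ}
    (hp : ‖p.2‖ ≤ 1) :
    HasSum (fun n => ((symB n + p.2 ^ 2 * symA n) * em n p) • V n) (Lop (realize V) p) := by
  have h := hasSum_firstOrder_realize hV p hp ((1 + p.2 ^ 2) / 2) (I * (1 - p.2 ^ 2) / 2) (1, 0)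
    (I, 0)
  refine h.congr_fun fun n => ?_
  rw [← Lop_em]; rfl

lemma norm_symA_le (n : Idx) : ‖symA n‖ ≤ 7 * sz n := by
  have h : symA n = (1 / 2 : ℂ) * phase n (1, 0) + (-I / 2) * phase n (I, 0) := by
    simp [phase_apply, symA]
    linear_combination (Real.pi * n.2.1 : ℂ) * I_sq
  rw [h]
  have h1 : ‖phase n (1, 0)‖ ≤ 7 * sz n := by
    simpa using ((phase n).le_opNorm (1, 0)).trans
      (mul_le_mul_of_nonneg_right (norm_phase_le n) (norm_nonneg _))
  have h2 : ‖phase n (I, 0)‖ ≤ 7 * sz n := by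
    simpa using ((phase n).le_opNorm (I, 0)).trans
      (mul_le_mul_of_nonneg_right (norm_phase_le n) (norm_nonneg _))
  refine (norm_add_le _ _).trans ?_
  rw [norm_mul, norm_mul]
  norm_num
  linarith

end Realize

section Expansion
open scoped ENNReal
variable {E : Type*} [NormedAddCommGroup E] [NormedSpace ℂ E]

/-- The character `exp(2πit)`. -/
def ex (t : ℝ) : ℂ := Complex.exp (2 * Real.pi * I * (t : ℂ))

lemma ex_add (t t' : ℝ) : ex (t + t') = ex t * ex t' := by
  unfold ex; rw [← Complex.exp_add]; congr 1; push_cast; ring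

lemma norm_ex (t : ℝ) : ‖ex t‖ = 1 := norm_exp_two_pi t

lemma ex_int (n : ℤ) : ex n = 1 := by
  unfold ex
  rw [show 2 * Real.pi * I * ((n : ℝ) : ℂ) = n * (2 * Real.pi * I) by push_cast; ring]
  exact Complex.exp_int_mul_two_pi_mul_I n

lemma ex_add_int (t : ℝ) (n : ℤ) : ex (t + n) = ex t := by rw [ex_add, ex_int, mul_one]

lemma ex_int_mul (n : ℤ) (t : ℝ) : ex (n * t) = ex t ^ n := by
  unfold ex
  rw [← Complex.exp_int_mul]; congr 1; push_cast; ring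

lemma exists_ex {s : ℂ} (hs : ‖s‖ = 1) : ∃ t : ℝ, ex t = s := by
  refine ⟨s.arg / (2 * Real.pi), ?_⟩
  unfold ex
  have h := Complex.norm_mul_exp_arg_mul_I s
  rw [hs] at h
  conv_rhs => rw [← h]
  rw [Complex.ofReal_one, one_mul]
  congr 1
  push_cast
  field_simp

lemma contDiff_ex : ContDiff ℝ (⊤ : ℕ∞) ex :=
  (contDiff_const.mul Complex.ofRealCLM.contDiff).cexp

/-- Representative in `[-1/2, 1/2]` modulo `1`. -/
def fr (t : ℝ) : ℝ := t - round t

lemma fr_add_int (t : ℝ) (m : ℤ) : fr (t + m) = fr t := by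
  unfold fr; rw [round_add_intCast]; push_cast; ring

lemma abs_fr_le (t : ℝ) : |fr t| ≤ 1 / 2 := abs_sub_round t

lemma fr_eq_self {t : ℝ} (h : |t| < 1 / 2) : fr t = t := by
  have h := abs_lt.mp h
  have : round t = 0 := round_eq_zero_iff.mpr ⟨by linarith, by linarith⟩
  simp [fr, this]

lemma abs_fr_eq {t : ℝ} (h : |t| ≤ 1 / 2) : |fr t| = |t| := by
  rcases h.lt_or_eq with h | h
  · rw [fr_eq_self h]
  · refine le_antisymm ?_ ?_
    · simpa [fr] using round_le t 0
    · rcases eq_or_ne (round t) 0 with h0 | h0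
      · simp [fr, h0]
      · have h1 : (1 : ℝ) ≤ |(round t : ℝ)| := by exact_mod_cast Int.one_le_abs h0
        have h2 : |(round t : ℝ)| ≤ |fr t| + |t| := by
          have : (round t : ℝ) = t - fr t := by simp [fr]
          rw [this, add_comm]; exact abs_sub _ _
        linarith

lemma ex_int_mul_fr (n : ℤ) (t : ℝ) : ex (n * fr t) = ex (n * t) := by
  have : n * t = n * fr t + ((n * round t : ℤ) : ℝ) := by unfold fr; push_cast; ring
  rw [this, ex_add_int]

lemma em_eq (n : Idx) (x y : ℝ) (s : ℂ) :
    em n ((x : ℂ) + y * I, s) = ex (n.1 * x) * ex (n.2.1 * y) * s ^ n.2.2 := by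
  rw [← ex_add]; simp [em, ex]

lemma fr_mem_Qs (x y : ℝ) : ((fr x : ℂ) + fr y * I) ∈ Qs := by
  constructor <;> simpa using abs_fr_le _

lemma Rep.unique [CompleteSpace E] {V V' : Idx → E} {f : ℂ × ℂ → E} (h : Rep V f) (h' : Rep V' f)
    (hV : l1 V ≠ ∞) (hV' : l1 V' ≠ ∞) : V = V' := by
  set W : Idx → E := fun n => V n - V' n with hW
  have hr : ∀ z ∈ Qs, ∀ s : ℂ, ‖s‖ ≤ 1 → HasSum (fun n => em n (z, s) • W n) 0 := by
    intro z hz s hs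
    simpa using h.sub h' z hz s hs
  have hs : Summable fun n => ‖W n‖ :=
    Summable.of_nonneg_of_le (fun n => norm_nonneg _) (fun n => norm_sub_le _ _)
      ((summable_norm_iff_enorm.mpr hV).add (summable_norm_iff_enorm.mpr hV'))
  set ι : Idx → (Fin 3 → ℤ) := fun n => ![n.1, n.2.1, n.2.2] with hι
  have hinj : Function.Injective ι := by
    rintro ⟨p, q, k⟩ ⟨p', q', k'⟩ h
    have h0 := congrFun h 0
    have h1 := congrFun h 1
    have h2 := congrFun h 2
    simp only [hι, Matrix.cons_val_zero, Matrix.cons_val_one, Matrix.cons_val] at h0 h1 h2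
    simp only [Prod.mk.injEq]
    exact ⟨h0, h1, by exact_mod_cast h2⟩
  set c : (Fin 3 → ℤ) → E := Function.extend ι W 0 with hc
  have hcι : ∀ n, c (ι n) = W n := fun n => hinj.extend_apply W 0 n
  have hc0 : ∀ n ∉ Set.range ι, c n = 0 := fun n hn => by
    rw [hc, Function.extend_apply' _ _ _ hn]; rfl
  have hcs : Summable fun n => ‖c n‖ := by
    rw [← hinj.summable_iff (fun n hn => by rw [hc0 n hn, norm_zero])]
    simpa only [Function.comp_def, hcι] using hs
  have hz : c = 0 := by
    refine fourier_series_unique hcs fun x => ?_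
    rw [← hinj.hasSum_iff (fun n hn => by rw [hc0 n hn, smul_zero])]
    have h1 := hr _ (fr_mem_Qs (x 0) (x 1)) (ex (x 2)) (norm_ex _).le
    refine h1.congr_fun fun n => ?_
    rw [em_eq, ex_int_mul_fr, ex_int_mul_fr]
    simp only [Function.comp_apply, hcι]
    congr 1
    rw [← zpow_natCast, ← ex_int_mul, ← ex_add, ← ex_add]
    simp [ex, hι, Fin.sum_univ_three]
  ext1 n
  have := congrFun hz (ι n)
  rw [hcι] at this
  exact sub_eq_zero.mp this

lemma SmH.differentiableAt_snd {U : Set ℂ} {u : ℂ × ℂ → E} (h : SmH U u) {z s : ℂ} (hz : z ∈ U)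
    (hs : ‖s‖ ≤ 1) : DifferentiableAt ℂ (fun s => u (z, s)) s := by
  have h1 : HasFDerivAt (fun s => u (z, s))
      ((fderiv ℝ u (z, s)).comp (ContinuousLinearMap.inr ℝ ℂ ℂ)) s :=
    (h.diff hz hs).hasFDerivAt.comp s (hasFDerivAt_prodMk_right z s)
  rw [differentiableAt_complex_iff_differentiableAt_real]
  refine ⟨h1.differentiableAt, ?_⟩
  rw [h1.fderiv]
  have h2 := (h z hz s hs).2
  simp only [Sbar, firstOrder, one_smul, neg_smul] at h2
  simpa [sub_eq_zero, ← sub_eq_add_neg] using h2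

lemma contDiffAt_fr {t : ℝ} (h : |fr t| < 1 / 2) : fr =ᶠ[𝓝 t] fun t' => t' - round t := by
  have hc : ContinuousAt (fun t' : ℝ => |t' - round t|) t :=
    (continuous_id.sub continuous_const).abs.continuousAt
  filter_upwards [hc.eventually_lt continuousAt_const h] with t' ht'
  have := fr_eq_self ht'
  rwa [sub_eq_add_neg, ← Int.cast_neg, fr_add_int, Int.cast_neg, ← sub_eq_add_neg] at this

lemma fr_large {t : ℝ} (h : 1 / 2 ≤ |fr t|) : ∀ᶠ t' in 𝓝 t, 3 / 8 < |fr t'| := by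
  have hc : ContinuousAt (fun t' : ℝ => |t - t'|) t :=
    (continuous_const.sub continuous_id).abs.continuousAt
  filter_upwards [hc.eventually_lt continuousAt_const (show |t - t| < 1 / 8 by norm_num)] with t' ht'
  have h1 : |fr t| ≤ |t - round t'| := round_le t _
  have h2 : |t - round t'| ≤ |t - t'| + |fr t'| := by
    rw [show t - round t' = (t - t') + fr t' by unfold fr; ring]; exact abs_add_le _ _
  linarith

theorem exists_expansion [CompleteSpace E] {f : ℝ → ℂ × ℂ → E}
    (hsm : ∀ (a : ℝ) (z s : ℂ), ‖s‖ ≤ 1 →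
      ContDiffAt ℝ (⊤ : ℕ∞) (fun q : ℝ × (ℂ × ℂ) => f q.1 q.2) (a, (z, s)))
    (hh : ∀ a, SmH Set.univ (f a)) (h0 : ∀ a (z s : ℂ), 3 / 8 < ‖z‖ → f a (z, s) = 0)
    (hper : ∀ a, f (a + 1) = f a) :
    ∃ V : ℤ → Idx → E, (∀ N : ℕ, ∑' j : ℤ × Idx, (sz j.2 : ℝ≥0∞) ^ N * ‖V j.1 j.2‖ₑ ≠ ∞) ∧
      ∀ a, ∀ z ∈ Qs, ∀ s : ℂ, ‖s‖ ≤ 1 →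
        HasSum (fun j : ℤ × Idx => (ex (j.1 * a) * em j.2 (z, s)) • V j.1 j.2) (f a (z, s)) := by
  set g : (Fin 4 → ℝ) → E := fun x => f (x 3) ((fr (x 0) : ℂ) + fr (x 1) * I, ex (x 2)) with hg
  have hre : ∀ x y : ℝ, |x| ≤ ‖(x : ℂ) + y * I‖ := fun x y => by
    simpa using Complex.abs_re_le_norm ((x : ℂ) + y * I)
  have him : ∀ x y : ℝ, |y| ≤ ‖(x : ℂ) + y * I‖ := fun x y => by
    simpa using Complex.abs_im_le_norm ((x : ℂ) + y * I)
  have hgp : LatticePeriodic g := by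
    intro x m
    have hm : f (x 3 + m 3) = f (x 3) := by
      have h1 : Function.Periodic f 1 := hper
      simpa using h1.int_mul (m 3) (x 3)
    simp only [hg, fr_add_int, ex_add_int, hm]
  have hgs : ContDiff ℝ (⊤ : ℕ∞) g := by
    rw [contDiff_iff_contDiffAt]
    intro x
    have hev : ∀ i : Fin 4, Tendsto (fun y : Fin 4 → ℝ => y i) (𝓝 x) (𝓝 (x i)) :=
      fun i => (continuous_apply i).continuousAt
    by_cases h : |fr (x 0)| < 1 / 2 ∧ |fr (x 1)| < 1 / 2
    · have h1 : g =ᶠ[𝓝 x] fun y =>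
          f (y 3) (((y 0 - round (x 0) : ℝ) : ℂ) + (y 1 - round (x 1) : ℝ) * I, ex (y 2)) := by
        filter_upwards [(hev 0).eventually (contDiffAt_fr h.1),
          (hev 1).eventually (contDiffAt_fr h.2)] with y hy0 hy1
        simp only [hg, hy0, hy1]
      refine ContDiffAt.congr_of_eventuallyEq ?_ h1
      have hp : ∀ i : Fin 4, ContDiff ℝ (⊤ : ℕ∞) fun y : Fin 4 → ℝ => y i := fun i =>
        contDiff_apply ℝ ℝ i
      have h2 : ContDiff ℝ (⊤ : ℕ∞) fun y : Fin 4 → ℝ => (y 3,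
          (((y 0 - round (x 0) : ℝ) : ℂ) + (y 1 - round (x 1) : ℝ) * I, ex (y 2))) := by
        refine (hp 3).prodMk (ContDiff.prodMk ?_ (contDiff_ex.comp (hp 2)))
        exact (Complex.ofRealCLM.contDiff.comp ((hp 0).sub contDiff_const)).add
          ((Complex.ofRealCLM.contDiff.comp ((hp 1).sub contDiff_const)).mul contDiff_const)
      exact (hsm (x 3) _ (ex (x 2)) (norm_ex _).le).comp x h2.contDiffAt
    · have h1 : g =ᶠ[𝓝 x] fun _ => 0 := by
        rw [not_and_or, not_lt, not_lt] at h
        rcases h with h | h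
        · filter_upwards [(hev 0).eventually (fr_large h)] with y hy
          exact h0 _ _ _ (hy.trans_le (hre _ _))
        · filter_upwards [(hev 1).eventually (fr_large h)] with y hy
          exact h0 _ _ _ (hy.trans_le (him _ _))
      exact contDiffAt_const.congr_of_eventuallyEq h1
  obtain ⟨c, hcr, hcs⟩ := exists_fourier_series hgp hgs
  have hc1 : Summable fun n => ‖c n‖ := by simpa using hcr 0
  have hgf : ∀ a, ∀ z ∈ Qs, ∀ t, g ![z.re, z.im, t, a] = f a (z, ex t) := by
    intro a z hz t
    simp only [hg, Matrix.cons_val_zero, Matrix.cons_val_one, Matrix.cons_val]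
    by_cases h : |z.re| < 1 / 2 ∧ |z.im| < 1 / 2
    · rw [fr_eq_self h.1, fr_eq_self h.2, Complex.re_add_im]
    · rw [not_and_or, not_lt, not_lt] at h
      rw [h0, h0]
      · rcases h with h | h
        · linarith [Complex.abs_re_le_norm z]
        · linarith [Complex.abs_im_le_norm z]
      · rcases h with h | h
        · linarith [abs_fr_eq hz.1, hre (fr z.re) (fr z.im)]
        · linarith [abs_fr_eq hz.2, him (fr z.re) (fr z.im)]
  have hexp : ∀ (n : Fin 4 → ℤ) (x : Fin 4 → ℝ), Complex.exp (2 * Real.pi * I *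
      ((∑ i, n i * x i : ℝ) : ℂ)) = ex (x 2) ^ n 2 * (ex (n 0 * x 0) * ex (n 1 * x 1) *
        ex (n 3 * x 3)) := by
    intro n x
    rw [← ex_int_mul, ← ex_add, ← ex_add, ← ex_add, Fin.sum_univ_four]
    unfold ex
    congr 3
    ring
  -- coefficients in the disc variable, for fixed `a, z`
  have key : ∀ a, ∀ z ∈ Qs, ∃ d : (Fin 4 → ℤ) → E,
      (∀ n, d n = (ex (n 0 * z.re) * ex (n 1 * z.im) * ex (n 3 * a)) • c n) ∧
      ∑' n, ‖d n‖ₑ ≠ ∞ ∧ (∀ k < 0, push (fun n : Fin 4 → ℤ => n 2) d k = 0) ∧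
      ∀ s : ℂ, ‖s‖ ≤ 1 →
        HasSum (fun k : ℕ => s ^ k • push (fun n : Fin 4 → ℤ => n 2) d k) (f a (z, s)) := by
    intro a z hz
    set d : (Fin 4 → ℤ) → E :=
      fun n => (ex (n 0 * z.re) * ex (n 1 * z.im) * ex (n 3 * a)) • c n with hd
    have hdn : ∀ n, ‖d n‖ = ‖c n‖ := fun n => by simp [hd, norm_smul, norm_ex]
    have hdf : ∑' n, ‖d n‖ₑ ≠ ∞ := summable_norm_iff_enorm.mp (by simpa only [hdn] using hc1)
    have hpf : Summable fun k => ‖push (fun n : Fin 4 → ℤ => n 2) d k‖ := by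
      refine summable_norm_iff_enorm.mpr (ne_top_of_le_ne_top hdf ?_)
      simpa using tsum_push_le (fun n : Fin 4 → ℤ => n 2) d (fun _ => 1)
    have hcont : ContinuousOn (fun s => f a (z, s)) (Metric.closedBall 0 1) := fun s hs =>
      ((hh a).differentiableAt_snd (Set.mem_univ z)
        (by simpa using hs)).continuousAt.continuousWithinAt
    have hdif : DifferentiableOn ℂ (fun s => f a (z, s)) (Metric.ball 0 1) := fun s hs =>
      ((hh a).differentiableAt_snd (Set.mem_univ z)
        (by have : ‖s‖ < 1 := by simpa using hs
            exact this.le)).differentiableWithinAt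
    have hsum : ∀ s : ℂ, ‖s‖ = 1 →
        HasSum (fun k : ℤ => s ^ k • push (fun n : Fin 4 → ℤ => n 2) d k) (f a (z, s)) := by
      intro s hs
      obtain ⟨t, rfl⟩ := exists_ex hs
      refine hasSum_push (g := fun k : ℤ => ex t ^ k) hdf ?_
      rw [← hgf a z hz t]
      refine (hcs _).congr_fun fun n => ?_
      rw [hexp, mul_smul]
      simp [hd]
    obtain ⟨h1, h2⟩ := hardy hcont hdif hpf hsum
    exact ⟨d, fun n => rfl, hdf, h1, h2⟩
  have hneg : ∀ n : Fin 4 → ℤ, n 2 < 0 → c n = 0 := by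
    set c' : (Fin 4 → ℤ) → E := fun n => if n 2 < 0 then c n else 0 with hc'
    have hc's : Summable fun n => ‖c' n‖ :=
      Summable.of_nonneg_of_le (fun n => norm_nonneg _) (fun n => by
        simp only [hc']; split_ifs <;> simp) hc1
    have hz : c' = 0 := by
      refine fourier_series_unique hc's fun x => ?_
      obtain ⟨d, hd, hdf, hd0, -⟩ := key (x 3) _ (fr_mem_Qs (x 0) (x 1))
      set d' : (Fin 4 → ℤ) → E := fun n => if n 2 < 0 then d n else 0 with hd'
      have hd'f : ∑' n, ‖d' n‖ₑ ≠ ∞ := by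
        refine ne_top_of_le_ne_top hdf (ENNReal.tsum_le_tsum fun n => ?_)
        simp only [hd']; split_ifs <;> simp
      have hp0 : ∀ k, push (fun n : Fin 4 → ℤ => n 2) d' k = 0 := by
        intro k
        rcases lt_or_ge k 0 with hk | hk
        · rw [← hd0 k hk]
          refine tsum_congr fun j => ?_
          have h : j.1 2 = k := j.2
          have : (j.1 2) < 0 := by rw [h]; exact hk
          simp [hd', this]
        · refine (tsum_congr fun j => ?_).trans tsum_zero
          have h : j.1 2 = k := j.2
          have : ¬ (j.1 2) < 0 := by rw [h]; exact not_lt.mpr hk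
          simp [hd', this]
      have h1 : Summable fun n : Fin 4 → ℤ => ex (x 2) ^ (n 2) • d' n := by
        refine Summable.of_norm_bounded (summable_norm_iff_enorm.mpr hd'f) fun n => ?_
        rw [norm_smul, norm_zpow, norm_ex, _root_.one_zpow, one_mul]
      obtain ⟨S, hS⟩ := h1
      have h2 := hasSum_push (g := fun k : ℤ => ex (x 2) ^ k) (φ := fun n : Fin 4 → ℤ => n 2)
        hd'f hS
      simp only [hp0, smul_zero] at h2
      have hS0 : S = 0 := h2.unique hasSum_zero
      rw [hS0] at hS
      refine hS.congr_fun fun n => ?_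
      rw [hexp, mul_smul]
      simp only [hd', hc']
      split_ifs
      · rw [hd n]
        simp [ex_int_mul_fr]
      · simp
    intro n hn
    have := congrFun hz n
    simpa [hc', hn] using this
  set ι : ℤ × Idx → (Fin 4 → ℤ) := fun j => ![j.2.1, j.2.2.1, j.2.2.2, j.1] with hι
  have hinj : Function.Injective ι := by
    rintro ⟨l, p, q, k⟩ ⟨l', p', q', k'⟩ h
    have h0 := congrFun h 0
    have h1 := congrFun h 1
    have h2 := congrFun h 2
    have h3 := congrFun h 3
    simp only [hι, Matrix.cons_val_zero, Matrix.cons_val_one, Matrix.cons_val] at h0 h1 h2 h3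
    simp only [Prod.mk.injEq]
    exact ⟨h3, h0, h1, by exact_mod_cast h2⟩
  have hc0 : ∀ n ∉ Set.range ι, c n = 0 := by
    intro n hn
    refine hneg n ?_
    by_contra hcon
    refine hn ⟨(n 3, n 0, n 1, (n 2).toNat), ?_⟩
    ext i
    fin_cases i <;> simp [hι]
    omega
  refine ⟨fun l n => c (ι (l, n)), fun N => ?_, fun a z hz s hs => ?_⟩
  · refine ne_top_of_le_ne_top (((hcr N).comp_injective hinj).tsum_ofReal_ne_top) ?_
    refine ENNReal.tsum_le_tsum fun j => ?_
    simp only [Function.comp_apply]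
    have hf0 := freqSize_nonneg (ι j)
    rw [ENNReal.ofReal_mul (by positivity), ofReal_norm, ENNReal.ofReal_pow (by positivity)]
    gcongr
    rw [← ENNReal.ofReal_natCast]
    refine ENNReal.ofReal_le_ofReal ?_
    have : (sz j.2 : ℝ) = 1 + |(j.2.1 : ℝ)| + |(j.2.2.1 : ℝ)| + j.2.2.2 := by
      simp [sz, Nat.cast_natAbs]
    rw [this]
    simp only [freqSize, Fin.sum_univ_four, hι, Matrix.cons_val_zero, Matrix.cons_val_one,
      Matrix.cons_val, Int.cast_natCast, Nat.abs_cast]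
    linarith [abs_nonneg (j.1 : ℝ)]
  · obtain ⟨d, hd, hdf, hd0, hd1⟩ := key a z hz
    have h1 : Summable fun n : Fin 4 → ℤ => s ^ (n 2).toNat • d n := by
      refine Summable.of_norm_bounded (summable_norm_iff_enorm.mpr hdf) fun n => ?_
      rw [norm_smul, norm_pow]
      exact mul_le_of_le_one_left (norm_nonneg _) (pow_le_one₀ (norm_nonneg _) hs)
    obtain ⟨S, hS⟩ := h1
    have h2 := hasSum_push (g := fun k : ℤ => s ^ k.toNat) (φ := fun n : Fin 4 → ℤ => n 2)
      hdf hS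
    rw [← (Nat.cast_injective (R := ℤ)).hasSum_iff] at h2
    · have h3 : S = f a (z, s) := h2.unique (by simpa [Function.comp_def] using hd1 s hs)
      rw [h3, ← hinj.hasSum_iff (fun n hn => by rw [hd n, hc0 n hn]; simp)] at hS
      refine hS.congr_fun fun j => ?_
      have h4 : em j.2 (z, s) = em j.2 ((z.re : ℂ) + z.im * I, s) := by rw [Complex.re_add_im]
      rw [h4, em_eq]
      simp only [Function.comp_apply, hd, smul_smul]
      congr 1
      simp only [hι, Matrix.cons_val_zero, Matrix.cons_val_one, Matrix.cons_val, Int.toNat_natCast]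
      ring
    · intro k hk
      rw [hd0 k, smul_zero]
      by_contra hcon
      exact hk ⟨k.toNat, by simp; omega⟩

theorem exists_rapid [CompleteSpace E] {f : ℂ × ℂ → E} (hf : SmH Set.univ f)
    (h0 : ∀ z s : ℂ, 3 / 8 < ‖z‖ → f (z, s) = 0) : ∃ V, Rapid V ∧ Rep V f := by
  obtain ⟨V, h1, h2⟩ := exists_expansion (f := fun _ => f)
    (fun a z s hs => ContDiffAt.comp (a, (z, s)) (hf.contDiffAt (Set.mem_univ z) hs)
      contDiffAt_snd) (fun _ => hf) (fun _ => h0) (fun _ => rfl)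
  refine ⟨push (fun j : ℤ × Idx => j.2) (fun j => V j.1 j.2), fun N => ?_, fun z hz s hs => ?_⟩
  · exact ne_top_of_le_ne_top (h1 N) (tsum_push_le _ _ _)
  · refine hasSum_push (g := fun n => em n (z, s)) (by simpa using h1 0) ?_
    refine (h2 0 z hz s hs).congr_fun fun j => ?_
    simp [ex]

/-- A smooth compactly supported function with a coefficient bound has a rapidly decreasing
expansion with the same bound. -/
lemma Bd.exists_rapid [CompleteSpace E] {f : ℂ × ℂ → E} {ν : ℝ≥0∞} (h : Bd f ν)
    (hf : SmH Set.univ f) (h0 : ∀ z s : ℂ, 3 / 8 < ‖z‖ → f (z, s) = 0) :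
    ∃ V, Rapid V ∧ Rep V f ∧ l1 V ≤ ν := by
  obtain ⟨V, h1, h2⟩ := PlanarTransport.exists_rapid hf h0
  obtain ⟨V', h3, h4, h5⟩ := h
  have h6 := h2.unique h5 h1.l1_ne_top h4
  exact ⟨V, h1, h2, h6 ▸ h3⟩

lemma exists_bd [CompleteSpace E] {f : ℂ × ℂ → E} (hf : SmH Set.univ f)
    (h0 : ∀ z s : ℂ, 3 / 8 < ‖z‖ → f (z, s) = 0) : ∃ ν : ℝ≥0∞, ν ≠ ∞ ∧ Bd f ν := by
  obtain ⟨V, h1, h2⟩ := exists_rapid hf h0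
  exact ⟨l1 V, h1.l1_ne_top, V, le_rfl, h1.l1_ne_top, h2⟩

end Expansion

section ExpBounds
open scoped ENNReal Nat
variable {A : Type*} [NormedRing A] [NormedAlgebra ℂ A] [CompleteSpace A] [NormOneClass A]

lemma Bd.pow {f : ℂ × ℂ → A} {ν : ℝ≥0∞} (hf : Bd f ν) (n : ℕ) :
    Bd (fun p => f p ^ n) (ν ^ n) := by
  induction n with
  | zero => simpa using Bd.const (1 : A)
  | succ n ih => simpa only [pow_succ] using ih.mul hf

lemma Bd.pow_sub {f g : ℂ × ℂ → A} {a d : ℝ} (ha : 0 ≤ a) (hd : 0 ≤ d)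
    (hg : Bd g (ENNReal.ofReal a)) (hfg : Bd (fun p => f p - g p) (ENNReal.ofReal d)) (n : ℕ) :
    Bd (fun p => f p ^ n - g p ^ n) (ENNReal.ofReal (n * (d * (a + d) ^ (n - 1)))) := by
  have hf : Bd f (ENNReal.ofReal (a + d)) := by
    rw [ENNReal.ofReal_add ha hd]
    exact (hg.add hfg).congr fun z _ s _ => by abel
  induction n with
  | zero => simpa using Bd.zero
  | succ n ih =>
    have h := ((hf.pow n).mul hfg).add (ih.mul hg)
    rw [← ENNReal.ofReal_pow (by positivity), ← ENNReal.ofReal_mul (by positivity),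
      ← ENNReal.ofReal_mul (by positivity), ← ENNReal.ofReal_add (by positivity) (by positivity)]
      at h
    refine (h.congr fun z _ s _ => ?_).mono (ENNReal.ofReal_le_ofReal ?_)
    · rw [pow_succ, pow_succ]; noncomm_ring
    · rcases n with _ | n
      · simp
      · simp only [Nat.add_sub_cancel]
        have : (a + d) ^ n * a ≤ (a + d) ^ (n + 1) := by
          rw [pow_succ]
          gcongr
          linarith
        push_cast
        nlinarith [mul_le_mul_of_nonneg_left this (by positivity : (0 : ℝ) ≤ (n + 1) * d)]

lemma Bd.exp_sub {f g : ℂ × ℂ → A} {a d : ℝ} (ha : 0 ≤ a) (hd : 0 ≤ d)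
    (hg : Bd g (ENNReal.ofReal a)) (hfg : Bd (fun p => f p - g p) (ENNReal.ofReal d)) :
    Bd (fun p => NormedSpace.exp (f p) - NormedSpace.exp (g p))
      (ENNReal.ofReal (d * Real.exp (a + d))) := by
  have h1 : HasSum (fun n : ℕ => (n ! : ℝ)⁻¹ * (n * (d * (a + d) ^ (n - 1))))
      (d * Real.exp (a + d)) := by
    rw [← hasSum_nat_add_iff' 1]
    have h2 := (NormedSpace.exp_series_hasSum_exp' (𝕂 := ℝ) (a + d)).mul_left d
    rw [← Real.exp_eq_exp_ℝ] at h2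
    simp only [Finset.range_one, Finset.sum_singleton, CharP.cast_eq_zero, zero_mul, mul_zero,
      sub_zero]
    refine h2.congr_fun fun n => ?_
    rw [Nat.factorial_succ, smul_eq_mul]
    simp only [Nat.add_sub_cancel]
    have : (n ! : ℝ) ≠ 0 := by positivity
    push_cast
    field_simp
  have h3 : ∀ n : ℕ, Bd (fun p => ((n ! : ℂ)⁻¹) • (f p ^ n - g p ^ n))
      (ENNReal.ofReal ((n ! : ℝ)⁻¹ * (n * (d * (a + d) ^ (n - 1))))) := fun n => by
    have h := (Bd.pow_sub ha hd hg hfg n).const_smul ((n ! : ℂ)⁻¹)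
    rw [ENNReal.ofReal_mul (by positivity)]
    refine h.mono (le_of_eq ?_)
    congr 1
    rw [← ofReal_norm]
    simp
  have h4 : ∑' n : ℕ, ENNReal.ofReal ((n ! : ℝ)⁻¹ * (n * (d * (a + d) ^ (n - 1)))) =
      ENNReal.ofReal (d * Real.exp (a + d)) := by
    rw [← h1.tsum_eq, ENNReal.ofReal_tsum_of_nonneg (fun n => by positivity) h1.summable]
  rw [← h4]
  refine Bd.tsum h3 (by rw [h4]; exact ENNReal.ofReal_ne_top) fun z _ s _ => ?_
  simp only [smul_sub]
  exact (NormedSpace.exp_series_hasSum_exp' (𝕂 := ℂ) (f (z, s))).sub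
    (NormedSpace.exp_series_hasSum_exp' (𝕂 := ℂ) (g (z, s)))

end ExpBounds

section Multiplier
open scoped ENNReal
variable {E : Type*} [NormedAddCommGroup E] [NormedSpace ℂ E]

lemma exists_shift (β : ℂ) {δ : ℝ} (hδ : 0 ≤ δ) :
    ∃ i : Fin 4, ‖β‖ + δ / 2 ≤ ‖β + δ * I ^ (i : ℕ)‖ := by
  have key : ∀ i : Fin 4, ‖β‖ ≤ 2 * (β * (starRingEnd ℂ) (I ^ (i : ℕ))).re →
      ‖β‖ + δ / 2 ≤ ‖β + δ * I ^ (i : ℕ)‖ := by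
    intro i hi
    have h1 : ‖β + δ * I ^ (i : ℕ)‖ ^ 2 =
        ‖β‖ ^ 2 + 2 * δ * (β * (starRingEnd ℂ) (I ^ (i : ℕ))).re + δ ^ 2 := by
      rw [← normSq_eq_norm_sq, ← normSq_eq_norm_sq, normSq_add]
      have : normSq ((δ : ℂ) * I ^ (i : ℕ)) = δ ^ 2 := by
        simp [normSq_eq_norm_sq]
      rw [this, map_mul, conj_ofReal]
      have : (β * (↑δ * (starRingEnd ℂ) (I ^ (i : ℕ)))).re =
        δ * (β * (starRingEnd ℂ) (I ^ (i : ℕ))).re := by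
        rw [mul_left_comm, re_ofReal_mul]
      rw [this]
      ring
    refine le_of_sq_le_sq ?_ (norm_nonneg _)
    rw [h1]
    nlinarith [norm_nonneg β, mul_le_mul_of_nonneg_left hi hδ]
  have h2 := Complex.norm_le_abs_re_add_abs_im β
  rcases le_total |β.im| |β.re| with h | h
  · rcases le_total 0 β.re with h0 | h0
    · refine ⟨0, key 0 ?_⟩
      rw [abs_of_nonneg h0] at *
      simp
      linarith
    · refine ⟨2, key 2 ?_⟩
      rw [abs_of_nonpos h0] at *
      simp
      linarith
  · rcases le_total 0 β.im with h0 | h0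
    · refine ⟨1, key 1 ?_⟩
      rw [abs_of_nonneg h0] at *
      simp
      linarith
    · refine ⟨3, key 3 ?_⟩
      rw [abs_of_nonpos h0] at *
      simp [pow_succ]
      linarith

/-- Raising the exponent of `s` by `2 l`. -/
def sh (x : ℕ × Idx) : Idx := (x.2.1, x.2.2.1, x.2.2.2 + 2 * x.1)

/-- Coefficients of the inverse of `γ + symB + s² symA`. -/
def mcoef (γ : ℂ) (x : ℕ × Idx) : ℂ := (-symA x.2) ^ x.1 / (symB x.2 + γ) ^ (x.1 + 1)

/-- The inverse of `γ + Lop` on coefficients. -/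
def Mop (γ : ℂ) (V : Idx → E) : Idx → E := push sh fun x => mcoef γ x • V x.2

/-- Frequencies where `γ + Lop` is invertible with a gap. -/
def Gap (δ : ℝ) (γ : ℂ) (V : Idx → E) : Prop :=
  ∀ n, V n ≠ 0 → ‖symA n‖ + δ / 2 ≤ ‖symB n + γ‖

/-- Weights for which the inverse of `γ + Lop` is bounded. -/
def Adm (δ : ℝ) (ω : Idx → ℝ≥0∞) : Prop := ∀ n, ∃ G : ℝ, 0 ≤ G ∧
  ‖symA n‖ * G ≤ ‖symA n‖ + δ / 4 ∧ ∀ l, ω (sh (l, n)) ≤ ω n * ENNReal.ofReal (G ^ l)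

lemma adm_one {δ : ℝ} (hδ : 0 ≤ δ) : Adm δ fun _ => 1 := fun n =>
  ⟨1, zero_le_one, by linarith, by simp⟩

lemma tsum_Mop_le {δ : ℝ} (hδ : 0 < δ) {ω : Idx → ℝ≥0∞} (hω : Adm δ ω) {γ : ℂ} {V : Idx → E}
    (hV : Gap δ γ V) : ∑' x : ℕ × Idx, ω (sh x) * ‖mcoef γ x • V x.2‖ₑ ≤
      ENNReal.ofReal (4 / δ) * wnorm ω V := by
  rw [ENNReal.tsum_prod (f := fun l n => ω (sh (l, n)) * ‖mcoef γ (l, n) • V n‖ₑ),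
    ENNReal.tsum_comm, wnorm, ← ENNReal.tsum_mul_left]
  refine ENNReal.tsum_le_tsum fun n => ?_
  by_cases h0 : V n = 0
  · simp [h0]
  obtain ⟨G, hG0, hG, hGω⟩ := hω n
  have hD := hV n h0
  set α := ‖symA n‖ with hα
  set D := ‖symB n + γ‖ with hDdef
  have hα0 : 0 ≤ α := norm_nonneg _
  have hD0 : 0 < D := by linarith
  have hr : α * G / D < 1 := by rw [div_lt_one hD0]; linarith
  have hs : HasSum (fun l : ℕ => D⁻¹ * (α * G / D) ^ l) (D⁻¹ * (1 - α * G / D)⁻¹) :=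
    (hasSum_geometric_of_lt_one (by positivity) hr).mul_left _
  calc ∑' l, ω (sh (l, n)) * ‖mcoef γ (l, n) • V n‖ₑ
      ≤ ∑' l, ENNReal.ofReal (D⁻¹ * (α * G / D) ^ l) * (ω n * ‖V n‖ₑ) := by
        refine ENNReal.tsum_le_tsum fun l => ?_
        have h1 : ‖mcoef γ (l, n)‖ₑ = ENNReal.ofReal (α ^ l / D ^ (l + 1)) := by
          rw [← ofReal_norm, mcoef, norm_div, norm_pow, norm_pow, norm_neg]
        have h2 : D⁻¹ * (α * G / D) ^ l = G ^ l * (α ^ l / D ^ (l + 1)) := by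
          rw [div_pow, mul_pow, pow_succ]
          field_simp
        rw [enorm_smul, h1, h2, ENNReal.ofReal_mul (by positivity)]
        calc _ ≤ (ω n * ENNReal.ofReal (G ^ l)) * (ENNReal.ofReal (α ^ l / D ^ (l + 1)) * ‖V n‖ₑ) := by
              gcongr
              exact hGω l
          _ = _ := by ring
    _ = ENNReal.ofReal (D⁻¹ * (1 - α * G / D)⁻¹) * (ω n * ‖V n‖ₑ) := by
        rw [ENNReal.tsum_mul_right, ← hs.tsum_eq,
          ENNReal.ofReal_tsum_of_nonneg (fun n => by positivity) hs.summable]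
    _ ≤ _ := by
        gcongr
        rw [← mul_inv, mul_sub, mul_one, mul_div_cancel₀ _ hD0.ne', ← inv_div]
        gcongr
        linarith

lemma wnorm_Mop_le {δ : ℝ} (hδ : 0 < δ) {ω : Idx → ℝ≥0∞} (hω : Adm δ ω) {γ : ℂ} {V : Idx → E}
    (hV : Gap δ γ V) : wnorm ω (Mop γ V) ≤ ENNReal.ofReal (4 / δ) * wnorm ω V :=
  (tsum_push_le _ _ ω).trans (tsum_Mop_le hδ hω hV)

lemma push_sub {J K : Type*} [CompleteSpace E] {φ : J → K} {c c' : J → E}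
    (hc : ∑' j, ‖c j‖ₑ ≠ ∞) (hc' : ∑' j, ‖c' j‖ₑ ≠ ∞) (n : K) :
    push φ (fun j => c j - c' j) n = push φ c n - push φ c' n :=
  Summable.tsum_sub ((Summable.of_enorm hc).comp_injective Subtype.val_injective)
    ((Summable.of_enorm hc').comp_injective Subtype.val_injective)

lemma tsum_Mop_ne_top {δ : ℝ} (hδ : 0 < δ) {γ : ℂ} {V : Idx → E} (hV : Gap δ γ V)
    (h : l1 V ≠ ∞) : ∑' x : ℕ × Idx, ‖mcoef γ x • V x.2‖ₑ ≠ ∞ := by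
  have h1 := tsum_Mop_le hδ (adm_one hδ.le) hV
  simp only [one_mul, ← l1_eq_wnorm] at h1
  exact ne_top_of_le_ne_top (ENNReal.mul_ne_top ENNReal.ofReal_ne_top h) h1

lemma l1_Mop_ne_top {δ : ℝ} (hδ : 0 < δ) {γ : ℂ} {V : Idx → E} (hV : Gap δ γ V)
    (h : l1 V ≠ ∞) : l1 (Mop γ V) ≠ ∞ := by
  have h1 := wnorm_Mop_le hδ (adm_one hδ.le) hV
  simp only [← l1_eq_wnorm] at h1
  exact ne_top_of_le_ne_top (ENNReal.mul_ne_top ENNReal.ofReal_ne_top h) h1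

lemma Mop_sub [CompleteSpace E] {δ : ℝ} (hδ : 0 < δ) {γ : ℂ} {V V' : Idx → E}
    (hV : Gap δ γ V) (hV' : Gap δ γ V') (h : l1 V ≠ ∞) (h' : l1 V' ≠ ∞) :
    Mop γ (fun n => V n - V' n) = fun n => Mop γ V n - Mop γ V' n := by
  ext n
  unfold Mop
  rw [← push_sub (tsum_Mop_ne_top hδ hV h) (tsum_Mop_ne_top hδ hV' h')]
  simp only [smul_sub]

lemma norm_symB_eq (n : Idx) : ‖symB n‖ = ‖symA n‖ := by
  have : symB n = -(starRingEnd ℂ) (symA n) := by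
    simp [symA, symB]
    ring
  rw [this, norm_neg, RCLike.norm_conj]

end Multiplier

section Resolvent
open scoped ENNReal
variable {E : Type*} [NormedAddCommGroup E] [NormedSpace ℂ E]

lemma em_sh (x : ℕ × Idx) (p : ℂ × ℂ) : em (sh x) p = em x.2 p * (p.2 ^ 2) ^ x.1 := by
  simp only [em, sh, pow_add, pow_mul, mul_assoc]

lemma resolvent_eq [CompleteSpace E] {δ : ℝ} (hδ : 0 < δ) {γ : ℂ} {V : Idx → E}
    (hV : Gap δ γ V) (hr : Rapid V) (hr' : Rapid (Mop γ V)) {p : ℂ × ℂ} (hp : ‖p.2‖ ≤ 1) :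
    γ • realize (Mop γ V) p + Lop (realize (Mop γ V)) p = realize V p := by
  set g : Idx → ℂ := fun n => (γ + symB n + p.2 ^ 2 * symA n) * em n p with hg
  have h1 : HasSum (fun n => g n • Mop γ V n)
      (γ • realize (Mop γ V) p + Lop (realize (Mop γ V)) p) := by
    refine (((hasSum_realize hr'.l1_ne_top hp).const_smul γ).add
      (hasSum_Lop_realize hr' hp)).congr_fun fun n => ?_
    simp only [hg, smul_smul, ← add_smul]
    congr 1
    ring
  have hs2 : ‖p.2 ^ 2‖ ≤ 1 := by
    rw [norm_pow]
    exact pow_le_one₀ (norm_nonneg _) hp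
  have hgb : ∀ n, ‖g n‖ ≤ ‖γ‖ + ‖symB n‖ + ‖symA n‖ := fun n => by
    rw [hg, norm_mul]
    refine (mul_le_of_le_one_right (norm_nonneg _) (norm_em_le n hp)).trans ?_
    refine (norm_add_le _ _).trans (add_le_add (norm_add_le _ _) ?_)
    rw [norm_mul]
    exact mul_le_of_le_one_left (norm_nonneg _) hs2
  set ω : Idx → ℝ≥0∞ := fun n => ENNReal.ofReal (‖γ‖ + ‖symB n‖ + ‖symA n‖) with hω
  have hadm : Adm δ ω := fun n => ⟨1, zero_le_one, by linarith, fun l => by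
    rw [one_pow, ENNReal.ofReal_one, mul_one]; rfl⟩
  have hfin : wnorm ω V ≠ ∞ := by
    have h2 : ∀ n, ω n ≤ ENNReal.ofReal (‖γ‖ + 14) * (sz n : ℝ≥0∞) ^ 1 := fun n => by
      rw [pow_one, ← ENNReal.ofReal_natCast, ← ENNReal.ofReal_mul (by positivity)]
      refine ENNReal.ofReal_le_ofReal ?_
      rw [norm_symB_eq]
      have h3 := norm_symA_le n
      have h4 : (1 : ℝ) ≤ sz n := by exact_mod_cast one_le_sz n
      nlinarith [norm_nonneg γ]
    refine ne_top_of_le_ne_top ?_ (wnorm_mono h2 V)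
    simp only [wnorm, mul_assoc, ENNReal.tsum_mul_left]
    exact ENNReal.mul_ne_top ENNReal.ofReal_ne_top (hr 1)
  have hsum : Summable fun x : ℕ × Idx => g (sh x) • mcoef γ x • V x.2 := by
    refine Summable.of_enorm (ne_top_of_le_ne_top
      (ENNReal.mul_ne_top ENNReal.ofReal_ne_top hfin) (le_trans ?_ (tsum_Mop_le hδ hadm hV)))
    refine ENNReal.tsum_le_tsum fun x => ?_
    rw [enorm_smul]
    gcongr
    rw [← ofReal_norm]
    exact ENNReal.ofReal_le_ofReal (hgb _)
  have hfib : ∀ n, HasSum (fun l : ℕ => g (sh (l, n)) • mcoef γ (l, n) • V n) (em n p • V n) := by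
    intro n
    by_cases h0 : V n = 0
    · simp [h0, hasSum_zero]
    have hD := hV n h0
    have hD0 : symB n + γ ≠ 0 := by
      rw [← norm_pos_iff]
      linarith [norm_nonneg (symA n)]
    set r : ℂ := -(p.2 ^ 2 * symA n) / (symB n + γ) with hrdef
    have hr1 : ‖r‖ < 1 := by
      rw [hrdef, norm_div, norm_neg, norm_mul, div_lt_one (norm_pos_iff.mpr hD0)]
      have := mul_le_of_le_one_left (norm_nonneg (symA n)) hs2
      linarith
    have hr2 : (1 - r) ≠ 0 := by
      intro h
      rw [sub_eq_zero] at h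
      rw [← h] at hr1
      simp at hr1
    have h3 := (((hasSum_geometric_of_norm_lt_one hr1).mul_left (1 - r)).mul_left
      (em n p)).smul_const (V n)
    rw [mul_inv_cancel₀ hr2, mul_one] at h3
    refine h3.congr_fun fun l => ?_
    rw [smul_smul]
    congr 1
    have e1 : symA (sh (l, n)) = symA n := rfl
    have e2 : symB (sh (l, n)) = symB n := rfl
    simp only [hg, e1, e2, em_sh, mcoef, hrdef]
    rw [div_pow, neg_mul_eq_mul_neg, mul_pow, pow_succ]
    field_simp
    ring
  have h5 : HasSum (fun x : ℕ × Idx => g (sh x) • mcoef γ x • V x.2) (realize V p) := by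
    have h6 := ((Equiv.prodComm Idx ℕ).hasSum_iff (f := fun x : ℕ × Idx =>
      g (sh x) • mcoef γ x • V x.2)).mpr hsum.hasSum
    have h7 := h6.prod_fiberwise hfib
    rw [(hasSum_realize hr.l1_ne_top hp).unique h7]
    exact hsum.hasSum
  exact h1.unique (hasSum_push (tsum_Mop_ne_top hδ hV hr.l1_ne_top) h5)

end Resolvent

section Weights
open scoped ENNReal
variable {E : Type*} [NormedAddCommGroup E] [NormedSpace ℂ E]

/-- The base of the polynomial weights. -/
def wb (e h : ℝ) (n : Idx) : ℝ := 1 + e * (|(n.1 : ℝ)| + |(n.2.1 : ℝ)| + h * n.2.2)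

/-- Polynomial weights which are close to `1` for small `e`. -/
def wt (N : ℕ) (e h : ℝ) (n : Idx) : ℝ≥0∞ := ENNReal.ofReal (wb e h n ^ N)

lemma one_le_wb {e h : ℝ} (he : 0 ≤ e) (hh : 0 ≤ h) (n : Idx) : 1 ≤ wb e h n := by
  unfold wb
  have : 0 ≤ e * (|(n.1 : ℝ)| + |(n.2.1 : ℝ)| + h * n.2.2) := by positivity
  linarith

lemma wt_add (N : ℕ) {e h : ℝ} (he : 0 ≤ e) (hh : 0 ≤ h) (n n' : Idx) :
    wt N e h (n + n') ≤ wt N e h n * wt N e h n' := by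
  have h1 := one_le_wb he hh n
  have h2 := one_le_wb he hh n'
  have h3 := one_le_wb he hh (n + n')
  unfold wt
  rw [← ENNReal.ofReal_mul (by positivity), ← mul_pow]
  refine ENNReal.ofReal_le_ofReal (pow_le_pow_left₀ (by linarith) ?_ N)
  have h4 : wb e h (n + n') ≤ wb e h n + wb e h n' - 1 := by
    unfold wb
    simp only [Prod.fst_add, Prod.snd_add]
    push_cast
    nlinarith [mul_le_mul_of_nonneg_left (abs_add_le (n.1 : ℝ) n'.1) he,
      mul_le_mul_of_nonneg_left (abs_add_le (n.2.1 : ℝ) n'.2.1) he]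
  nlinarith

lemma sz_cast (n : Idx) : (sz n : ℝ) = 1 + |(n.1 : ℝ)| + |(n.2.1 : ℝ)| + n.2.2 := by
  unfold sz
  push_cast
  simp [Nat.cast_natAbs]

lemma wnorm_wt_le (N : ℕ) {e h : ℝ} (he : 0 ≤ e) (he1 : e ≤ 1) (hh : 0 ≤ h) (hh1 : h ≤ 1)
    (V : Idx → E) : wnorm (wt N e h) V ≤
      l1 V + ENNReal.ofReal e * wnorm (fun n => (sz n : ℝ≥0∞) ^ N) V := by
  unfold wnorm l1
  rw [← ENNReal.tsum_mul_left, ← ENNReal.tsum_add]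
  refine ENNReal.tsum_le_tsum fun n => ?_
  rw [← mul_assoc, ← one_add_mul]
  gcongr
  beta_reduce
  rw [← ENNReal.ofReal_one, ← ENNReal.ofReal_natCast, ← ENNReal.ofReal_pow (by positivity),
    ← ENNReal.ofReal_mul he, ← ENNReal.ofReal_add zero_le_one (by positivity)]
  refine ENNReal.ofReal_le_ofReal ?_
  have h1 : wb e h n ≤ (1 - e) • 1 + e • (sz n : ℝ) := by
    rw [sz_cast]
    unfold wb
    simp only [smul_eq_mul]
    have : e * (h * n.2.2) ≤ e * (n.2.2 : ℝ) := by
      gcongr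
      exact mul_le_of_le_one_left (Nat.cast_nonneg _) hh1
    nlinarith
  have h2 := (convexOn_pow N).2 (x := (1 : ℝ)) (by simp) (y := (sz n : ℝ)) (by simp)
    (sub_nonneg.mpr he1) he (by ring)
  refine (pow_le_pow_left₀ (by linarith [one_le_wb he hh n]) h1 N).trans (h2.trans ?_)
  simp
  linarith

lemma wt_le_sz (N : ℕ) {e h : ℝ} (he : 0 ≤ e) (he1 : e ≤ 1) (hh : 0 ≤ h) (hh1 : h ≤ 1)
    (n : Idx) : wt N e h n ≤ (sz n : ℝ≥0∞) ^ N := by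
  unfold wt
  rw [← ENNReal.ofReal_natCast, ← ENNReal.ofReal_pow (by positivity)]
  refine ENNReal.ofReal_le_ofReal (pow_le_pow_left₀ (by linarith [one_le_wb he hh n]) ?_ N)
  rw [sz_cast]
  unfold wb
  have h1 : h * n.2.2 ≤ (n.2.2 : ℝ) := mul_le_of_le_one_left (Nat.cast_nonneg _) hh1
  have h2 := mul_le_of_le_one_left
    (by positivity : 0 ≤ |(n.1 : ℝ)| + |(n.2.1 : ℝ)| + h * n.2.2) he1
  linarith

lemma rapid_of_wt {V : Idx → E} (H : ∀ N : ℕ, ∃ e h : ℝ, 0 < e ∧ e ≤ 1 ∧ 0 < h ∧ h ≤ 1 ∧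
    wnorm (wt N e h) V ≠ ∞) : Rapid V := fun N => by
  obtain ⟨e, h, he, he1, hh, hh1, hfin⟩ := H N
  have h2 : ∀ n, (sz n : ℝ≥0∞) ^ N ≤ ENNReal.ofReal ((e * h)⁻¹ ^ N) * wt N e h n := fun n => by
    unfold wt
    have h3 := one_le_wb he.le hh.le n
    rw [← ENNReal.ofReal_natCast, ← ENNReal.ofReal_pow (by positivity),
      ← ENNReal.ofReal_mul (by positivity), ← mul_pow]
    refine ENNReal.ofReal_le_ofReal (pow_le_pow_left₀ (by positivity) ?_ N)
    rw [← div_eq_inv_mul, le_div_iff₀ (by positivity), sz_cast]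
    unfold wb
    have h4 : e * h ≤ 1 := mul_le_one₀ he1 hh.le hh1
    have h5 : e * h ≤ e := mul_le_of_le_one_right he.le hh1
    nlinarith [abs_nonneg (n.1 : ℝ), abs_nonneg (n.2.1 : ℝ),
      mul_le_mul_of_nonneg_left h5 (abs_nonneg (n.1 : ℝ)),
      mul_le_mul_of_nonneg_left h5 (abs_nonneg (n.2.1 : ℝ))]
  refine ne_top_of_le_ne_top ?_ (wnorm_mono h2 V)
  simp only [wnorm, mul_assoc, ENNReal.tsum_mul_left]
  exact ENNReal.mul_ne_top ENNReal.ofReal_ne_top hfin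

lemma norm_symA_le_pi (n : Idx) : ‖symA n‖ ≤ Real.pi * (|(n.1 : ℝ)| + |(n.2.1 : ℝ)|) := by
  unfold symA
  rw [norm_mul, norm_real, Real.norm_of_nonneg Real.pi_pos.le]
  gcongr
  refine (norm_add_le _ _).trans ?_
  simp

/-- The slope of the weight in the last frequency. -/
def slope (δ : ℝ) (N : ℕ) : ℝ := δ / (16 * Real.pi * (N + 1))

lemma slope_pos {δ : ℝ} (hδ : 0 < δ) (N : ℕ) : 0 < slope δ N := by
  unfold slope
  have := Real.pi_pos
  positivity

lemma slope_mul (δ : ℝ) (N : ℕ) : slope δ N * (16 * Real.pi * (N + 1)) = δ := by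
  unfold slope
  have := Real.pi_pos
  field_simp

lemma slope_le {δ : ℝ} (hδ : 0 < δ) (hδ1 : δ ≤ 1) (N : ℕ) : slope δ N * (N + 1) ≤ 1 / 16 := by
  have h := slope_mul δ N
  have h1 := slope_pos hδ N
  have h2 := Real.pi_gt_three
  nlinarith [mul_pos h1 (by positivity : (0 : ℝ) < N + 1)]

lemma adm_wt {δ : ℝ} (hδ : 0 < δ) (hδ1 : δ ≤ 1) (N : ℕ) {e : ℝ} (he : 0 < e) (he1 : e ≤ 1) :
    Adm δ (wt N e (slope δ N)) := fun n => by
  set h := slope δ N with hh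
  have hh0 : 0 < h := slope_pos hδ N
  have hhN : h * (N + 1) ≤ 1 / 16 := slope_le hδ hδ1 N
  have hmul : h * (16 * Real.pi * (N + 1)) = δ := slope_mul δ N
  have hpi := Real.pi_gt_three
  set a : ℝ := |(n.1 : ℝ)| + |(n.2.1 : ℝ)| with ha
  have ha0 : 0 ≤ a := by positivity
  set y : ℝ := 2 * e * h / (1 + e * a) with hy
  have hy0 : 0 ≤ y := by positivity
  have hya : y * (1 + e * a) = 2 * e * h := by
    rw [hy]; field_simp
  have hy1 : y ≤ 2 * h := by nlinarith [mul_nonneg hy0 (mul_nonneg he.le ha0)]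
  have hya2 : y * a ≤ 2 * h := by
    have : e * (y * a) ≤ e * (2 * h) := by nlinarith
    exact le_of_mul_le_mul_left this he
  have hNy : N * y ≤ 1 := by
    nlinarith [mul_le_mul_of_nonneg_left hy1 (Nat.cast_nonneg (α := ℝ) N)]
  have hE : (1 + y) ^ N ≤ 1 + 2 * (N * y) := by
    have h1 : (1 + y) ^ N ≤ Real.exp (N * y) := by
      rw [Real.exp_nat_mul]
      exact pow_le_pow_left₀ (by linarith) (by linarith [Real.add_one_le_exp y]) N
    have h2 := Real.abs_exp_sub_one_le (x := N * y) (by rw [abs_of_nonneg (by positivity)]; exact hNy)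
    rw [abs_of_nonneg (a := N * y) (by positivity)] at h2
    linarith [le_abs_self (Real.exp (N * y) - 1)]
  refine ⟨(1 + y) ^ N, by positivity, ?_, fun l => ?_⟩
  · have h1 := norm_symA_le_pi n
    have h2 : ‖symA n‖ * (2 * (N * y)) ≤ δ / 4 := by
      calc ‖symA n‖ * (2 * (N * y)) ≤ Real.pi * a * (2 * (N * y)) := by gcongr
        _ = 2 * Real.pi * N * (y * a) := by ring
        _ ≤ 2 * Real.pi * N * (2 * h) := by gcongr
        _ ≤ 4 * Real.pi * (N + 1) * h := by nlinarith [mul_pos Real.pi_pos hh0]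
        _ = δ / 4 := by rw [← hmul]; ring
    nlinarith [mul_le_mul_of_nonneg_left hE (norm_nonneg (symA n))]
  · unfold wt
    have hb := one_le_wb he.le hh0.le n
    have hbs := one_le_wb he.le hh0.le (sh (l, n))
    rw [← ENNReal.ofReal_mul (by positivity)]
    refine ENNReal.ofReal_le_ofReal ?_
    rw [← pow_mul, mul_comm N l, pow_mul, ← mul_pow]
    refine pow_le_pow_left₀ (by linarith) ?_ N
    have h1 : wb e h (sh (l, n)) = wb e h n + 2 * e * h * l := by
      simp only [wb, sh]
      push_cast
      ring
    have h2 : 1 + l * y ≤ (1 + y) ^ l := one_add_mul_le_pow (by linarith) l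
    have h3 : 1 + e * a ≤ wb e h n := by
      unfold wb
      have : 0 ≤ e * (h * n.2.2) := by positivity
      nlinarith
    have h4 : 2 * e * h ≤ y * wb e h n := by nlinarith
    rw [h1]
    calc wb e h n + 2 * e * h * l ≤ wb e h n + y * wb e h n * l := by gcongr
      _ = wb e h n * (1 + l * y) := by ring
      _ ≤ _ := by gcongr

end Weights

section Neumann
open scoped ENNReal
variable {E : Type*} [NormedAddCommGroup E] [NormedSpace ℂ E] [CompleteSpace E]

lemma wnorm_iterate_le {T : (Idx → E) → Idx → E} {ω : Idx → ℝ≥0∞}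
    (h : ∀ V, wnorm ω (T V) ≤ 2⁻¹ * wnorm ω V) (F : Idx → E) (j : ℕ) :
    wnorm ω (T^[j] F) ≤ 2⁻¹ ^ j * wnorm ω F := by
  induction j with
  | zero => simp
  | succ j ih =>
    rw [Function.iterate_succ_apply', pow_succ', mul_assoc]
    exact (h _).trans (by gcongr)

lemma wnorm_tsum_le {u : ℕ → Idx → E} {ω : Idx → ℝ≥0∞} {c : ℝ≥0∞}
    (h : ∀ j, wnorm ω (u j) ≤ 2⁻¹ ^ j * c) : wnorm ω (fun n => ∑' j, u j n) ≤ 2 * c := by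
  calc wnorm ω (fun n => ∑' j, u j n) ≤ ∑' n, ∑' j, ω n * ‖u j n‖ₑ := by
        refine ENNReal.tsum_le_tsum fun n => ?_
        rw [ENNReal.tsum_mul_left]
        gcongr
        exact enorm_tsum_le_tsum_enorm
    _ = ∑' j, wnorm ω (u j) := ENNReal.tsum_comm
    _ ≤ ∑' j : ℕ, 2⁻¹ ^ j * c := ENNReal.tsum_le_tsum h
    _ = 2 * c := by
        rw [ENNReal.tsum_mul_right, ENNReal.tsum_geometric, ENNReal.one_sub_inv_two, inv_inv]

lemma exists_neumann {T : (Idx → E) → Idx → E}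
    (hsub : ∀ V V', l1 V ≠ ∞ → l1 V' ≠ ∞ → T (fun n => V n - V' n) = fun n => T V n - T V' n)
    (hT : ∀ V, l1 (T V) ≤ 2⁻¹ * l1 V) {F : Idx → E} (hF : l1 F ≠ ∞) :
    ∃ V : Idx → E, (∀ n, V n = F n + T V n) ∧
      ∀ ω, (∀ V, wnorm ω (T V) ≤ 2⁻¹ * wnorm ω V) → wnorm ω V ≤ 2 * wnorm ω F := by
  have hT1 : ∀ V, wnorm (fun _ => 1) (T V) ≤ 2⁻¹ * wnorm (fun _ => 1) V := by
    simpa only [l1_eq_wnorm] using hT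
  set u : ℕ → Idx → E := fun j => T^[j] F with hu
  have hul : ∀ j, l1 (u j) ≤ 2⁻¹ ^ j * l1 F := fun j => by
    simpa only [l1_eq_wnorm] using wnorm_iterate_le hT1 F j
  have hus : ∀ n, Summable fun j => u j n := fun n => by
    refine Summable.of_enorm (ne_top_of_le_ne_top (b := 2 * l1 F)
      (ENNReal.mul_ne_top (by simp) hF) ?_)
    calc ∑' j, ‖u j n‖ₑ ≤ ∑' j : ℕ, 2⁻¹ ^ j * l1 F :=
          ENNReal.tsum_le_tsum fun j => (ENNReal.le_tsum n).trans (hul j)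
      _ = 2 * l1 F := by
        rw [ENNReal.tsum_mul_right, ENNReal.tsum_geometric, ENNReal.one_sub_inv_two, inv_inv]
  set P : ℕ → Idx → E := fun N n => ∑ j ∈ Finset.range N, u j n with hP
  set V : Idx → E := fun n => ∑' j, u j n with hV
  have hul_top : ∀ j, l1 (u j) ≠ ∞ := fun j => ne_top_of_le_ne_top
    (ENNReal.mul_ne_top (ENNReal.pow_ne_top (by simp)) hF) (hul j)
  have hPtop : ∀ N, l1 (P N) ≠ ∞ := fun N => by
    induction N with
    | zero => simp [hP, l1]
    | succ N ih =>
      have h : P (N + 1) = fun n => P N n + u N n := by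
        ext n; simp only [hP, Finset.sum_range_succ]
      rw [h, l1_eq_wnorm]
      refine ne_top_of_le_ne_top ?_ (wnorm_add_le _ _ _)
      simp only [← l1_eq_wnorm]
      exact ENNReal.add_ne_top.mpr ⟨ih, hul_top N⟩
  have hVtop : l1 V ≠ ∞ := by
    rw [l1_eq_wnorm]
    refine ne_top_of_le_ne_top ?_ (wnorm_tsum_le (c := l1 F) (u := u)
      fun j => by simpa only [l1_eq_wnorm] using hul j)
    exact ENNReal.mul_ne_top (by simp) hF
  have hTz : T (fun _ => 0) = fun _ => 0 := by
    have h0 : l1 (fun _ : Idx => (0 : E)) ≠ ∞ := by simp [l1]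
    have := hsub _ _ h0 h0
    simpa using this
  have hTP : ∀ N n, F n + T (P N) n = P (N + 1) n := fun N => by
    induction N with
    | zero =>
      intro n
      have : P 0 = fun _ => 0 := by ext n; simp [hP]
      rw [this, hTz]
      simp [hP, hu]
    | succ N ih =>
      intro n
      have h1 : P N = fun n => P (N + 1) n - u N n := by
        ext n; simp only [hP, Finset.sum_range_succ]; abel
      have h2 := hsub _ _ (hPtop (N + 1)) (hul_top N)
      rw [← h1] at h2
      have h3 : T (u N) = u (N + 1) := (Function.iterate_succ_apply' T N F).symm
      have h4 : P (N + 1 + 1) n = P (N + 1) n + u (N + 1) n := by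
        simp only [hP, Finset.sum_range_succ _ (N + 1)]
      rw [h4, ← ih n, h2]
      beta_reduce
      rw [h3]
      abel
  have htail : ∀ N, l1 (fun n => V n - P N n) ≤ 2⁻¹ ^ N * (2 * l1 F) := fun N => by
    have h1 : (fun n => V n - P N n) = fun n => ∑' j, u (j + N) n := by
      ext n
      simp only [hV, hP]
      rw [← (hus n).sum_add_tsum_nat_add N]
      abel
    rw [h1, l1_eq_wnorm, mul_left_comm]
    refine wnorm_tsum_le (u := fun j => u (j + N)) fun j => ?_
    rw [← l1_eq_wnorm, ← mul_assoc, ← pow_add]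
    exact hul _
  have hlim : Tendsto (fun N : ℕ => (2⁻¹ : ℝ≥0∞) ^ N * (4 * l1 F)) atTop (𝓝 0) := by
    have := ENNReal.Tendsto.mul_const (b := 4 * l1 F)
      (ENNReal.tendsto_pow_atTop_nhds_zero_of_lt_one (r := (2⁻¹ : ℝ≥0∞)) (by simp))
      (Or.inr (ENNReal.mul_ne_top (by simp) hF))
    simpa using this
  refine ⟨V, ?_, fun ω hω => wnorm_tsum_le fun j => wnorm_iterate_le hω F j⟩
  have hzero : ∀ N n, ‖V n - (F n + T V n)‖ₑ ≤ 2⁻¹ ^ N * (4 * l1 F) := fun N n => by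
    have h1 : V n - (F n + T V n) = (V n - P (N + 1) n) - T (fun n => V n - P N n) n := by
      rw [hsub _ _ hVtop (hPtop N), ← hTP N n]
      beta_reduce
      abel
    rw [h1]
    calc _ ≤ ‖V n - P (N + 1) n‖ₑ + ‖T (fun n => V n - P N n) n‖ₑ := by
          rw [sub_eq_add_neg]
          exact (enorm_add_le _ _).trans_eq (by rw [enorm_neg])
      _ ≤ 2⁻¹ ^ (N + 1) * (2 * l1 F) + 2⁻¹ * (2⁻¹ ^ N * (2 * l1 F)) := by
          gcongr
          · exact (ENNReal.le_tsum n).trans (htail (N + 1))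
          · exact (ENNReal.le_tsum n).trans ((hT _).trans (by gcongr; exact htail N))
      _ = 2⁻¹ ^ (N + 1) * (4 * l1 F) := by
          rw [pow_succ]
          ring
      _ ≤ 2⁻¹ ^ N * (4 * l1 F) := by
          have h2 : (2⁻¹ : ℝ≥0∞) ≤ 1 := by simp
          exact mul_le_mul' (pow_le_pow_right_of_le_one' h2 (Nat.le_succ N)) le_rfl
  intro n
  have h2 : ‖V n - (F n + T V n)‖ₑ ≤ 0 := ge_of_tendsto' hlim fun N => hzero N n
  exact sub_eq_zero.mp (enorm_eq_zero.mp (le_antisymm h2 zero_le))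

end Neumann

section Split
open scoped ENNReal
variable {E : Type*} [NormedAddCommGroup E] [NormedSpace ℂ E]

/-- The four shifts. -/
def gam (δ : ℝ) (i : Fin 4) : ℂ := δ * I ^ (i : ℕ)

lemma norm_gam {δ : ℝ} (hδ : 0 ≤ δ) (i : Fin 4) : ‖gam δ i‖ = δ := by
  simp [gam, abs_of_nonneg hδ]

open Classical in
/-- The part of a family on which the shift `i` opens a gap. -/
def sel (δ : ℝ) (i : Fin 4) (V : Idx → E) (n : Idx) : E :=
  if (∃ i : Fin 4, ‖symB n‖ + δ / 2 ≤ ‖symB n + δ * I ^ (i : ℕ)‖) ∧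
    Classical.epsilon (fun i : Fin 4 => ‖symB n‖ + δ / 2 ≤ ‖symB n + δ * I ^ (i : ℕ)‖) = i
  then V n else 0

lemma gap_sel (δ : ℝ) (i : Fin 4) (V : Idx → E) : Gap δ (gam δ i) (sel δ i V) := fun n hn => by
  unfold sel at hn
  rw [ne_eq, ite_eq_right_iff, Classical.not_imp] at hn
  have h := Classical.epsilon_spec hn.1.1
  rw [hn.1.2, norm_symB_eq] at h
  exact h

lemma norm_sel_le (δ : ℝ) (i : Fin 4) (V : Idx → E) (n : Idx) : ‖sel δ i V n‖ ≤ ‖V n‖ := by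
  unfold sel
  split_ifs <;> simp

lemma sum_sel {δ : ℝ} (hδ : 0 ≤ δ) (V : Idx → E) (n : Idx) : ∑ i, sel δ i V n = V n := by
  unfold sel
  simp [exists_shift (symB n) hδ]

lemma sum_wnorm_sel {δ : ℝ} (hδ : 0 ≤ δ) (ω : Idx → ℝ≥0∞) (V : Idx → E) :
    ∑ i, wnorm ω (sel δ i V) = wnorm ω V := by
  unfold wnorm
  rw [← Summable.tsum_finsetSum fun _ _ => ENNReal.summable]
  refine tsum_congr fun n => ?_
  have h : ∀ i, ω n * ‖sel δ i V n‖ₑ = if Classical.epsilon (fun i : Fin 4 =>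
      ‖symB n‖ + δ / 2 ≤ ‖symB n + δ * I ^ (i : ℕ)‖) = i then ω n * ‖V n‖ₑ else 0 := by
    intro i
    unfold sel
    simp only [exists_shift (symB n) hδ, true_and]
    split_ifs <;> simp
  simp only [h]
  simp

lemma sel_sub (δ : ℝ) (i : Fin 4) (V V' : Idx → E) :
    sel δ i (fun n => V n - V' n) = fun n => sel δ i V n - sel δ i V' n := by
  ext n
  unfold sel
  split_ifs <;> simp

lemma wnorm_sum_le {J : Type*} (s : Finset J) (ω : Idx → ℝ≥0∞) (V : J → Idx → E) :
    wnorm ω (fun n => ∑ i ∈ s, V i n) ≤ ∑ i ∈ s, wnorm ω (V i) := by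
  unfold wnorm
  rw [← Summable.tsum_finsetSum fun _ _ => ENNReal.summable]
  refine ENNReal.tsum_le_tsum fun n => ?_
  rw [← Finset.mul_sum]
  gcongr
  exact enorm_sum_le _ _

lemma l1_sel_ne_top (δ : ℝ) (i : Fin 4) {V : Idx → E} (h : l1 V ≠ ∞) : l1 (sel δ i V) ≠ ∞ := by
  rw [l1_eq_wnorm] at *
  exact ne_top_of_le_ne_top h (wnorm_mono_right (norm_sel_le δ i V))

lemma Rapid.sel {V : Idx → E} (h : Rapid V) (δ : ℝ) (i : Fin 4) : Rapid (sel δ i V) := fun N =>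
  ne_top_of_le_ne_top (h N) (wnorm_mono_right (norm_sel_le δ i V))

variable {R : Type*} [NormedRing R] [NormedAlgebra ℂ R] [Module R E] [IsBoundedSMul R E]
  [IsScalarTower ℂ R E] [SMulCommClass ℂ R E]

lemma conv_sub [CompleteSpace E] {a : Idx → R} {b b' : Idx → E} (ha : l1 a ≠ ∞) (hb : l1 b ≠ ∞)
    (hb' : l1 b' ≠ ∞) : conv a (fun n => b n - b' n) = fun n => conv a b n - conv a b' n := by
  have key : ∀ b : Idx → E, l1 b ≠ ∞ → ∑' x : Idx × Idx, ‖a x.1 • b x.2‖ₑ ≠ ∞ := fun b hb => by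
    have h1 := tsum_conv_le a b (fun _ => 1) (by simp)
    simp only [one_mul, ← l1_eq_wnorm] at h1
    exact ne_top_of_le_ne_top (ENNReal.mul_ne_top ha hb) h1
  ext n
  unfold conv
  rw [← push_sub (key b hb) (key b' hb')]
  simp only [smul_sub]

end Split

section Core
open scoped ENNReal
variable {A : Type*} [NormedRing A] [NormedAlgebra ℂ A] [CompleteSpace A]

/-- The operator whose fixed points give solutions. -/
def Tsol (δ : ℝ) (W : Fin 4 → Idx → A) (X : Fin 4 → Idx → ℂ) (V : Idx → A) (n : Idx) : A :=
  ∑ i, (conv (W i) (Mop (gam δ i) (sel δ i V)) n - conv (X i) (sel δ i V) n)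

lemma wnorm_sub_le {E : Type*} [NormedAddCommGroup E] [NormedSpace ℂ E] (ω : Idx → ℝ≥0∞) (V V' : Idx → E) :
    wnorm ω (fun n => V n - V' n) ≤ wnorm ω V + wnorm ω V' := by
  simp only [sub_eq_add_neg]
  exact (wnorm_add_le ω V fun n => -V' n).trans_eq (by rw [wnorm_neg])

lemma wnorm_Tsol_le {δ : ℝ} (hδ : 0 < δ) {W : Fin 4 → Idx → A} {X : Fin 4 → Idx → ℂ}
    {ω : Idx → ℝ≥0∞} (hω : Adm δ ω) (hω' : ∀ n n', ω (n + n') ≤ ω n * ω n')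
    (hs : ∀ i, wnorm ω (W i) * ENNReal.ofReal (4 / δ) + wnorm ω (X i) ≤ 2⁻¹) (V : Idx → A) :
    wnorm ω (Tsol δ W X V) ≤ 2⁻¹ * wnorm ω V := by
  calc wnorm ω (Tsol δ W X V) ≤ ∑ i, wnorm ω (fun n =>
        conv (W i) (Mop (gam δ i) (sel δ i V)) n - conv (X i) (sel δ i V) n) :=
        wnorm_sum_le _ _ _
    _ ≤ ∑ i, 2⁻¹ * wnorm ω (sel δ i V) := by
        refine Finset.sum_le_sum fun i _ => ?_
        calc _ ≤ wnorm ω (W i) * wnorm ω (Mop (gam δ i) (sel δ i V)) +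
              wnorm ω (X i) * wnorm ω (sel δ i V) :=
              (wnorm_sub_le _ _ _).trans
                (add_le_add (wnorm_conv_le _ _ ω hω') (wnorm_conv_le _ _ ω hω'))
          _ ≤ wnorm ω (W i) * (ENNReal.ofReal (4 / δ) * wnorm ω (sel δ i V)) +
              wnorm ω (X i) * wnorm ω (sel δ i V) := by
              gcongr
              exact wnorm_Mop_le hδ hω (gap_sel δ i V)
          _ = (wnorm ω (W i) * ENNReal.ofReal (4 / δ) + wnorm ω (X i)) *
              wnorm ω (sel δ i V) := by ring
          _ ≤ _ := by gcongr; exact hs i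
    _ = 2⁻¹ * wnorm ω V := by rw [← Finset.mul_sum, sum_wnorm_sel hδ.le]

lemma Tsol_sub {δ : ℝ} (hδ : 0 < δ) {W : Fin 4 → Idx → A} {X : Fin 4 → Idx → ℂ}
    (hW : ∀ i, l1 (W i) ≠ ∞) (hX : ∀ i, l1 (X i) ≠ ∞) {V V' : Idx → A}
    (hV : l1 V ≠ ∞) (hV' : l1 V' ≠ ∞) :
    Tsol δ W X (fun n => V n - V' n) = fun n => Tsol δ W X V n - Tsol δ W X V' n := by
  ext n
  unfold Tsol
  rw [← Finset.sum_sub_distrib]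
  refine Finset.sum_congr rfl fun i _ => ?_
  have h1 := gap_sel δ i V
  have h2 := gap_sel δ i V'
  have h3 := l1_sel_ne_top δ i hV
  have h4 := l1_sel_ne_top δ i hV'
  rw [sel_sub, Mop_sub hδ h1 h2 h3 h4, conv_sub (hW i) (l1_Mop_ne_top hδ h1 h3)
    (l1_Mop_ne_top hδ h2 h4), conv_sub (hX i) h3 h4]
  beta_reduce
  abel

lemma exists_fixed {δ : ℝ} (hδ : 0 < δ) (hδ1 : δ ≤ 1) {W : Fin 4 → Idx → A}
    {X : Fin 4 → Idx → ℂ} (hW : ∀ i, Rapid (W i)) (hX : ∀ i, Rapid (X i))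
    (hs : ∀ i, l1 (W i) * ENNReal.ofReal (4 / δ) + l1 (X i) ≤ 4⁻¹) {F : Idx → A} (hF : Rapid F) :
    ∃ V, Rapid V ∧ (∀ i, Rapid (Mop (gam δ i) (sel δ i V))) ∧ l1 V ≤ 2 * l1 F ∧
      ∀ n, V n = F n + Tsol δ W X V n := by
  have h42 : (4⁻¹ : ℝ≥0∞) ≤ 2⁻¹ := ENNReal.inv_le_inv.mpr (by norm_num)
  have hT1 : ∀ V, wnorm (fun _ => 1) (Tsol δ W X V) ≤ 2⁻¹ * wnorm (fun _ => 1) V :=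
    wnorm_Tsol_le hδ (adm_one hδ.le) (by simp)
      (fun i => by simpa only [← l1_eq_wnorm] using (hs i).trans h42)
  obtain ⟨V, h1, h2⟩ := exists_neumann (T := Tsol δ W X)
    (fun V V' => Tsol_sub hδ (fun i => (hW i).l1_ne_top) fun i => (hX i).l1_ne_top)
    (by simpa only [l1_eq_wnorm] using hT1) hF.l1_ne_top
  have h3 : l1 V ≤ 2 * l1 F := by simpa only [l1_eq_wnorm] using h2 _ hT1
  have key : ∀ N : ℕ, ∃ e : ℝ, 0 < e ∧ e ≤ 1 ∧ wnorm (wt N e (slope δ N)) V ≠ ∞ := by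
    intro N
    set Q : Fin 4 → ℝ≥0∞ := fun i => wnorm (fun n => (sz n : ℝ≥0∞) ^ N) (W i) *
      ENNReal.ofReal (4 / δ) + wnorm (fun n => (sz n : ℝ≥0∞) ^ N) (X i) with hQ
    have hQtop : ∑ i, Q i ≠ ∞ := ENNReal.sum_ne_top.mpr fun i _ =>
      ENNReal.add_ne_top.mpr ⟨ENNReal.mul_ne_top (hW i N) ENNReal.ofReal_ne_top, hX i N⟩
    set q : ℝ := (∑ i, Q i).toReal with hq
    have hq0 : 0 ≤ q := ENNReal.toReal_nonneg
    set e : ℝ := 1 / (4 * q + 1) with he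
    have he0 : 0 < e := by positivity
    have he1 : e ≤ 1 := by
      rw [he, div_le_one (by positivity)]
      linarith
    have heq : e * q ≤ 1 / 4 := by
      rw [he, one_div_mul_eq_div, div_le_iff₀ (by positivity)]
      linarith
    have hslope := slope_pos hδ N
    have hslope1 : slope δ N ≤ 1 := by
      nlinarith [slope_le hδ hδ1 N, mul_nonneg hslope.le (Nat.cast_nonneg (α := ℝ) N)]
    refine ⟨e, he0, he1, ?_⟩
    have h4 := h2 (wt N e (slope δ N)) (wnorm_Tsol_le hδ (adm_wt hδ hδ1 N he0 he1)
      (wt_add N he0.le hslope.le) fun i => ?_)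
    · exact ne_top_of_le_ne_top (ENNReal.mul_ne_top (by simp) (ne_top_of_le_ne_top (hF N)
        (wnorm_mono (wt_le_sz N he0.le he1 hslope.le hslope1) F))) h4
    · calc _ ≤ (l1 (W i) + ENNReal.ofReal e * wnorm (fun n => (sz n : ℝ≥0∞) ^ N) (W i)) *
            ENNReal.ofReal (4 / δ) +
            (l1 (X i) + ENNReal.ofReal e * wnorm (fun n => (sz n : ℝ≥0∞) ^ N) (X i)) := by
            gcongr <;> exact wnorm_wt_le N he0.le he1 hslope.le hslope1 _
        _ = (l1 (W i) * ENNReal.ofReal (4 / δ) + l1 (X i)) + ENNReal.ofReal e * Q i := by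
            rw [hQ]; ring
        _ ≤ 4⁻¹ + 4⁻¹ := by
            refine add_le_add (hs i) ?_
            calc ENNReal.ofReal e * Q i ≤ ENNReal.ofReal e * ENNReal.ofReal q := by
                  gcongr
                  rw [hq, ENNReal.ofReal_toReal hQtop]
                  exact Finset.single_le_sum (fun _ _ => zero_le) (Finset.mem_univ i)
              _ ≤ ENNReal.ofReal (1 / 4) := by
                  rw [← ENNReal.ofReal_mul he0.le]
                  exact ENNReal.ofReal_le_ofReal heq
              _ = 4⁻¹ := by
                  rw [one_div, ENNReal.ofReal_inv_of_pos (by norm_num)]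
                  simp
        _ = 2⁻¹ := by
            rw [show (4 : ℝ≥0∞) = 2 * 2 by norm_num,
              ENNReal.mul_inv (by simp) (by simp), ← add_mul, ENNReal.inv_two_add_inv_two, one_mul]
  have hslope1 : ∀ N, slope δ N ≤ 1 := fun N => by
    nlinarith [slope_le hδ hδ1 N, mul_nonneg (slope_pos hδ N).le (Nat.cast_nonneg (α := ℝ) N)]
  refine ⟨V, rapid_of_wt fun N => ?_, fun i => rapid_of_wt fun N => ?_, h3, h1⟩
  · obtain ⟨e, he0, he1, h⟩ := key N
    exact ⟨e, slope δ N, he0, he1, slope_pos hδ N, hslope1 N, h⟩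
  · obtain ⟨e, he0, he1, h⟩ := key N
    refine ⟨e, slope δ N, he0, he1, slope_pos hδ N, hslope1 N, ?_⟩
    refine ne_top_of_le_ne_top ?_ (wnorm_Mop_le hδ (adm_wt hδ hδ1 N he0 he1) (gap_sel δ i V))
    exact ENNReal.mul_ne_top ENNReal.ofReal_ne_top
      (ne_top_of_le_ne_top h (wnorm_mono_right (norm_sel_le δ i V)))

end Core

section Cutoffs

/-- A cutoff equal to `1` on the disc of radius `1/4`. -/
def bumpIn : ContDiffBump (0 : ℂ) := ⟨1 / 4, 5 / 16, by norm_num, by norm_num⟩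

/-- A cutoff equal to `1` on the support of `bumpIn`. -/
def bumpOut : ContDiffBump (0 : ℂ) := ⟨5 / 16, 11 / 32, by norm_num, by norm_num⟩

lemma bumpIn_eq_one {z : ℂ} (hz : ‖z‖ ≤ 1 / 4) : bumpIn z = 1 :=
  bumpIn.one_of_mem_closedBall (by simpa [bumpIn] using hz)

lemma bumpIn_eq_zero {z : ℂ} (hz : 5 / 16 ≤ ‖z‖) : bumpIn z = 0 :=
  bumpIn.zero_of_le_dist (by simpa [bumpIn] using hz)

lemma bumpOut_eq_one {z : ℂ} (hz : ‖z‖ ≤ 5 / 16) : bumpOut z = 1 :=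
  bumpOut.one_of_mem_closedBall (by simpa [bumpOut] using hz)

lemma bumpOut_eq_zero {z : ℂ} (hz : 11 / 32 ≤ ‖z‖) : bumpOut z = 0 :=
  bumpOut.zero_of_le_dist (by simpa [bumpOut] using hz)

lemma contDiff_conj : ContDiff ℝ (⊤ : ℕ∞) (starRingEnd ℂ) :=
  Complex.conjCLE.contDiff

lemma contDiff_ofReal_comp {χ : ℂ → ℝ} (hχ : ContDiff ℝ (⊤ : ℕ∞) χ) :
    ContDiff ℝ (⊤ : ℕ∞) fun z => (χ z : ℂ) := Complex.ofRealCLM.contDiff.comp hχ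

end Cutoffs

section Solve
open scoped ENNReal
variable {A : Type*} [NormedRing A] [NormedAlgebra ℂ A] [CompleteSpace A]

lemma smH_expConj (γ : ℂ) (U : Set ℂ) :
    SmH U (fun p => Complex.exp (γ * (starRingEnd ℂ) p.1)) :=
  SmH.of_fst (contDiff_const.mul contDiff_conj).cexp

lemma Lop_expConj (γ : ℂ) (p : ℂ × ℂ) : Lop (fun p => Complex.exp (γ * (starRingEnd ℂ) p.1)) p =
    γ * Complex.exp (γ * (starRingEnd ℂ) p.1) := by
  have h1 : HasFDerivAt (fun p : ℂ × ℂ => (starRingEnd ℂ) p.1)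
      ((Complex.conjCLE : ℂ →L[ℝ] ℂ).comp (ContinuousLinearMap.fst ℝ ℂ ℂ)) p :=
    (Complex.conjCLE : ℂ →L[ℝ] ℂ).hasFDerivAt.comp p hasFDerivAt_fst
  have h2 := (h1.const_mul γ).cexp
  unfold Lop firstOrder
  rw [h2.fderiv]
  simp
  linear_combination (-(Complex.exp (γ * (starRingEnd ℂ) p.1) * γ * (1 - p.2 ^ 2) / 2)) * I_sq

lemma exists_small_exp : ∃ δ : ℝ, 0 < δ ∧ δ ≤ 1 ∧ ∀ i, ∃ X : Idx → ℂ, Rapid X ∧ l1 X ≤ 8⁻¹ ∧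
    Rep X (fun p => (bumpIn p.1 : ℂ) * (Complex.exp (gam δ i * (starRingEnd ℂ) p.1) - 1)) := by
  have hs1 : SmH Set.univ (fun p : ℂ × ℂ => (bumpOut p.1 : ℂ) * (starRingEnd ℂ) p.1) :=
    SmH.of_fst (g := fun z => (bumpOut z : ℂ) * (starRingEnd ℂ) z)
      ((contDiff_ofReal_comp bumpOut.contDiff).mul contDiff_conj)
  have hs2 : SmH Set.univ (fun p : ℂ × ℂ => (bumpIn p.1 : ℂ)) :=
    SmH.of_fst (g := fun z => (bumpIn z : ℂ)) (contDiff_ofReal_comp bumpIn.contDiff)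
  obtain ⟨μ, hμ, hb1⟩ := exists_bd hs1 fun z s hz => by
    simp [bumpOut_eq_zero (show 11 / 32 ≤ ‖z‖ by linarith)]
  obtain ⟨μ', hμ', hb2⟩ := exists_bd hs2 fun z s hz => by
    simp [bumpIn_eq_zero (show 5 / 16 ≤ ‖z‖ by linarith)]
  set m := μ.toReal with hm
  set m' := μ'.toReal with hm'
  have hm0 : 0 ≤ m := ENNReal.toReal_nonneg
  have hm0' : 0 ≤ m' := ENNReal.toReal_nonneg
  set δ : ℝ := 1 / (8 * (m' * (m * Real.exp m)) + 1) with hδ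
  have hδ0 : 0 < δ := by positivity
  have hδ1 : δ ≤ 1 := by
    rw [hδ, div_le_one (by positivity)]
    have : 0 ≤ 8 * (m' * (m * Real.exp m)) := by positivity
    linarith
  refine ⟨δ, hδ0, hδ1, fun i => ?_⟩
  have hb3 : Bd (fun p : ℂ × ℂ => gam δ i • ((bumpOut p.1 : ℂ) * (starRingEnd ℂ) p.1) - 0)
      (ENNReal.ofReal (δ * m)) := by
    simp only [sub_zero]
    refine (hb1.const_smul (gam δ i)).mono (le_of_eq ?_)
    rw [← ofReal_norm, norm_gam hδ0.le, ENNReal.ofReal_mul hδ0.le, hm, ENNReal.ofReal_toReal hμ]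
  have hb4 := Bd.exp_sub (g := fun _ => (0 : ℂ)) le_rfl (by positivity : 0 ≤ δ * m)
    (by simpa using Bd.zero) hb3
  have hb5 := hb2.mul hb4
  have hb6 : Bd (fun p => (bumpIn p.1 : ℂ) * (Complex.exp (gam δ i * (starRingEnd ℂ) p.1) - 1))
      8⁻¹ := by
    refine (hb5.congr fun z _ s _ => ?_).mono ?_
    · rw [← Complex.exp_eq_exp_ℂ, Complex.exp_zero]
      rcases le_total ‖z‖ (5 / 16) with h | h
      · simp [bumpOut_eq_one h]
      · simp [bumpIn_eq_zero h]
    · rw [← ENNReal.ofReal_toReal hμ', ← hm', ← ENNReal.ofReal_mul hm0', zero_add]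
      have h8 : (8⁻¹ : ℝ≥0∞) = ENNReal.ofReal (1 / 8) := by
        rw [one_div, ENNReal.ofReal_inv_of_pos (by norm_num)]
        simp
      rw [h8]
      refine ENNReal.ofReal_le_ofReal ?_
      have h9 : Real.exp (δ * m) ≤ Real.exp m :=
        Real.exp_le_exp.mpr (mul_le_of_le_one_left hm0 hδ1)
      calc m' * (δ * m * Real.exp (δ * m)) ≤ m' * (δ * m * Real.exp m) := by gcongr
        _ = δ * (m' * (m * Real.exp m)) := by ring
        _ ≤ 1 / 8 := by
          rw [hδ, one_div_mul_eq_div, div_le_iff₀ (by positivity)]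
          linarith
  obtain ⟨X, h1, h2, h3⟩ := hb6.exists_rapid
    (hs2.mul ((smH_expConj _ _).sub (SmH.const 1))) fun z s hz => by
      simp [bumpIn_eq_zero (show 5 / 16 ≤ ‖z‖ by linarith)]
  exact ⟨X, h1, h3, h2⟩

lemma norm_le_of_mem_Qs {z : ℂ} (hz : z ∈ Qs) : ‖z‖ ≤ 1 :=
  (Complex.norm_le_abs_re_add_abs_im z).trans (by linarith [hz.1, hz.2])

lemma mem_Qs {z : ℂ} (hz : ‖z‖ ≤ 1 / 2) : z ∈ Qs :=
  ⟨(Complex.abs_re_le_norm z).trans hz, (Complex.abs_im_le_norm z).trans hz⟩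

theorem exists_solve : ∃ C ε₀ : ℝ≥0∞, C ≠ ∞ ∧ 0 < ε₀ ∧ ∀ B f : ℂ × ℂ → A,
    SmH Set.univ B → SmH Set.univ f → (∀ z s : ℂ, 3 / 8 < ‖z‖ → B (z, s) = 0) →
    (∀ z s : ℂ, 3 / 8 < ‖z‖ → f (z, s) = 0) → Bd B ε₀ → ∀ ν, Bd f ν →
    ∃ v, SmH Set.univ v ∧ (∀ z ∈ Metric.ball (0 : ℂ) (1 / 4), ∀ s : ℂ, ‖s‖ ≤ 1 →
      Lop v (z, s) = B (z, s) * v (z, s) + f (z, s)) ∧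
      ∀ z ∈ Qs, ∀ s : ℂ, ‖s‖ ≤ 1 → ‖v (z, s)‖ₑ ≤ C * ν := by
  obtain ⟨δ, hδ, hδ1, hX⟩ := exists_small_exp
  choose X hX1 hX2 hX3 using hX
  have hsb : SmH Set.univ (fun p : ℂ × ℂ => (bumpIn p.1 : ℂ)) :=
    SmH.of_fst (g := fun z => (bumpIn z : ℂ)) (contDiff_ofReal_comp bumpIn.contDiff)
  have hw : ∀ i, ∃ ν : ℝ≥0∞, ν ≠ ∞ ∧
      Bd (fun p => (bumpIn p.1 : ℂ) * Complex.exp (gam δ i * (starRingEnd ℂ) p.1)) ν := fun i =>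
    exists_bd (hsb.mul (smH_expConj _ _)) fun z s hz => by
      simp [bumpIn_eq_zero (show 5 / 16 ≤ ‖z‖ by linarith)]
  choose w hw1 hw2 using hw
  set w' : ℝ := (∑ i, w i).toReal with hw'
  have hw0 : 0 ≤ w' := ENNReal.toReal_nonneg
  have hwle : ∀ i, w i ≤ ENNReal.ofReal w' := fun i => by
    rw [hw', ENNReal.ofReal_toReal (ENNReal.sum_ne_top.mpr fun i _ => hw1 i)]
    exact Finset.single_le_sum (fun _ _ => zero_le) (Finset.mem_univ i)
  have h8 : (8⁻¹ : ℝ≥0∞) = ENNReal.ofReal (1 / 8) := by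
    rw [one_div, ENNReal.ofReal_inv_of_pos (by norm_num)]
    simp
  have h4 : (4⁻¹ : ℝ≥0∞) = ENNReal.ofReal (1 / 4) := by
    rw [one_div, ENNReal.ofReal_inv_of_pos (by norm_num)]
    simp
  refine ⟨ENNReal.ofReal (Real.exp 1) * (ENNReal.ofReal (4 / δ) * 2),
    ENNReal.ofReal (δ / (32 * (w' + 1))), ?_, ?_, ?_⟩
  · exact ENNReal.mul_ne_top ENNReal.ofReal_ne_top
      (ENNReal.mul_ne_top ENNReal.ofReal_ne_top (by simp))
  · rw [ENNReal.ofReal_pos]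
    positivity
  intro B f hB hf hB0 hf0 hBb ν hfb
  have hW : ∀ i, ∃ V, Rapid V ∧ Rep V (fun p => ((bumpIn p.1 : ℂ) *
      Complex.exp (gam δ i * (starRingEnd ℂ) p.1)) • B p) ∧
      l1 V ≤ w i * ENNReal.ofReal (δ / (32 * (w' + 1))) := fun i =>
    ((hw2 i).smul hBb).exists_rapid ((hsb.mul (smH_expConj _ _)).smul hB) fun z s hz => by
      simp [hB0 z s hz]
  choose W hW1 hW2 hW3 using hW
  obtain ⟨F, hF1, hF2, hF3⟩ := hfb.exists_rapid hf hf0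
  have hsmall : ∀ i, l1 (W i) * ENNReal.ofReal (4 / δ) + l1 (X i) ≤ 4⁻¹ := fun i => by
    calc l1 (W i) * ENNReal.ofReal (4 / δ) + l1 (X i)
        ≤ ENNReal.ofReal w' * ENNReal.ofReal (δ / (32 * (w' + 1))) * ENNReal.ofReal (4 / δ) +
          8⁻¹ := by
          gcongr
          · exact (hW3 i).trans (by gcongr; exact hwle i)
          · exact hX2 i
      _ = ENNReal.ofReal (w' * (δ / (32 * (w' + 1))) * (4 / δ) + 1 / 8) := by
          rw [h8, ← ENNReal.ofReal_mul hw0, ← ENNReal.ofReal_mul (by positivity),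
            ← ENNReal.ofReal_add (by positivity) (by positivity)]
      _ ≤ 4⁻¹ := by
          rw [h4]
          refine ENNReal.ofReal_le_ofReal ?_
          have : w' * (δ / (32 * (w' + 1))) * (4 / δ) ≤ 1 / 8 := by
            have : w' * (δ / (32 * (w' + 1))) * (4 / δ) = w' / (8 * (w' + 1)) := by
              field_simp
              ring
            rw [this, div_le_iff₀ (by positivity)]
            linarith
          linarith
  obtain ⟨V, hV1, hV2, hV3, hV4⟩ := exists_fixed hδ hδ1 hW1 hX1 hsmall hF1
  set M : Fin 4 → ℂ × ℂ → A := fun i => realize (Mop (gam δ i) (sel δ i V)) with hM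
  set e : Fin 4 → ℂ × ℂ → ℂ := fun i p => Complex.exp (gam δ i * (starRingEnd ℂ) p.1) with he
  have hMs : ∀ i, SmH Set.univ (M i) := fun i => smH_realize (hV2 i) _
  have hes : ∀ i, SmH Set.univ (e i) := fun i => smH_expConj _ _
  have hsum : ∀ s : Finset (Fin 4), SmH Set.univ (fun p => ∑ i ∈ s, e i p • M i p) := by
    intro s
    induction s using Finset.induction_on with
    | empty => simpa using SmH.const (0 : A)
    | insert i s hi ih =>
      simp only [Finset.sum_insert hi]
      exact ((hes i).smul (hMs i)).add ih
  have hLsum : ∀ (t : Finset (Fin 4)) (z s : ℂ), ‖s‖ ≤ 1 →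
      Lop (fun p => ∑ i ∈ t, e i p • M i p) (z, s) =
        ∑ i ∈ t, e i (z, s) • realize (sel δ i V) (z, s) := by
    intro t z s hs
    induction t using Finset.induction_on with
    | empty =>
      simp only [Finset.sum_empty]
      exact firstOrder_const (0 : A)
    | insert i t hi ih =>
      simp only [Finset.sum_insert hi]
      have h1 := firstOrder_add (a := (1 + s ^ 2) / 2) (b := I * (1 - s ^ 2) / 2) (v := (1, 0))
        (w := (I, 0)) (((hes i).smul (hMs i)).diff (Set.mem_univ z) hs)
        ((hsum t).diff (Set.mem_univ z) hs)
      refine h1.trans ?_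
      congr 1
      rw [firstOrder_smul ((hes i).diff (Set.mem_univ z) hs) ((hMs i).diff (Set.mem_univ z) hs)]
      have h2 : firstOrder ((1 + s ^ 2) / 2) (I * (1 - s ^ 2) / 2) (1, 0) (I, 0) (e i) (z, s) =
        gam δ i * e i (z, s) := Lop_expConj (gam δ i) (z, s)
      have h3 := resolvent_eq hδ (gap_sel δ i V) (hV1.sel δ i) (hV2 i) (p := (z, s)) hs
      unfold Lop at h3
      rw [h2, ← h3, smul_add, smul_smul, mul_comm (e i (z, s)) (gam δ i)]
  have hreal : ∀ z ∈ Qs, ∀ s : ℂ, ‖s‖ ≤ 1 → ∑ i, realize (sel δ i V) (z, s) = f (z, s) +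
      ∑ i, (((bumpIn z : ℂ) * e i (z, s)) • B (z, s) * M i (z, s) -
        ((bumpIn z : ℂ) * (e i (z, s) - 1)) • realize (sel δ i V) (z, s)) := by
    intro z hz s hs
    have hr : ∀ i, Rep (sel δ i V) (realize (sel δ i V)) := fun i =>
      rep_realize (hV1.sel δ i).l1_ne_top
    have h1 : HasSum (fun n => em n (z, s) • V n) (∑ i, realize (sel δ i V) (z, s)) := by
      refine (hasSum_sum fun i _ => hr i z hz s hs).congr_fun fun n => ?_
      rw [← Finset.smul_sum, sum_sel hδ.le]
    refine h1.unique ?_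
    have h2 := (hF2 z hz s hs).add (hasSum_sum (s := Finset.univ) fun i _ =>
      (((hW2 i).conv (rep_realize (hV2 i).l1_ne_top) (hW1 i).l1_ne_top
        (hV2 i).l1_ne_top) z hz s hs).sub
      (((hX3 i).conv (hr i) (hX1 i).l1_ne_top (hV1.sel δ i).l1_ne_top) z hz s hs))
    simp only [smul_eq_mul] at h2
    refine h2.congr_fun fun n => ?_
    rw [hV4 n, Tsol, smul_add, Finset.smul_sum]
    simp only [smul_sub]
  refine ⟨fun p => ∑ i, e i p • M i p, hsum _, fun z hz s hs => ?_, fun z hz s hs => ?_⟩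
  · have hz' : ‖z‖ ≤ 1 / 4 := by
      rw [mem_ball_zero_iff] at hz
      exact hz.le
    rw [hLsum _ z s hs]
    have h1 := hreal z (mem_Qs (by linarith)) s hs
    simp only [bumpIn_eq_one hz', Complex.ofReal_one, one_mul, Finset.sum_sub_distrib, sub_smul,
      one_smul] at h1
    rw [Finset.mul_sum]
    simp only [mul_smul_comm, ← smul_mul_assoc]
    have h2 := sub_eq_zero.mpr h1
    rw [← sub_eq_zero, ← h2]
    abel
  · have he1 : ∀ i, ‖e i (z, s)‖ₑ ≤ ENNReal.ofReal (Real.exp 1) := fun i => by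
      rw [← ofReal_norm]
      refine ENNReal.ofReal_le_ofReal ((Complex.norm_exp_le_exp_norm _).trans ?_)
      rw [Real.exp_le_exp, norm_mul, norm_gam hδ.le, RCLike.norm_conj]
      nlinarith [norm_nonneg z, norm_le_of_mem_Qs hz]
    have hM1 : ∀ i, ‖M i (z, s)‖ₑ ≤ ENNReal.ofReal (4 / δ) * l1 (sel δ i V) := fun i => by
      refine (Rep.norm_le (rep_realize (hV2 i).l1_ne_top) le_rfl hz hs).trans ?_
      have := wnorm_Mop_le hδ (adm_one hδ.le) (gap_sel δ i V)
      simpa only [← l1_eq_wnorm] using this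
    calc ‖∑ i, e i (z, s) • M i (z, s)‖ₑ ≤ ∑ i, ‖e i (z, s) • M i (z, s)‖ₑ := enorm_sum_le _ _
      _ ≤ ∑ i, ENNReal.ofReal (Real.exp 1) * (ENNReal.ofReal (4 / δ) * l1 (sel δ i V)) := by
          refine Finset.sum_le_sum fun i _ => ?_
          rw [enorm_smul]
          exact mul_le_mul' (he1 i) (hM1 i)
      _ = ENNReal.ofReal (Real.exp 1) * (ENNReal.ofReal (4 / δ) * l1 V) := by
          rw [← Finset.mul_sum, ← Finset.mul_sum]
          simp only [l1_eq_wnorm, sum_wnorm_sel hδ.le]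
      _ ≤ ENNReal.ofReal (Real.exp 1) * (ENNReal.ofReal (4 / δ) * (2 * ν)) := by
          gcongr
          exact hV3.trans (by gcongr)
      _ = _ := by ring

end Solve

section Dilation
open scoped ComplexConjugate
variable {E : Type*} [NormedAddCommGroup E] [NormedSpace ℂ E]
  {T : Type*} [NormedAddCommGroup T] [NormedSpace ℝ T]

/-- Solutions of the homogeneous equation. -/
def Sol0 (U : Set ℂ) (u : ℂ × ℂ → E) : Prop :=
  SmH U u ∧ ∀ z ∈ U, ∀ s : ℂ, ‖s‖ ≤ 1 → Lop u (z, s) = 0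

lemma clm_apply_complex (L : ℂ × ℂ →L[ℝ] E) (x y : ℂ) :
    L (x, y) = (x.re : ℂ) • L (1, 0) + (x.im : ℂ) • L (I, 0) + (y.re : ℂ) • L (0, 1) +
      (y.im : ℂ) • L (0, I) := by
  have h : (x, y) = x.re • ((1, 0) : ℂ × ℂ) + x.im • ((I, 0) : ℂ × ℂ) +
      y.re • ((0, 1) : ℂ × ℂ) + y.im • ((0, I) : ℂ × ℂ) := by
    ext <;> simp
  rw [h]
  simp only [map_add, map_smul]
  simp

lemma fderiv_eq_of_homogeneous {u : ℂ × ℂ → E} {z s : ℂ} (hL : Lop u (z, s) = 0)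
    (hS : Sbar u (z, s) = 0) :
    ∃ P Q : E, ∀ x y : ℂ, fderiv ℝ u (z, s) (x, y) = (x - s ^ 2 * conj x) • P + y • Q := by
  generalize hD : fderiv ℝ u (z, s) = L
  unfold Lop firstOrder at hL
  unfold Sbar firstOrder at hS
  rw [hD] at hL hS
  refine ⟨(1 / 2 : ℂ) • (L (1, 0) - I • L (I, 0)), L (0, 1), fun x y => ?_⟩
  rw [clm_apply_complex L x y]
  have h1 : L (0, I) = I • L (0, 1) := by
    rw [one_smul, neg_smul, ← sub_eq_add_neg, sub_eq_zero] at hS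
    exact hS
  have h2 : (x.re : ℂ) • L (1, 0) + (x.im : ℂ) • L (I, 0) =
      x • ((1 / 2 : ℂ) • (L (1, 0) - I • L (I, 0))) +
      conj x • ((1 / 2 : ℂ) • (L (1, 0) + I • L (I, 0))) := by
    have e1 : conj x = (x.re : ℂ) - x.im * I := by
      apply Complex.ext <;> simp
    rw [e1]
    nth_rewrite 3 [← Complex.re_add_im x]
    match_scalars
    · ring_nf
    · ring_nf
      simp
  have h3 : (1 / 2 : ℂ) • (L (1, 0) + I • L (I, 0)) =
      -(s ^ 2 • ((1 / 2 : ℂ) • (L (1, 0) - I • L (I, 0)))) := by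
    rw [eq_neg_iff_add_eq_zero, ← hL]
    match_scalars <;> ring
  rw [h2, h3, h1, smul_neg, smul_smul (y.im : ℂ) I, add_assoc, ← add_smul,
    Complex.re_add_im, sub_smul, smul_smul (conj x), mul_comm (s ^ 2)]
  abel

/-- The first integral of `Lop` centred at `z₀`. -/
def wv (z₀ : ℂ) (p : ℂ × ℂ) : ℂ := p.1 - z₀ - p.2 ^ 2 * conj (p.1 - z₀)

/-- Recovers the spatial variable from the first integral. -/
def Zv (q : ℂ × ℂ) : ℂ := (q.1 + q.2 ^ 2 * conj q.1) / ((1 - normSq q.2 ^ 2 : ℝ) : ℂ)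

/-- The complexified dilation about `z₀`. -/
def Psi (z₀ l : ℂ) (p : ℂ × ℂ) : ℂ × ℂ := (z₀ + Zv (l * wv z₀ p, l * p.2), l * p.2)

lemma one_sub_normSq_sq_pos {s : ℂ} (hs : ‖s‖ < 1) : 0 < 1 - normSq s ^ 2 := by
  rw [Complex.normSq_eq_norm_sq]
  have : (‖s‖ ^ 2) ^ 2 < 1 := by
    rw [← pow_mul]
    exact pow_lt_one₀ (norm_nonneg s) hs (by norm_num)
  linarith

lemma Zv_sub {w s : ℂ} (hs : ‖s‖ < 1) : Zv (w, s) - s ^ 2 * conj (Zv (w, s)) = w := by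
  have h := one_sub_normSq_sq_pos hs
  have h' : ((1 - normSq s ^ 2 : ℝ) : ℂ) ≠ 0 := by exact_mod_cast h.ne'
  have hn : conj s * s = (normSq s : ℂ) := by rw [mul_comm, Complex.mul_conj]
  unfold Zv
  simp only [map_div₀, map_add, map_mul, map_pow, Complex.conj_conj, Complex.conj_ofReal]
  field_simp
  push_cast
  rw [← hn]
  ring

lemma wv_Psi (z₀ l : ℂ) {p : ℂ × ℂ} (h : ‖l * p.2‖ < 1) : wv z₀ (Psi z₀ l p) = l * wv z₀ p := by
  have := Zv_sub (w := l * wv z₀ p) h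
  simp only [Psi]
  rw [wv]
  simpa only [add_sub_cancel_left] using this

lemma Psi_Psi (z₀ l l' : ℂ) {p : ℂ × ℂ} (h : ‖l * p.2‖ < 1) :
    Psi z₀ l' (Psi z₀ l p) = Psi z₀ (l' * l) p := by
  rw [Psi, wv_Psi z₀ l h, Psi, Psi]
  simp only [mul_assoc]

lemma Zv_mul (z₀ : ℂ) {l : ℂ} {p : ℂ × ℂ} :
    Zv (l * wv z₀ p, l * p.2) * ((1 - normSq (l * p.2) ^ 2 : ℝ) : ℂ) =
      if ‖l * p.2‖ < 1 then
      l * (((1 - ‖l‖ ^ 2 * (‖p.2‖ ^ 2) ^ 2 : ℝ) : ℂ) * (p.1 - z₀) -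
        ((1 - ‖l‖ ^ 2 : ℝ) : ℂ) * (p.2 ^ 2 * conj (p.1 - z₀)))
      else Zv (l * wv z₀ p, l * p.2) * ((1 - normSq (l * p.2) ^ 2 : ℝ) : ℂ) := by
  split_ifs with h
  swap
  · rfl
  have hD : ((1 - normSq (l * p.2) ^ 2 : ℝ) : ℂ) ≠ 0 := by
    exact_mod_cast (one_sub_normSq_sq_pos h).ne'
  have hl : l * conj l = ((‖l‖ ^ 2 : ℝ) : ℂ) := by rw [Complex.mul_conj, Complex.normSq_eq_norm_sq]
  have hs : p.2 * conj p.2 = ((‖p.2‖ ^ 2 : ℝ) : ℂ) := by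
    rw [Complex.mul_conj, Complex.normSq_eq_norm_sq]
  unfold Zv
  rw [div_mul_cancel₀ _ hD]
  push_cast at hl hs ⊢
  rw [← hl, ← hs]
  unfold wv
  simp only [map_mul, map_sub, map_pow, Complex.conj_conj]
  ring

lemma norm_Zv_le (z₀ : ℂ) {l : ℂ} {p : ℂ × ℂ} (h : ‖l * p.2‖ < 1) (hl : ‖l‖ ≤ 1)
    (hs : ‖p.2‖ ≤ 1) : ‖Zv (l * wv z₀ p, l * p.2)‖ * (1 + ‖l‖ ^ 2 * ‖p.2‖ ^ 2) ≤
      ‖l‖ * (1 + ‖p.2‖ ^ 2) * ‖p.1 - z₀‖ := by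
  have h1 := Zv_mul z₀ (l := l) (p := p)
  rw [if_pos h] at h1
  have h2 := congrArg norm h1
  have hD := one_sub_normSq_sq_pos h
  have ht : ‖l‖ ^ 2 ≤ 1 := pow_le_one₀ (norm_nonneg _) hl
  have hσ : ‖p.2‖ ^ 2 ≤ 1 := pow_le_one₀ (norm_nonneg _) hs
  have hσ' : (‖p.2‖ ^ 2) ^ 2 ≤ 1 := pow_le_one₀ (by positivity) hσ
  have hτσ : ‖l‖ ^ 2 * ‖p.2‖ ^ 2 < 1 := by
    rw [← mul_pow, ← norm_mul]
    exact pow_lt_one₀ (norm_nonneg _) h (by norm_num)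
  have hττ : ‖l‖ ^ 2 * (‖p.2‖ ^ 2) ^ 2 ≤ 1 := mul_le_one₀ ht (by positivity) hσ'
  rw [norm_mul, Complex.norm_real, Real.norm_of_nonneg hD.le, norm_mul] at h2
  have h3 : ‖((1 - ‖l‖ ^ 2 * (‖p.2‖ ^ 2) ^ 2 : ℝ) : ℂ) * (p.1 - z₀) -
        ((1 - ‖l‖ ^ 2 : ℝ) : ℂ) * (p.2 ^ 2 * conj (p.1 - z₀))‖ ≤
      ((1 + ‖p.2‖ ^ 2) * (1 - ‖l‖ ^ 2 * ‖p.2‖ ^ 2)) * ‖p.1 - z₀‖ := by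
    refine (norm_sub_le _ _).trans (le_of_eq ?_)
    rw [norm_mul, norm_mul, norm_mul, Complex.norm_real, Complex.norm_real,
      Real.norm_of_nonneg (by linarith), Real.norm_of_nonneg (by linarith), RCLike.norm_conj,
      norm_pow]
    ring
  rw [norm_mul, Complex.normSq_eq_norm_sq, norm_mul] at *
  have hpos : 0 < 1 - ‖l‖ ^ 2 * ‖p.2‖ ^ 2 := by linarith
  refine le_of_mul_le_mul_right ?_ hpos
  calc ‖Zv (l * wv z₀ p, l * p.2)‖ * (1 + ‖l‖ ^ 2 * ‖p.2‖ ^ 2) * (1 - ‖l‖ ^ 2 * ‖p.2‖ ^ 2)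
      = ‖Zv (l * wv z₀ p, l * p.2)‖ * (1 - ((‖l‖ * ‖p.2‖) ^ 2) ^ 2) := by ring
    _ ≤ ‖l‖ * (((1 + ‖p.2‖ ^ 2) * (1 - ‖l‖ ^ 2 * ‖p.2‖ ^ 2)) * ‖p.1 - z₀‖) := by
        rw [h2]
        exact mul_le_mul_of_nonneg_left h3 (norm_nonneg _)
    _ = _ := by ring

lemma norm_Zv_le_self (z₀ : ℂ) {l : ℂ} {p : ℂ × ℂ} (h : ‖l * p.2‖ < 1) (hl : ‖l‖ ≤ 1)
    (hs : ‖p.2‖ ≤ 1) : ‖Zv (l * wv z₀ p, l * p.2)‖ ≤ ‖p.1 - z₀‖ := by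
  have h1 := norm_Zv_le z₀ h hl hs
  have h2 : ‖l‖ * (1 + ‖p.2‖ ^ 2) ≤ 1 + ‖l‖ ^ 2 * ‖p.2‖ ^ 2 := by
    have h3 : ‖p.2‖ ^ 2 ≤ 1 := pow_le_one₀ (norm_nonneg _) hs
    have h4 : ‖l‖ * ‖p.2‖ ^ 2 ≤ 1 := mul_le_one₀ hl (by positivity) h3
    nlinarith [mul_nonneg (sub_nonneg.mpr hl) (sub_nonneg.mpr h4)]
  refine le_of_mul_le_mul_right (h1.trans ?_) (by positivity : 0 < 1 + ‖l‖ ^ 2 * ‖p.2‖ ^ 2)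
  rw [mul_comm ‖p.1 - z₀‖]
  exact mul_le_mul_of_nonneg_right h2 (norm_nonneg _)

lemma norm_Zv_le_two (z₀ : ℂ) {l : ℂ} {p : ℂ × ℂ} (h : ‖l * p.2‖ < 1) (hl : ‖l‖ ≤ 1)
    (hs : ‖p.2‖ ≤ 1) : ‖Zv (l * wv z₀ p, l * p.2)‖ ≤ 2 * ‖l‖ * ‖p.1 - z₀‖ := by
  have h1 := norm_Zv_le z₀ h hl hs
  have h2 : ‖Zv (l * wv z₀ p, l * p.2)‖ ≤
      ‖Zv (l * wv z₀ p, l * p.2)‖ * (1 + ‖l‖ ^ 2 * ‖p.2‖ ^ 2) :=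
    le_mul_of_one_le_right (norm_nonneg _) (by linarith [show 0 ≤ ‖l‖ ^ 2 * ‖p.2‖ ^ 2 by positivity])
  refine (h2.trans h1).trans ?_
  have h3 : ‖p.2‖ ^ 2 ≤ 1 := pow_le_one₀ (norm_nonneg _) hs
  have : ‖l‖ * (1 + ‖p.2‖ ^ 2) ≤ 2 * ‖l‖ := by nlinarith [norm_nonneg l]
  gcongr

lemma Zv_of_norm_eq_one (z₀ : ℂ) {l : ℂ} {p : ℂ × ℂ} (hl : ‖l‖ = 1) (hs : ‖p.2‖ < 1) :
    Zv (l * wv z₀ p, l * p.2) = l * (p.1 - z₀) := by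
  have h : ‖l * p.2‖ < 1 := by rwa [norm_mul, hl, one_mul]
  have h1 := Zv_mul z₀ (l := l) (p := p)
  have hD := one_sub_normSq_sq_pos h
  rw [if_pos h] at h1
  rw [Complex.normSq_eq_norm_sq, norm_mul, hl] at *
  have hD' : ((1 - ((1 * ‖p.2‖) ^ 2) ^ 2 : ℝ) : ℂ) ≠ 0 := by exact_mod_cast hD.ne'
  refine mul_right_cancel₀ hD' (h1.trans ?_)
  push_cast
  ring

lemma contDiffAt_Psi (z₀ : ℂ) {q : ℂ × (ℂ × ℂ)} (h : ‖q.1 * q.2.2‖ < 1) :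
    ContDiffAt ℝ (⊤ : ℕ∞) (fun q : ℂ × (ℂ × ℂ) => Psi z₀ q.1 q.2) q := by
  have hc : ContDiff ℝ (⊤ : ℕ∞) (fun z : ℂ => conj z) := contDiff_conj
  have hn : ContDiff ℝ (⊤ : ℕ∞) (fun z : ℂ => normSq z) := by
    simp only [Complex.normSq_eq_norm_sq]
    exact contDiff_norm_sq ℝ
  have h1 : ContDiff ℝ (⊤ : ℕ∞) (fun q : ℂ × (ℂ × ℂ) => q.1) := contDiff_fst
  have h2 : ContDiff ℝ (⊤ : ℕ∞) (fun q : ℂ × (ℂ × ℂ) => q.2.1) := contDiff_fst.comp contDiff_snd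
  have h3 : ContDiff ℝ (⊤ : ℕ∞) (fun q : ℂ × (ℂ × ℂ) => q.2.2) := contDiff_snd.comp contDiff_snd
  have hw : ContDiff ℝ (⊤ : ℕ∞) (fun q : ℂ × (ℂ × ℂ) => q.1 * wv z₀ q.2) :=
    h1.mul ((h2.sub contDiff_const).sub ((h3.pow 2).mul (hc.comp (h2.sub contDiff_const))))
  have hD : ((1 - normSq (q.1 * q.2.2) ^ 2 : ℝ) : ℂ) ≠ 0 := by
    exact_mod_cast (one_sub_normSq_sq_pos h).ne'
  refine ContDiffAt.prodMk (contDiffAt_const.add ?_) (h1.mul h3).contDiffAt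
  simp only [Zv, div_eq_mul_inv]
  refine (hw.add (((h1.mul h3).pow 2).mul (hc.comp hw))).contDiffAt.mul (ContDiffAt.inv ?_ hD)
  exact (Complex.ofRealCLM.contDiff.comp
    (contDiff_const.sub ((hn.comp (h1.mul h3)).pow 2))).contDiffAt

lemma hasFDerivAt_comp_of_homogeneous {u : ℂ × ℂ → E} {Φ : T → ℂ × ℂ} {z₀ : ℂ} {q : T}
    {W' S' : T →L[ℝ] ℂ} (hu : DifferentiableAt ℝ u (Φ q))
    (hL : Lop u (Φ q) = 0) (hS : Sbar u (Φ q) = 0) (hΦ : DifferentiableAt ℝ Φ q)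
    (hW' : HasFDerivAt (fun q => wv z₀ (Φ q)) W' q)
    (hS' : HasFDerivAt (fun q => (Φ q).2) S' q) :
    ∃ L : T →L[ℝ] E, HasFDerivAt (fun q => u (Φ q)) L q ∧ ∃ P Q : E, ∀ v,
      L v = W' v • P + S' v • Q := by
  obtain ⟨P, Q, hPQ⟩ := fderiv_eq_of_homogeneous (z := (Φ q).1) (s := (Φ q).2) hL hS
  have h1 : HasFDerivAt (fun q => u (Φ q)) _ q := HasFDerivAt.comp q hu.hasFDerivAt hΦ.hasFDerivAt
  refine ⟨_, h1, P, Q + (2 * (Φ q).2 * conj ((Φ q).1 - z₀)) • P, fun v => ?_⟩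
  have hY' := (hasFDerivAt_fst (𝕜 := ℝ) (E := ℂ) (F := ℂ) (p := Φ q)).comp q hΦ.hasFDerivAt
  have hS2 := (hasFDerivAt_snd (𝕜 := ℝ) (E := ℂ) (F := ℂ) (p := Φ q)).comp q hΦ.hasFDerivAt
  have hc : HasFDerivAt (fun q => conj ((Φ q).1 - z₀)) _ q :=
    HasFDerivAt.comp q (Complex.conjCLE : ℂ →L[ℝ] ℂ).hasFDerivAt (hY'.sub_const z₀)
  have h2 : HasFDerivAt (fun q => wv z₀ (Φ q)) _ q :=
    (hY'.sub_const z₀).sub ((hS2.pow 2).mul hc)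
  rw [hW'.unique h2, hS'.unique hS2]
  have h3 := hPQ (fderiv ℝ Φ q v).1 (fderiv ℝ Φ q v).2
  simp only [ContinuousLinearMap.comp_apply]
  refine h3.trans ?_
  simp
  module

/-- Composition with a dilation is holomorphic in the dilation parameter. -/
lemma differentiableAt_comp_Psi {U : Set ℂ} {u : ℂ × ℂ → E} (hu : Sol0 U u) (z₀ : ℂ)
    {l : ℂ} {p : ℂ × ℂ} (hp : (Psi z₀ l p).1 ∈ U) (h : ‖l * p.2‖ < 1) :
    DifferentiableAt ℂ (fun l => u (Psi z₀ l p)) l := by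
  have h0 : DifferentiableAt ℝ (fun l => Psi z₀ l p) l :=
    (ContDiffAt.comp l (contDiffAt_Psi z₀ (q := (l, p)) h)
      (contDiffAt_id.prodMk contDiffAt_const)).differentiableAt (by simp)
  have hs : ‖(Psi z₀ l p).2‖ ≤ 1 := h.le
  have h6 : HasFDerivAt (fun l => l * wv z₀ p)
      ((ContinuousLinearMap.id ℝ ℂ).smulRight (wv z₀ p)) l :=
    ((ContinuousLinearMap.id ℝ ℂ).smulRight (wv z₀ p)).hasFDerivAt
  have h7 : HasFDerivAt (fun l => (Psi z₀ l p).2)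
      ((ContinuousLinearMap.id ℝ ℂ).smulRight p.2) l :=
    ((ContinuousLinearMap.id ℝ ℂ).smulRight p.2).hasFDerivAt
  have h5 : (fun l => wv z₀ (Psi z₀ l p)) =ᶠ[𝓝 l] fun l => l * wv z₀ p := by
    have : ∀ᶠ l' in 𝓝 l, ‖l' * p.2‖ < 1 :=
      (continuous_id.mul continuous_const).norm.continuousAt.eventually_lt continuousAt_const h
    filter_upwards [this] with l' hl'
    exact wv_Psi z₀ l' hl'
  obtain ⟨L, hL, P, Q, h4⟩ := hasFDerivAt_comp_of_homogeneous (z₀ := z₀)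
    (Φ := fun l => Psi z₀ l p) (q := l) (hu.1.diff hp hs)
    (hu.2 _ hp _ hs) ((hu.1 _ hp _ hs).2) h0 (h6.congr_of_eventuallyEq h5) h7
  rw [differentiableAt_complex_iff_differentiableAt_real]
  refine ⟨hL.differentiableAt, ?_⟩
  rw [hL.fderiv, h4, h4]
  simp [smul_smul]

/-- Dilations preserve solutions. -/
lemma Sol0.comp_Psi {U V : Set ℂ} {u : ℂ × ℂ → E} (hu : Sol0 U u) (z₀ : ℂ)
    {l : ℂ} (hl : ‖l‖ < 1) (h : ∀ z ∈ V, ∀ s : ℂ, ‖s‖ ≤ 1 → (Psi z₀ l (z, s)).1 ∈ U) :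
    Sol0 V (fun p => u (Psi z₀ l p)) := by
  have key : ∀ z ∈ V, ∀ s : ℂ, ‖s‖ ≤ 1 → ContDiffAt ℝ (⊤ : ℕ∞) (fun p => u (Psi z₀ l p)) (z, s) ∧
      ∃ P Q : E, ∀ x y : ℂ, fderiv ℝ (fun p => u (Psi z₀ l p)) (z, s) (x, y) =
        (x - s ^ 2 * conj x - 2 * s * y * conj (z - z₀)) • P + y • Q := by
    intro z hz s hs
    have hls : ‖l * s‖ < 1 := by
      rw [norm_mul]
      nlinarith [norm_nonneg l, norm_nonneg s]
    have h0 : ContDiffAt ℝ (⊤ : ℕ∞) (fun p => Psi z₀ l p) (z, s) :=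
      ContDiffAt.comp (z, s) (contDiffAt_Psi z₀ (q := (l, (z, s))) hls)
        (contDiffAt_const.prodMk contDiffAt_id)
    have hs' : ‖(Psi z₀ l (z, s)).2‖ ≤ 1 := hls.le
    have hm := h z hz s hs
    refine ⟨ContDiffAt.comp (z, s) (hu.1.contDiffAt hm hs') h0, ?_⟩
    have hz1 := hasFDerivAt_fst (𝕜 := ℝ) (E := ℂ) (F := ℂ) (p := (z, s))
    have hs1 := hasFDerivAt_snd (𝕜 := ℝ) (E := ℂ) (F := ℂ) (p := (z, s))
    have hc : HasFDerivAt (fun q : ℂ × ℂ => conj (q.1 - z₀)) _ (z, s) :=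
      HasFDerivAt.comp (z, s) (Complex.conjCLE : ℂ →L[ℝ] ℂ).hasFDerivAt (hz1.sub_const z₀)
    have hw : HasFDerivAt (fun p : ℂ × ℂ => l * wv z₀ p) _ (z, s) :=
      ((hz1.sub_const z₀).sub ((hs1.pow 2).mul hc)).const_mul l
    have hS : HasFDerivAt (fun p : ℂ × ℂ => (Psi z₀ l p).2) _ (z, s) := hs1.const_mul l
    have h5 : (fun p => wv z₀ (Psi z₀ l p)) =ᶠ[𝓝 (z, s)] fun p => l * wv z₀ p := by
      have : ∀ᶠ p : ℂ × ℂ in 𝓝 (z, s), ‖l * p.2‖ < 1 :=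
        (continuous_const.mul continuous_snd).norm.continuousAt.eventually_lt
          continuousAt_const hls
      filter_upwards [this] with p hp
      exact wv_Psi z₀ l hp
    obtain ⟨L, hL, P, Q, h4⟩ := hasFDerivAt_comp_of_homogeneous (z₀ := z₀)
      (Φ := fun p => Psi z₀ l p) (q := (z, s)) (hu.1.diff hm hs')
      (hu.2 _ hm _ hs') ((hu.1 _ hm _ hs').2) (h0.differentiableAt (by simp))
      (hw.congr_of_eventuallyEq h5) hS
    refine ⟨l • P, l • Q, fun x y => ?_⟩
    rw [hL.fderiv, h4]
    simp
    module
  refine ⟨fun z hz s hs => ⟨(key z hz s hs).1, ?_⟩, fun z hz s hs => ?_⟩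
  · obtain ⟨-, P, Q, h1⟩ := key z hz s hs
    unfold Sbar firstOrder
    rw [h1, h1]
    simp
    match_scalars <;> ring_nf
  · obtain ⟨-, P, Q, h1⟩ := key z hz s hs
    unfold Lop firstOrder
    rw [h1, h1]
    simp
    match_scalars
    ring_nf
    simp

end Dilation

section RungeDisc
open scoped ComplexConjugate ENNReal
variable {E : Type*} [NormedAddCommGroup E] [NormedSpace ℂ E]

lemma fourier_unique_int [CompleteSpace E] {c : ℤ → E} (hc : Summable fun l => ‖c l‖)
    (h : ∀ a : ℝ, HasSum (fun l : ℤ => ex (l * a) • c l) 0) : c = 0 := by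
  have h1 : (fun n : Fin 1 → ℤ => c (n 0)) = 0 := by
    refine fourier_series_unique (d := Fin 1) ?_ fun x => ?_
    · exact (Equiv.funUnique (Fin 1) ℤ).summable_iff.mpr hc
    · refine ((Equiv.funUnique (Fin 1) ℤ).hasSum_iff.mpr (h (x 0))).congr_fun fun n => ?_
      simp [ex]
  funext l
  exact congrFun h1 fun _ => l

lemma fourier_unique_nat [CompleteSpace E] {c : ℕ → E} (hc : Summable fun l => ‖c l‖)
    (h : ∀ l : ℂ, ‖l‖ = 1 → HasSum (fun k : ℕ => l ^ k • c k) 0) : c = 0 := by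
  have hi : Function.Injective ((↑) : ℕ → ℤ) := Nat.cast_injective
  have h0 : Function.extend ((↑) : ℕ → ℤ) c 0 = 0 := by
    refine fourier_unique_int ?_ fun a => ?_
    · refine (hi.summable_iff fun l hl => ?_).mp ?_
      · simp [Function.extend_apply' _ _ _ hl]
      · refine hc.congr fun k => ?_
        simp [hi.extend_apply]
    · refine (hi.hasSum_iff fun l hl => ?_).mp ?_
      · simp [Function.extend_apply' _ _ _ hl]
      · refine (h (ex a) (norm_ex a)).congr_fun fun k => ?_
        have := ex_int_mul k a
        simp only [Function.comp_apply, hi.extend_apply]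
        rw [this, zpow_natCast]
  funext k
  rw [← hi.extend_apply c 0 k, h0]
  rfl

/-- Fourier modes of a periodic family of functions. -/
theorem exists_modes [CompleteSpace E] {f : ℝ → ℂ × ℂ → E}
    (hsm : ∀ (a : ℝ) (z s : ℂ), ‖s‖ ≤ 1 →
      ContDiffAt ℝ (⊤ : ℕ∞) (fun q : ℝ × (ℂ × ℂ) => f q.1 q.2) (a, (z, s)))
    (hh : ∀ a, SmH Set.univ (f a)) (h0 : ∀ a (z s : ℂ), 3 / 8 < ‖z‖ → f a (z, s) = 0)
    (hper : ∀ a, f (a + 1) = f a) {W : Set ℂ} (hW : IsOpen W) (hWQ : W ⊆ Qs)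
    (hL : ∀ a, ∀ z ∈ W, ∀ s : ℂ, ‖s‖ ≤ 1 → Lop (f a) (z, s) = 0) :
    ∃ (φ : ℤ → ℂ × ℂ → E) (ν : ℤ → ℝ≥0∞), (∀ l, Bd (φ l) (ν l)) ∧ ∑' l, ν l ≠ ∞ ∧
      (∀ a, ∀ z ∈ Qs, ∀ s : ℂ, ‖s‖ ≤ 1 →
        HasSum (fun l : ℤ => ex (l * a) • φ l (z, s)) (f a (z, s))) ∧
      ∀ l, Sol0 W (φ l) := by
  obtain ⟨V, hV, hVf⟩ := exists_expansion hsm hh h0 hper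
  have hprod : ∀ N : ℕ, ∑' l, wnorm (fun n => (sz n : ℝ≥0∞) ^ N) (V l) ≠ ∞ := fun N => by
    have := hV N
    rwa [ENNReal.tsum_prod (f := fun l n => (sz n : ℝ≥0∞) ^ N * ‖V l n‖ₑ)] at this
  have hrap : ∀ l, Rapid (V l) := fun l N => ENNReal.ne_top_of_tsum_ne_top (hprod N) l
  have hl1 : ∑' l, l1 (V l) ≠ ∞ := by simpa [l1_eq_wnorm] using hprod 0
  have hsum : ∀ a, ∀ z ∈ Qs, ∀ s : ℂ, ‖s‖ ≤ 1 →
      HasSum (fun l : ℤ => ex (l * a) • realize (V l) (z, s)) (f a (z, s)) := fun a z hz s hs => by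
    refine (hVf a z hz s hs).prod_fiberwise fun l => ?_
    refine ((hasSum_realize (hrap l).l1_ne_top (p := (z, s)) hs).const_smul (ex (l * a))).congr_fun
      fun n => ?_
    rw [smul_smul]
  have hder : Summable fun l => ∑' n, (sz n : ℝ) * ‖V l n‖ := by
    have h1 : Summable fun l => (wnorm (fun n => (sz n : ℝ≥0∞) ^ 1) (V l)).toReal :=
      ENNReal.summable_toReal (hprod 1)
    refine h1.congr fun l => ?_
    unfold wnorm
    rw [ENNReal.tsum_toReal_eq fun n => by simp [ENNReal.mul_ne_top]]
    simp
  refine ⟨fun l => realize (V l), fun l => l1 (V l),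
    fun l => ⟨V l, le_rfl, (hrap l).l1_ne_top, rep_realize (hrap l).l1_ne_top⟩, hl1, hsum,
    fun l => ⟨smH_realize (hrap l) W, fun z hz s hs => ?_⟩⟩
  obtain ⟨C, hC0, hC⟩ := norm_fderiv_realize_le (E := E)
  have hD : ∀ l, Differentiable ℝ (realize (V l)) := fun l =>
    (contDiff_realize (hrap l)).differentiable (by simp)
  have hfd : ∀ (a : ℝ) (l : ℤ) p, fderiv ℝ (fun p => ex (l * a) • realize (V l) p) p =
      ex (l * a) • fderiv ℝ (realize (V l)) p := fun a l p =>
    fderiv_fun_const_smul (hD l p) _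
  have hcs : ∀ a, Summable fun l : ℤ => ‖ex (l * a) • realize (V l) (z, s)‖ := fun a => by
    have h2 : Summable fun l => (l1 (V l)).toReal := ENNReal.summable_toReal hl1
    refine Summable.of_nonneg_of_le (fun _ => norm_nonneg _) (fun l => ?_) h2
    rw [norm_smul, norm_ex, one_mul, ← toReal_enorm]
    exact ENNReal.toReal_mono (hrap l).l1_ne_top
      ((rep_realize (hrap l).l1_ne_top).norm_le le_rfl (hWQ hz) hs)
  have hLs : ∀ a, HasSum (fun l : ℤ => ex (l * a) • Lop (realize (V l)) (z, s)) 0 := fun a => by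
    have hb : ∀ (l : ℤ) p, ‖fderiv ℝ (fun p => ex (l * a) • realize (V l) p) p‖ ≤
        C * ∑' n, (sz n : ℝ) * ‖V l n‖ := fun l p => by
      rw [hfd, norm_smul, norm_ex, one_mul]
      exact hC _ (hrap l) p
    have hd : ∀ l : ℤ, Differentiable ℝ (fun p => ex (l * a) • realize (V l) p) := fun l =>
      (hD l).const_smul _
    have h1 := fderiv_tsum_apply (hder.mul_left C) hd hb (hcs a).of_norm (z, s)
    have h1d := differentiable_tsum (hder.mul_left C) (fun l p => ((hd l) p).hasFDerivAt) hb
    have h2 : HasSum (fun l : ℤ => fderiv ℝ (fun p => ex (l * a) • realize (V l) p) (z, s))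
        (fderiv ℝ (fun p => ∑' l : ℤ, ex (l * a) • realize (V l) p) (z, s)) := by
      rw [h1]
      exact (Summable.of_norm_bounded (hder.mul_left C) fun l => hb l (z, s)).hasSum
    have h3 := ((h2.mapL (ContinuousLinearMap.apply ℝ E (1, 0))).const_smul ((1 + s ^ 2) / 2)).add
      ((h2.mapL (ContinuousLinearMap.apply ℝ E (I, 0))).const_smul (I * (1 - s ^ 2) / 2))
    have h4 : Lop (fun p => ∑' l : ℤ, ex (l * a) • realize (V l) p) (z, s) = 0 := by
      rw [← hL a z hz s hs]
      exact Lop_eq_of_eqOn hW hz hs (h1d _) ((hh a).diff (Set.mem_univ z) hs) fun z hz s hs =>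
        (hsum a z (hWQ hz) s hs).tsum_eq
    rw [← h4]
    refine h3.congr_fun fun l => ?_
    rw [hfd]
    simp [Lop, firstOrder, smul_add, smul_smul, mul_comm]
  have hnorm : Summable fun l => ‖Lop (realize (V l)) (z, s)‖ := by
    refine Summable.of_nonneg_of_le (fun _ => norm_nonneg _) (fun l => ?_)
      ((hder.mul_left C).mul_left (‖(1 + s ^ 2) / 2‖ * ‖((1 : ℂ), (0 : ℂ))‖ +
        ‖I * (1 - s ^ 2) / 2‖ * ‖(I, (0 : ℂ))‖))
    have hb := hC _ (hrap l) (z, s)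
    unfold Lop firstOrder
    refine (norm_add_le _ _).trans ?_
    rw [norm_smul, norm_smul, add_mul, mul_assoc, mul_assoc]
    gcongr <;> rw [mul_comm]
    · exact (ContinuousLinearMap.le_opNorm _ _).trans (by gcongr)
    · exact (ContinuousLinearMap.le_opNorm _ _).trans (by gcongr)
  exact congrFun (fourier_unique_int hnorm hLs) l

lemma SmH.eq_of_eq {U : Set ℂ} {u v : ℂ × ℂ → E} (hu : SmH U u) (hv : SmH U v) {z : ℂ}
    (hz : z ∈ U) (h : ∀ s : ℂ, ‖s‖ < 1 → u (z, s) = v (z, s)) {s : ℂ} (hs : ‖s‖ ≤ 1) :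
    u (z, s) = v (z, s) := by
  have hc : ∀ {w : ℂ × ℂ → E}, SmH U w →
      ContinuousOn (fun s => w (z, s)) (Metric.closedBall 0 1) := fun hw s hs => by
    have := (hw.contDiffAt hz (by simpa using hs)).continuousAt
    exact (ContinuousAt.comp (f := fun s => (z, s)) this (by fun_prop)).continuousWithinAt
  have h1 : Set.EqOn (fun s => u (z, s)) (fun s => v (z, s)) (Metric.ball 0 1) := fun s hs =>
    h s (by simpa using hs)
  exact h1.of_subset_closure (hc hu) (hc hv) Metric.ball_subset_closedBall
    (by rw [closure_ball _ one_ne_zero]) (by simpa using hs)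

lemma Sol0.mono {U V : Set ℂ} {u : ℂ × ℂ → E} (hu : Sol0 U u) (h : V ⊆ U) : Sol0 V u :=
  ⟨hu.1.mono h, fun z hz => hu.2 z (h hz)⟩

lemma Sol0.zero {U : Set ℂ} : Sol0 U (fun _ : ℂ × ℂ => (0 : E)) :=
  ⟨SmH.const 0, fun _ _ _ _ => firstOrder_const 0⟩

lemma Sol0.add {U : Set ℂ} {u v : ℂ × ℂ → E} (hu : Sol0 U u) (hv : Sol0 U v) :
    Sol0 U (fun p => u p + v p) :=
  ⟨hu.1.add hv.1, fun z hz s hs => by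
    have h1 := hu.2 z hz s hs
    have h2 := hv.2 z hz s hs
    unfold Lop at *
    rw [firstOrder_add (hu.1.diff hz hs) (hv.1.diff hz hs), h1, h2, add_zero]⟩

lemma Sol0.sub {U : Set ℂ} {u v : ℂ × ℂ → E} (hu : Sol0 U u) (hv : Sol0 U v) :
    Sol0 U (fun p => u p - v p) :=
  ⟨hu.1.sub hv.1, fun z hz s hs => by
    have h1 := hu.2 z hz s hs
    have h2 := hv.2 z hz s hs
    unfold Lop at *
    rw [firstOrder_sub (hu.1.diff hz hs) (hv.1.diff hz hs), h1, h2, sub_zero]⟩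

lemma Sol0.const_smul {U : Set ℂ} {u : ℂ × ℂ → E} (hu : Sol0 U u) (c : ℂ) :
    Sol0 U (fun p => c • u p) :=
  ⟨(SmH.const c).smul hu.1, fun z hz s hs => by
    have h1 := hu.2 z hz s hs
    unfold Lop at *
    rw [firstOrder_smul (differentiableAt_const c) (hu.1.diff hz hs), h1, firstOrder_const,
      zero_smul, smul_zero, add_zero]⟩

lemma Sol0.sum {U : Set ℂ} {u : ℕ → ℂ × ℂ → E} (hu : ∀ k, Sol0 U (u k)) (N : ℕ) :
    Sol0 U (fun p => ∑ k ∈ Finset.range N, u k p) := by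
  induction N with
  | zero => simpa using Sol0.zero
  | succ N ih => simpa only [Finset.sum_range_succ] using ih.add (hu N)

lemma Sol0.rotate {U : Set ℂ} {u : ℂ × ℂ → E} (hu : Sol0 U u) (z₀ : ℂ) {e : ℂ} (he : ‖e‖ = 1) :
    Sol0 {z | z₀ + e * (z - z₀) ∈ U} (fun p => u (z₀ + e * (p.1 - z₀), e * p.2)) := by
  have key : ∀ z, z₀ + e * (z - z₀) ∈ U → ∀ s : ℂ, ‖s‖ ≤ 1 →
      ContDiffAt ℝ (⊤ : ℕ∞) (fun p : ℂ × ℂ => u (z₀ + e * (p.1 - z₀), e * p.2)) (z, s) ∧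
      ∃ P Q : E, ∀ x y : ℂ,
        fderiv ℝ (fun p : ℂ × ℂ => u (z₀ + e * (p.1 - z₀), e * p.2)) (z, s) (x, y) =
        (x - s ^ 2 * conj x) • P + y • Q := by
    intro z hz s hs
    have hs' : ‖e * s‖ ≤ 1 := by rwa [norm_mul, he, one_mul]
    refine ⟨ContDiffAt.comp (z, s) (hu.1.contDiffAt hz hs') (((contDiff_const.add
      (contDiff_const.mul (contDiff_fst.sub contDiff_const))).prodMk
      (contDiff_const.mul contDiff_snd)).contDiffAt), ?_⟩
    obtain ⟨P, Q, hPQ⟩ := fderiv_eq_of_homogeneous (hu.2 _ hz _ hs') ((hu.1 _ hz _ hs').2)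
    have h1 : HasFDerivAt (fun p : ℂ × ℂ => (z₀ + e * (p.1 - z₀), e * p.2)) _ (z, s) :=
      ((((hasFDerivAt_fst (𝕜 := ℝ) (E := ℂ) (F := ℂ) (p := (z, s))).sub_const z₀).const_mul
        e).const_add z₀).prodMk
        ((hasFDerivAt_snd (𝕜 := ℝ) (E := ℂ) (F := ℂ) (p := (z, s))).const_mul e)
    have h2 : HasFDerivAt (fun p : ℂ × ℂ => u (z₀ + e * (p.1 - z₀), e * p.2)) _ (z, s) :=
      HasFDerivAt.comp (z, s) (hu.1.diff hz hs').hasFDerivAt h1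
    refine ⟨e • P, e • Q, fun x y => ?_⟩
    rw [h2.fderiv]
    have hee : e * conj e = 1 := by rw [Complex.mul_conj, Complex.normSq_eq_norm_sq, he]; simp
    have h3 := hPQ (e * x) (e * y)
    have h4 : e * x - (e * s) ^ 2 * conj (e * x) = e * (x - s ^ 2 * conj x) := by
      rw [map_mul]
      linear_combination (-e * s ^ 2 * conj x) * hee
    rw [h4] at h3
    simp only [ContinuousLinearMap.comp_apply, ContinuousLinearMap.prod_apply]
    refine h3.trans ?_
    simp [smul_smul, mul_comm]
  refine ⟨fun z hz s hs => ⟨(key z hz s hs).1, ?_⟩, fun z hz s hs => ?_⟩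
  · obtain ⟨-, P, Q, h1⟩ := key z hz s hs
    unfold Sbar firstOrder
    rw [h1, h1]
    simp
  · obtain ⟨-, P, Q, h1⟩ := key z hz s hs
    unfold Lop firstOrder
    rw [h1, h1]
    simp
    match_scalars
    ring_nf
    simp

end RungeDisc

section Cutoffs

lemma exists_separating {F K : Set ℂ} (hF : IsClosed F) (hK : IsClosed K) (hd : Disjoint F K) :
    ∃ κ : ℂ → ℝ, ContDiff ℝ (⊤ : ℕ∞) κ ∧ (∀ z, 0 ≤ κ z ∧ κ z ≤ 1) ∧ ∃ N₀ N₁ : Set ℂ,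
      IsOpen N₀ ∧ IsOpen N₁ ∧ F ⊆ N₀ ∧ K ⊆ N₁ ∧ (∀ z ∈ N₀, κ z = 0) ∧ ∀ z ∈ N₁, κ z = 1 := by
  obtain ⟨f, h0, h1, h2⟩ := exists_contMDiffMap_zero_one_nhds_of_isClosed
    (modelWithCornersSelf ℝ ℂ) (n := (⊤ : ℕ∞)) hF hK hd
  obtain ⟨N₀, h3, h4, h5⟩ := eventually_nhdsSet_iff_exists.mp h0
  obtain ⟨N₁, h6, h7, h8⟩ := eventually_nhdsSet_iff_exists.mp h1
  exact ⟨f, f.contMDiff.contDiff, fun z => ⟨(h2 z).1, (h2 z).2⟩, N₀, N₁, h3, h6, h4, h7, h5, h8⟩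

lemma exists_cutoff {K U : Set ℂ} (hK : IsClosed K) (hU : IsOpen U) (h : K ⊆ U) :
    ∃ χ : ℂ → ℝ, ContDiff ℝ (⊤ : ℕ∞) χ ∧ (∀ z, 0 ≤ χ z ∧ χ z ≤ 1) ∧ tsupport χ ⊆ U ∧
      ∃ O, IsOpen O ∧ K ⊆ O ∧ O ⊆ U ∧ ∀ z ∈ O, χ z = 1 := by
  obtain ⟨χ, h1, h2, N₀, N₁, h3, h4, h5, h6, h7, h8⟩ := exists_separating hU.isClosed_compl hK
    (Set.disjoint_left.mpr fun z hz hz' => hz (h hz'))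
  refine ⟨χ, h1, h2, ?_, N₁, h4, h6, fun z hz => ?_, h8⟩
  · have : tsupport χ ⊆ N₀ᶜ := closure_minimal
      (fun z hz hz' => hz (h7 z hz')) h3.isClosed_compl
    exact fun z hz => by_contra fun hz' => this hz (h5 hz')
  · by_contra hz'
    have := h7 z (h5 hz')
    rw [h8 z hz] at this
    exact one_ne_zero this

end Cutoffs

section RungeDisc
open scoped ComplexConjugate ENNReal
variable {E : Type*} [NormedAddCommGroup E] [NormedSpace ℂ E]

lemma Lop_eq_of_open {u v : ℂ × ℂ → E} {U : Set ℂ} (hU : IsOpen U) {z s : ℂ} (hz : z ∈ U)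
    (h : ∀ z ∈ U, ∀ s, u (z, s) = v (z, s)) : Lop u (z, s) = Lop v (z, s) := by
  refine firstOrder_congr (Filter.EventuallyEq.fderiv_eq ?_)
  filter_upwards [(hU.preimage continuous_fst).mem_nhds (show (z, s).1 ∈ U from hz)] with q hq
  exact h q.1 hq q.2

lemma exists_larger_closedBall {U : Set ℂ} (hU : IsOpen U) {z₀ : ℂ} {r : ℝ} (hr : 0 < r)
    (h : Metric.closedBall z₀ r ⊆ U) : ∃ r', r < r' ∧ Metric.closedBall z₀ r' ⊆ U := by
  obtain ⟨δ, hδ, h1⟩ := (isCompact_closedBall z₀ r).exists_cthickening_subset_open hU h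
  rw [cthickening_closedBall hδ.le hr.le] at h1
  exact ⟨δ + r, by linarith, h1⟩

/-- Coefficients of the expansion along the complexified dilations. -/
lemma exists_homogeneous_expansion [CompleteSpace E] {U : Set ℂ} (hU : IsOpen U) {u : ℂ × ℂ → E} (hu : Sol0 U u)
    {z₀ : ℂ} {r : ℝ} (hr : 0 < r) (hrU : Metric.closedBall z₀ r ⊆ U)
    (hr4 : Metric.closedBall z₀ r ⊆ Metric.ball 0 (1 / 4)) :
    ∃ r₁, r < r₁ ∧ Metric.ball z₀ r₁ ⊆ U ∩ Metric.ball 0 (1 / 4) ∧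
    ∃ (φ : ℕ → ℂ × ℂ → E) (ν : ℕ → ℝ≥0∞), (∀ k, Bd (φ k) (ν k)) ∧ ∑' k, ν k ≠ ∞ ∧
      (∀ k, Sol0 (Metric.ball z₀ r₁) (φ k)) ∧
      (∀ z ∈ Metric.ball z₀ r₁, ∀ s : ℂ, ‖s‖ ≤ 1 → HasSum (fun k => φ k (z, s)) (u (z, s))) ∧
      ∀ z ∈ Metric.ball z₀ r₁, ∀ s : ℂ, ‖s‖ < 1 → ∀ l : ℂ, ‖l‖ ≤ 1 →
        HasSum (fun k : ℕ => l ^ k • φ k (z, s)) (u (Psi z₀ l (z, s))) := by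
  obtain ⟨r₂, hr₂, h2⟩ := exists_larger_closedBall (hU.inter Metric.isOpen_ball) hr
    (Set.subset_inter hrU hr4)
  obtain ⟨r₁, hr₁, hr₁₂⟩ := exists_between hr₂
  have h1 : Metric.ball z₀ r₁ ⊆ U ∩ Metric.ball 0 (1 / 4) :=
    (Metric.ball_subset_closedBall.trans (Metric.closedBall_subset_closedBall hr₁₂.le)).trans h2
  set χ : ℂ → ℝ := fun z => Real.smoothTransition ((r₂ ^ 2 - ‖z - z₀‖ ^ 2) / (r₂ ^ 2 - r₁ ^ 2))
    with hχdef
  have hd : 0 < r₂ ^ 2 - r₁ ^ 2 := by nlinarith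
  have hχ : ContDiff ℝ (⊤ : ℕ∞) χ := by
    refine Real.smoothTransition.contDiff.comp (ContDiff.div_const ?_ _)
    exact contDiff_const.sub ((contDiff_norm_sq ℝ).comp (contDiff_id.sub contDiff_const))
  have hχ1 : ∀ z ∈ Metric.ball z₀ r₁, χ z = 1 := fun z hz => by
    refine Real.smoothTransition.one_of_one_le ?_
    rw [one_le_div hd]
    rw [mem_ball_iff_norm] at hz
    nlinarith [norm_nonneg (z - z₀)]
  have hχ0 : ∀ z, r₂ ≤ ‖z - z₀‖ → χ z = 0 := fun z hz => by
    refine Real.smoothTransition.zero_of_nonpos (div_nonpos_of_nonpos_of_nonneg ?_ hd.le)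
    nlinarith
  have hsupp : tsupport χ ⊆ Metric.closedBall z₀ r₂ := by
    refine closure_minimal (fun z hz => ?_) Metric.isClosed_closedBall
    rw [mem_closedBall_iff_norm]
    by_contra! h
    exact hz (hχ0 z h.le)
  have hrot : ∀ {z e : ℂ}, ‖e‖ = 1 → z ∈ Metric.closedBall z₀ r₂ →
      z₀ + e * (z - z₀) ∈ Metric.closedBall z₀ r₂ := fun he hz => by
    rw [mem_closedBall_iff_norm] at hz ⊢
    rwa [add_sub_cancel_left, norm_mul, he, one_mul]
  have hrot1 : ∀ {z e : ℂ}, ‖e‖ = 1 → z ∈ Metric.ball z₀ r₁ →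
      z₀ + e * (z - z₀) ∈ Metric.ball z₀ r₁ := fun he hz => by
    rw [mem_ball_iff_norm] at hz ⊢
    rwa [add_sub_cancel_left, norm_mul, he, one_mul]
  set f : ℝ → ℂ × ℂ → E := fun a p =>
    (χ p.1 : ℂ) • u (z₀ + ex a * (p.1 - z₀), ex a * p.2) with hf
  have hW : Metric.ball z₀ r₁ ⊆ Qs := fun z hz => mem_Qs (by
    have := (h1 hz).2
    rw [mem_ball_zero_iff] at this
    linarith)
  have hcut : ∀ a, SmH Set.univ (f a) := fun a =>
    (hu.rotate z₀ (norm_ex a)).1.cutoff hχ fun z hz => (h2 (hrot (norm_ex a) (hsupp hz))).1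
  have hsm : ∀ (a : ℝ) (z s : ℂ), ‖s‖ ≤ 1 →
      ContDiffAt ℝ (⊤ : ℕ∞) (fun q : ℝ × (ℂ × ℂ) => f q.1 q.2) (a, (z, s)) := by
    intro a z s hs
    by_cases hz : z ∈ tsupport χ
    · refine ContDiffAt.smul (ContDiff.contDiffAt ?_) ?_
      · exact (contDiff_ofReal_comp hχ).comp (contDiff_fst.comp contDiff_snd)
      · refine ContDiffAt.comp (𝕜 := ℝ) (g := u) (f := fun q : ℝ × (ℂ × ℂ) =>
          (z₀ + ex q.1 * (q.2.1 - z₀), ex q.1 * q.2.2)) (a, (z, s))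
          (hu.1.contDiffAt (h2 (hrot (norm_ex a) (hsupp hz))).1 (by simpa [norm_ex] using hs)) ?_
        have he : ContDiff ℝ (⊤ : ℕ∞) (fun q : ℝ × (ℂ × ℂ) => ex q.1) :=
          contDiff_ex.comp contDiff_fst
        refine ContDiff.contDiffAt (ContDiff.prodMk ?_ ?_)
        · exact contDiff_const.add (he.mul (by fun_prop))
        · exact he.mul (by fun_prop)
    · have hev : (fun q : ℝ × (ℂ × ℂ) => f q.1 q.2) =ᶠ[𝓝 (a, (z, s))] fun _ => 0 := by
        have ho : IsOpen ((fun q : ℝ × (ℂ × ℂ) => q.2.1) ⁻¹' (tsupport χ)ᶜ) :=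
          (isClosed_tsupport χ).isOpen_compl.preimage (by fun_prop)
        filter_upwards [ho.mem_nhds (show (a, (z, s)).2.1 ∈ (tsupport χ)ᶜ from hz)] with q hq
        simp only [hf]
        rw [image_eq_zero_of_notMem_tsupport hq]
        simp
      exact contDiffAt_const.congr_of_eventuallyEq hev
  have h0 : ∀ a (z s : ℂ), 3 / 8 < ‖z‖ → f a (z, s) = 0 := by
    intro a z s hz
    have : χ z = 0 := by
      by_contra hne
      have := (h2 (hsupp (subset_closure hne))).2
      rw [mem_ball_zero_iff] at this
      linarith
    simp [hf, this]
  have hper : ∀ a, f (a + 1) = f a := by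
    intro a
    have : ex (a + 1) = ex a := by simpa using ex_add_int a 1
    simp only [hf, this]
  have hL : ∀ a, ∀ z ∈ Metric.ball z₀ r₁, ∀ s : ℂ, ‖s‖ ≤ 1 → Lop (f a) (z, s) = 0 := by
    intro a z hz s hs
    have h3 : Lop (f a) (z, s) =
        Lop (fun p => u (z₀ + ex a * (p.1 - z₀), ex a * p.2)) (z, s) :=
      Lop_eq_of_open Metric.isOpen_ball hz fun z hz s => by simp [hf, hχ1 z hz]
    rw [h3]
    exact (hu.rotate z₀ (norm_ex a)).2 z (h1 (hrot1 (norm_ex a) hz)).1 s hs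
  obtain ⟨φ, ν, hφ, hν, hsum, hsol⟩ :=
    exists_modes hsm hcut h0 hper Metric.isOpen_ball hW hL
  have hsumm : ∀ z ∈ Metric.ball z₀ r₁, ∀ s : ℂ, ‖s‖ ≤ 1 → Summable fun k => ‖φ k (z, s)‖ :=
    fun z hz s hs => by
      refine summable_norm_iff_enorm.mpr (ne_top_of_le_ne_top hν ?_)
      exact ENNReal.tsum_le_tsum fun k => (hφ k).norm_le (hW hz) hs
  have hhardy : ∀ z ∈ Metric.ball z₀ r₁, ∀ s : ℂ, ‖s‖ < 1 →
      (∀ k < 0, φ k (z, s) = 0) ∧ ∀ l : ℂ, ‖l‖ ≤ 1 →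
        HasSum (fun k : ℕ => l ^ k • φ k (z, s)) (u (Psi z₀ l (z, s))) := by
    intro z hz s hs
    have hls : ∀ l : ℂ, ‖l‖ ≤ 1 → ‖l * s‖ < 1 := fun l hl => by
      rw [norm_mul]
      exact (mul_le_of_le_one_left (norm_nonneg s) hl).trans_lt hs
    have hdiff : ∀ l : ℂ, ‖l‖ ≤ 1 → DifferentiableAt ℂ (fun l => u (Psi z₀ l (z, s))) l :=
      fun l hl => by
        refine differentiableAt_comp_Psi (hu.mono (fun z hz => (h1 hz).1)) z₀ ?_ (hls l hl)
        rw [mem_ball_iff_norm] at hz ⊢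
        simp only [Psi, add_sub_cancel_left]
        exact (norm_Zv_le_self z₀ (p := (z, s)) (hls l hl) hl hs.le).trans_lt hz
    refine hardy (h := fun l => u (Psi z₀ l (z, s))) ?_ ?_ (hsumm z hz s hs.le) ?_
    · exact fun l hl => (hdiff l (by simpa using hl)).continuousAt.continuousWithinAt
    · exact fun l hl => (hdiff l (mem_ball_zero_iff.mp hl).le).differentiableWithinAt
    · intro l hl
      obtain ⟨a, rfl⟩ := exists_ex hl
      have h4 := hsum a z (hW hz) s hs.le
      have h5 : f a (z, s) = u (Psi z₀ (ex a) (z, s)) := by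
        simp only [hf, hχ1 z hz, Psi]
        rw [Zv_of_norm_eq_one z₀ (p := (z, s)) hl hs]
        simp
      rw [h5] at h4
      exact h4.congr_fun fun k => by rw [ex_int_mul]
  have hneg : ∀ k < 0, ∀ z ∈ Metric.ball z₀ r₁, ∀ s : ℂ, ‖s‖ ≤ 1 → φ k (z, s) = 0 :=
    fun k hk z hz s hs => (hsol k).1.eq_of_eq (SmH.const 0) hz
      (fun s hs => (hhardy z hz s hs).1 k hk) hs
  have hi : Function.Injective ((↑) : ℕ → ℤ) := Nat.cast_injective
  refine ⟨r₁, hr₁, h1, fun k => φ k, fun k => ν k, fun k => hφ k,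
    ne_top_of_le_ne_top hν (ENNReal.tsum_comp_le_tsum_of_injective hi ν), fun k => hsol k, ?_,
    fun z hz s hs => (hhardy z hz s hs).2⟩
  intro z hz s hs
  have h4 := hsum 0 z (hW hz) s hs
  have h5 : f 0 (z, s) = u (z, s) := by
    simp [hf, hχ1 z hz, ex]
  rw [h5] at h4
  have h6 := (hi.hasSum_iff (f := fun k : ℤ => ex (k * 0) • φ k (z, s)) (a := u (z, s))
    fun k hk => ?_).mpr (by exact_mod_cast h4)
  · exact h6.congr_fun fun k => by simp [ex]
  · rw [hneg k (by
      by_contra! h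
      exact hk ⟨k.toNat, Int.toNat_of_nonneg h⟩) z hz s hs, smul_zero]

/-- The Runge property: homogeneous solutions near `K` are approximated near `K` by homogeneous
solutions on the unit disc. -/
def Runge (E : Type*) [NormedAddCommGroup E] [NormedSpace ℂ E] (K : Set ℂ) : Prop :=
  ∀ U, IsOpen U → K ⊆ U → ∀ u : ℂ × ℂ → E, Sol0 U u → ∃ O, IsOpen O ∧ K ⊆ O ∧
    ∀ χ : ℂ → ℝ, ContDiff ℝ (⊤ : ℕ∞) χ → tsupport χ ⊆ O → ∀ ε : ℝ≥0∞, ε ≠ 0 →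
      ∃ p, Sol0 (Metric.ball 0 1) p ∧ Bd (fun q => (χ q.1 : ℂ) • (u q - p q)) ε

theorem runge_disc [CompleteSpace E] {z₀ : ℂ} {r : ℝ} (hr : 0 < r)
    (hr4 : Metric.closedBall z₀ r ⊆ Metric.ball 0 (1 / 4)) :
    Runge E (Metric.closedBall z₀ r) := by
  intro U hU hrU u hu
  obtain ⟨r₁, hr₁, h1, φ, ν, hφ, hν, hsol, hsum, hdil⟩ :=
    exists_homogeneous_expansion hU hu hr hrU hr4
  have hW : Metric.ball z₀ r₁ ⊆ Qs := fun z hz => mem_Qs (by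
    have := (h1 hz).2
    rw [mem_ball_zero_iff] at this
    linarith)
  refine ⟨Metric.ball z₀ r₁, Metric.isOpen_ball, Metric.closedBall_subset_ball hr₁, ?_⟩
  intro χ hχ hχs ε hε
  have hz₀ : ‖z₀‖ < 1 / 4 := mem_ball_zero_iff.mp (hr4 (Metric.mem_closedBall_self hr.le))
  obtain ⟨l₀, hl0, hl1, hl2⟩ : ∃ l₀ : ℝ, 0 < l₀ ∧ l₀ < 1 ∧ 5 / 2 * l₀ < r₁ := by
    refine ⟨min (1 / 2) (r₁ / 8), lt_min (by norm_num) (by linarith),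
      (min_le_left _ _).trans_lt (by norm_num), ?_⟩
    linarith [min_le_right (1 / 2) (r₁ / 8)]
  have hnl : ‖(l₀ : ℂ)‖ = l₀ := by simp [abs_of_pos hl0]
  have hlc : (l₀ : ℂ) ≠ 0 := by exact_mod_cast hl0.ne'
  have hls : ∀ s : ℂ, ‖s‖ ≤ 1 → ‖(l₀ : ℂ) * s‖ < 1 := fun s hs => by
    rw [norm_mul, hnl]
    exact (mul_le_of_le_one_right hl0.le hs).trans_lt hl1
  have hmaps : ∀ z ∈ Metric.ball (0 : ℂ) 1, ∀ s : ℂ, ‖s‖ ≤ 1 →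
      (Psi z₀ l₀ (z, s)).1 ∈ Metric.ball z₀ r₁ := fun z hz s hs => by
    have h2 := norm_Zv_le_two z₀ (l := l₀) (p := (z, s)) (hls s hs) (by rw [hnl]; exact hl1.le) hs
    rw [mem_ball_zero_iff] at hz
    rw [mem_ball_iff_norm, Psi]
    simp only [add_sub_cancel_left]
    have h3 : ‖z - z₀‖ ≤ 5 / 4 := (norm_sub_le _ _).trans (by linarith)
    rw [hnl] at h2
    nlinarith
  have hball : Metric.ball z₀ r₁ ⊆ Metric.ball (0 : ℂ) 1 := fun z hz =>
    Metric.ball_subset_ball (by norm_num) (h1 hz).2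
  have hsumm : ∀ z ∈ Metric.ball z₀ r₁, ∀ s : ℂ, ‖s‖ ≤ 1 → Summable fun k => ‖φ k (z, s)‖ :=
    fun z hz s hs => by
      refine summable_norm_iff_enorm.mpr (ne_top_of_le_ne_top hν ?_)
      exact ENNReal.tsum_le_tsum fun k => (hφ k).norm_le (hW hz) hs
  have hscale : ∀ z ∈ Metric.ball z₀ r₁, ∀ s : ℂ, ‖s‖ < 1 → ∀ k,
      φ k (Psi z₀ l₀ (z, s)) = (l₀ : ℂ) ^ k • φ k (z, s) := by
    intro z hz s hs
    have hm := hmaps z (hball hz) s hs.le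
    have hs' : ‖(Psi z₀ l₀ (z, s)).2‖ < 1 := hls s hs.le
    have hS := hsumm _ hm _ hs'.le
    have key := fourier_unique_nat
      (c := fun k => φ k (Psi z₀ l₀ (z, s)) - (l₀ : ℂ) ^ k • φ k (z, s)) ?_ fun l hl => ?_
    · exact fun k => sub_eq_zero.mp (congrFun key k)
    · refine Summable.of_nonneg_of_le (fun _ => norm_nonneg _) (fun k => ?_)
        (hS.add (hsumm z hz s hs.le))
      refine (norm_sub_le _ _).trans (add_le_add le_rfl ?_)
      rw [norm_smul, norm_pow, hnl]
      exact mul_le_of_le_one_left (norm_nonneg _) (pow_le_one₀ hl0.le hl1.le)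
    · have h2 := hdil _ hm _ hs' l hl.le
      have h3 := hdil z hz s hs (l * l₀) (by rw [norm_mul, hl, hnl]; linarith)
      rw [Prod.mk.eta, Psi_Psi z₀ l₀ l (p := (z, s)) (hls s hs.le)] at h2
      have h4 := h2.sub h3
      rw [sub_self] at h4
      exact h4.congr_fun fun k => by rw [smul_sub, smul_smul, mul_pow]
  set P : ℕ → ℂ × ℂ → E := fun k q => ((l₀ : ℂ) ^ k)⁻¹ • φ k (Psi z₀ l₀ q) with hP
  have hPsol : ∀ k, Sol0 (Metric.ball 0 1) (P k) := fun k =>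
    ((hsol k).comp_Psi z₀ (l := l₀) (by rw [hnl]; exact hl1) hmaps).const_smul _
  have hPeq : ∀ k, ∀ z ∈ Metric.ball z₀ r₁, ∀ s : ℂ, ‖s‖ ≤ 1 → P k (z, s) = φ k (z, s) :=
    fun k z hz s hs => ((hPsol k).1.mono hball).eq_of_eq (hsol k).1 hz (fun s hs => by
      simp only [hP]
      rw [hscale z hz s hs k, inv_smul_smul₀ (pow_ne_zero _ hlc)]) hs
  have hχ0 : ∀ z, z ∉ Metric.ball z₀ r₁ → χ z = 0 := fun z hz =>
    image_eq_zero_of_notMem_tsupport fun h => hz (hχs h)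
  obtain ⟨μ, hμ, hχb⟩ := exists_bd (f := fun q : ℂ × ℂ => (χ q.1 : ℂ))
    (SmH.of_fst (contDiff_ofReal_comp hχ)) fun z s hz => by
      rw [hχ0 z fun h => ?_, ofReal_zero]
      have := (h1 h).2
      rw [mem_ball_zero_iff] at this
      linarith
  have hlim : Tendsto (fun N => μ * ∑' k, ν (k + N)) atTop (𝓝 0) := by
    simpa using ENNReal.Tendsto.const_mul (ENNReal.tendsto_sum_nat_add ν hν) (Or.inr hμ)
  obtain ⟨N, hN⟩ := (hlim.eventually_lt_const (pos_iff_ne_zero.mpr hε)).exists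
  refine ⟨fun q => ∑ k ∈ Finset.range N, P k q, Sol0.sum hPsol N, ?_⟩
  rw [← ENNReal.tsum_mul_left] at hN
  refine (Bd.tsum (F := fun k q => (χ q.1 : ℂ) • φ (k + N) q)
    (fun k => hχb.smul (hφ (k + N))) (ne_top_of_lt hN) fun z hz s hs => ?_).mono hN.le
  by_cases hzW : z ∈ Metric.ball z₀ r₁
  · refine HasSum.const_smul _ ?_
    simp only [hPeq _ z hzW s hs]
    exact (hasSum_nat_add_iff' N).mpr (hsum z hzW s hs)
  · simp [hχ0 z hzW, hasSum_zero]

end RungeDisc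

section Splitting
open scoped ComplexConjugate ENNReal
variable {E : Type*} [NormedAddCommGroup E] [NormedSpace ℂ E]
variable {A : Type*} [NormedRing A] [NormedAlgebra ℂ A] [CompleteSpace A]

/-- `Lop` applied to a function of the spatial variable. -/
def Lfst (κ : ℂ → ℝ) (p : ℂ × ℂ) : ℂ :=
  (1 + p.2 ^ 2) / 2 * (fderiv ℝ κ p.1 1 : ℝ) + I * (1 - p.2 ^ 2) / 2 * (fderiv ℝ κ p.1 I : ℝ)

lemma Lop_fst {κ : ℂ → ℝ} (hκ : ContDiff ℝ (⊤ : ℕ∞) κ) (p : ℂ × ℂ) :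
    Lop (fun q : ℂ × ℂ => (κ q.1 : ℂ)) p = Lfst κ p := by
  have h1 : HasFDerivAt (fun q : ℂ × ℂ => (κ q.1 : ℂ))
      (ofRealCLM.comp ((fderiv ℝ κ p.1).comp (ContinuousLinearMap.fst ℝ ℂ ℂ))) p :=
    ofRealCLM.hasFDerivAt.comp p
      (HasFDerivAt.comp p ((hκ.differentiable (by simp) p.1).hasFDerivAt) hasFDerivAt_fst)
  simp [Lop, firstOrder, Lfst, h1.fderiv]

lemma Lop_fst_smul {κ : ℂ → ℝ} (hκ : ContDiff ℝ (⊤ : ℕ∞) κ) {u : ℂ × ℂ → E} {p : ℂ × ℂ}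
    (hu : DifferentiableAt ℝ u p) :
    Lop (fun q => (κ q.1 : ℂ) • u q) p = Lfst κ p • u p + (κ p.1 : ℂ) • Lop u p := by
  have h1 : DifferentiableAt ℝ (fun q : ℂ × ℂ => (κ q.1 : ℂ)) p :=
    (((contDiff_ofReal_comp hκ).comp contDiff_fst).differentiable (by simp) p)
  have h2 := Lop_fst hκ p
  unfold Lop at *
  rw [firstOrder_smul h1 hu, h2]

lemma smH_snd {U : Set ℂ} : SmH U (fun p => p.2) := fun z _ s _ =>
  ⟨contDiff_snd.contDiffAt, by simp [Sbar, firstOrder, fderiv_snd]⟩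

lemma smH_Lfst {κ : ℂ → ℝ} (hκ : ContDiff ℝ (⊤ : ℕ∞) κ) (U : Set ℂ) : SmH U (Lfst κ) := by
  have hd : ∀ v : ℂ, SmH U (fun p => ((fderiv ℝ κ p.1 v : ℝ) : ℂ)) := fun v =>
    SmH.of_fst (g := fun z => ((fderiv ℝ κ z v : ℝ) : ℂ))
      (contDiff_ofReal_comp ((hκ.fderiv_right (m := (⊤ : ℕ∞)) (by simp)).clm_apply contDiff_const))
  have hs : SmH U (fun p => p.2 ^ 2) := by
    simpa only [sq] using smH_snd.mul smH_snd
  have h1 : SmH U (fun p => (1 + p.2 ^ 2) / 2) := by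
    simpa only [div_eq_mul_inv] using ((SmH.const 1).add hs).mul (SmH.const (2⁻¹ : ℂ))
  have h2 : SmH U (fun p => I * (1 - p.2 ^ 2) / 2) := by
    simpa only [div_eq_mul_inv] using
      ((SmH.const I).mul ((SmH.const 1).sub hs)).mul (SmH.const (2⁻¹ : ℂ))
  exact (h1.mul (hd 1)).add (h2.mul (hd I))

lemma Lfst_eq_zero {κ : ℂ → ℝ} {N : Set ℂ} (hN : IsOpen N) {c : ℝ} (h : ∀ z ∈ N, κ z = c) {z : ℂ}
    (hz : z ∈ N) (s : ℂ) : Lfst κ (z, s) = 0 := by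
  have : fderiv ℝ κ z = 0 := by
    have h1 : κ =ᶠ[𝓝 z] fun _ => c := by
      filter_upwards [hN.mem_nhds hz] with w hw
      exact h w hw
    rw [h1.fderiv_eq, fderiv_const_apply]
  simp [Lfst, this]

/-- The geometric data used to split a function near `K₁ ∩ K₂`. -/
lemma exists_splitting {K₁ K₂ U : Set ℂ} (h1 : IsClosed K₁) (h2 : IsClosed K₂) (hU : IsOpen U)
    (h : K₁ ∩ K₂ ⊆ U) : ∃ κ χ : ℂ → ℝ, ContDiff ℝ (⊤ : ℕ∞) κ ∧ ContDiff ℝ (⊤ : ℕ∞) χ ∧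
      (∀ z, 0 ≤ κ z ∧ κ z ≤ 1) ∧ tsupport χ ⊆ U ∧ ∃ U₀ N₁ N₂ : Set ℂ, IsOpen U₀ ∧ IsOpen N₁ ∧
      IsOpen N₂ ∧ U₀ ⊆ U ∧ K₁ ⊆ U₀ ∪ N₁ ∧ K₂ ⊆ U₀ ∪ N₂ ∧ (∀ z ∈ U₀, χ z = 1) ∧
      (∀ z ∈ N₁, κ z = 0) ∧ ∀ z ∈ N₂, κ z = 1 := by
  obtain ⟨κ, hκ, hκ1, N₁, N₂, hN1, hN2, hF1, hF2, h01, h02⟩ :=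
    exists_separating (h1.sdiff hU) (h2.sdiff hU)
      (Set.disjoint_left.mpr fun z hz hz' => hz.2 (h ⟨hz.1, hz'.1⟩))
  obtain ⟨χ, hχ, -, hχU, U₀, hU₀, hK₀, hU₀U, hχ1⟩ :=
    exists_cutoff ((h1.sdiff hN1).union (h2.sdiff hN2)) hU (by
      rintro z (hz | hz)
      · exact by_contra fun h => hz.2 (hF1 ⟨hz.1, h⟩)
      · exact by_contra fun h => hz.2 (hF2 ⟨hz.1, h⟩))
  refine ⟨κ, χ, hκ, hχ, hκ1, hχU, U₀, N₁, N₂, hU₀, hN1, hN2, hU₀U, fun z hz => ?_, fun z hz => ?_,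
    hχ1, h01, h02⟩
  · by_cases h : z ∈ N₁
    · exact Or.inr h
    · exact Or.inl (hK₀ (Or.inl ⟨hz, h⟩))
  · by_cases h : z ∈ N₂
    · exact Or.inr h
    · exact Or.inl (hK₀ (Or.inr ⟨hz, h⟩))

lemma Sol0.union {U V : Set ℂ} {u : ℂ × ℂ → E} (hu : Sol0 U u) (hv : Sol0 V u) :
    Sol0 (U ∪ V) u :=
  ⟨hu.1.union hv.1, fun z hz => hz.elim (hu.2 z) (hv.2 z)⟩

theorem Runge.inter {K₁ K₂ : Set ℂ} (h1 : IsClosed K₁) (h2 : IsClosed K₂)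
    (hb1 : K₁ ⊆ Metric.ball 0 (1 / 4)) (hb2 : K₂ ⊆ Metric.ball 0 (1 / 4))
    (hR1 : Runge A K₁) (hR2 : Runge A K₂) : Runge A (K₁ ∩ K₂) := by
  intro U hU hKU u hu
  obtain ⟨κ, χ₀, hκ, hχ₀, -, hχ₀U, U₀, N₁, N₂, hU₀, hN1, hN2, hU₀U, hK1, hK2, hχ1, h01, h02⟩ :=
    exists_splitting h1 h2 (hU.inter Metric.isOpen_ball) (Set.subset_inter hKU
      (Set.inter_subset_left.trans hb1))
  set f : ℂ × ℂ → A := fun p => (χ₀ p.1 : ℂ) • (Lfst κ p • u p) with hf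
  have hfs : SmH Set.univ f := ((smH_Lfst hκ U).smul hu.1).cutoff hχ₀ fun z hz => (hχ₀U hz).1
  have hf0 : ∀ z s : ℂ, 3 / 8 < ‖z‖ → f (z, s) = 0 := fun z s hz => by
    have : χ₀ z = 0 := image_eq_zero_of_notMem_tsupport fun h => by
      have := (hχ₀U h).2
      rw [mem_ball_zero_iff] at this
      linarith
    simp [hf, this]
  obtain ⟨C, ε₀, hC, hε₀, hsolve⟩ := exists_solve (A := A)
  obtain ⟨ν, hν, hbf⟩ := exists_bd hfs hf0
  obtain ⟨v, hv, hLv, -⟩ := hsolve (fun _ => 0) f (SmH.const 0) hfs (fun _ _ _ => rfl) hf0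
    (Bd.zero.mono bot_le) ν hbf
  simp only [zero_mul, zero_add] at hLv
  have hmain : ∀ N : Set ℂ, IsOpen N → ∀ c : ℝ, (∀ z ∈ N, κ z = c) →
      Sol0 ((U₀ ∪ N) ∩ Metric.ball 0 (1 / 4)) (fun p => ((κ p.1 - c : ℝ) : ℂ) • u p - v p) := by
    intro N hN c hc
    have hκc : ContDiff ℝ (⊤ : ℕ∞) (fun z => κ z - c) := hκ.sub contDiff_const
    have hLc : ∀ p, Lfst (fun z => κ z - c) p = Lfst κ p := fun p => by
      simp [Lfst, fderiv_sub_const]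
    rw [Set.union_inter_distrib_right]
    refine Sol0.union ⟨?_, fun z hz s hs => ?_⟩ ⟨?_, fun z hz s hs => ?_⟩
    · exact ((SmH.of_fst (contDiff_ofReal_comp hκc)).smul (hu.1.mono fun z hz =>
        (hU₀U hz.1).1)).sub (hv.mono (Set.subset_univ _))
    · have hz' := (hU₀U hz.1).1
      have hd := hu.1.diff hz' hs
      have h3 := Lop_fst_smul hκc hd
      have h4 := hLv z hz.2 s hs
      have h5 : DifferentiableAt ℝ (fun q : ℂ × ℂ => ((κ q.1 - c : ℝ) : ℂ) • u q) (z, s) :=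
        (((SmH.of_fst (contDiff_ofReal_comp hκc)).smul (hu.1.mono (Set.Subset.refl U)))).diff hz' hs
      rw [hu.2 z hz' s hs, smul_zero, add_zero, hLc] at h3
      unfold Lop at *
      rw [firstOrder_sub h5 (hv.diff (Set.mem_univ z) hs), h3, h4]
      simp [hf, hχ1 z hz.1]
    · refine ((SmH.const (0 : A)).sub (hv.mono (Set.subset_univ (N ∩ Metric.ball 0 (1 / 4))))).congr
        (hN.inter Metric.isOpen_ball) fun z hz s => ?_
      simp [hc z hz.1]
    · have h4 := hLv z hz.2 s hs
      rw [Lop_eq_of_open (v := fun p => (0 : A) - v p) hN hz.1 fun z hz s => by simp [hc z hz]]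
      unfold Lop at *
      rw [firstOrder_sub (differentiableAt_const _) (hv.diff (Set.mem_univ z) hs), h4]
      simp [hf, Lfst_eq_zero hN hc hz.1, firstOrder_const]
  obtain ⟨O₁, hO1, hKO1, hap1⟩ := hR1 _ ((hU₀.union hN1).inter Metric.isOpen_ball)
    (Set.subset_inter hK1 hb1) _ (hmain N₁ hN1 0 h01)
  obtain ⟨O₂, hO2, hKO2, hap2⟩ := hR2 _ ((hU₀.union hN2).inter Metric.isOpen_ball)
    (Set.subset_inter hK2 hb2) _ (hmain N₂ hN2 1 h02)
  refine ⟨O₁ ∩ O₂, hO1.inter hO2, Set.inter_subset_inter hKO1 hKO2, fun χ hχ hχs ε hε => ?_⟩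
  have hε2 : ε / 2 ≠ 0 := by simpa using hε
  obtain ⟨p₁, hp1, hb1⟩ := hap1 χ hχ (hχs.trans Set.inter_subset_left) (ε / 2) hε2
  obtain ⟨p₂, hp2, hb2⟩ := hap2 χ hχ (hχs.trans Set.inter_subset_right) (ε / 2) hε2
  refine ⟨fun q => p₁ q - p₂ q, hp1.sub hp2, ?_⟩
  rw [← ENNReal.add_halves ε]
  refine (hb1.sub hb2).congr fun z _ s _ => ?_
  rw [← smul_sub]
  congr 1
  push_cast
  module

end Splitting

section Approximation
open scoped ENNReal
variable {A : Type*} [NormedRing A] [NormedAlgebra ℂ A] [CompleteSpace A]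

lemma inverse_mul_of_isUnit {a b : A} (ha : IsUnit a) (hb : IsUnit b) :
    Ring.inverse (a * b) = Ring.inverse b * Ring.inverse a := by
  obtain ⟨x, rfl⟩ := ha
  obtain ⟨y, rfl⟩ := hb
  rw [← Units.val_mul, Ring.inverse_unit, Ring.inverse_unit, Ring.inverse_unit, _root_.mul_inv_rev,
    Units.val_mul]

lemma isUnit_inverse {a : A} (ha : IsUnit a) : IsUnit (Ring.inverse a) := by
  obtain ⟨x, rfl⟩ := ha
  rw [Ring.inverse_unit]
  exact Units.isUnit _

lemma contDiffAt_exp (x : A) : ContDiffAt ℂ (⊤ : ℕ∞) (NormedSpace.exp : A → A) x :=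
  (NormedSpace.exp_analytic (𝕂 := ℂ) x).contDiffAt

lemma isUnit_exp (x : A) : IsUnit (NormedSpace.exp x) := by
  let _ : NormedAlgebra ℚ A := NormedAlgebra.restrictScalars ℚ ℂ A
  exact NormedSpace.isUnit_exp x

lemma inverse_exp (x : A) : Ring.inverse (NormedSpace.exp x) = NormedSpace.exp (-x) := by
  let _ : NormedAlgebra ℚ A := NormedAlgebra.restrictScalars ℚ ℂ A
  exact Ring.inverse_exp x

/-- A smooth logarithm near the unit. -/
lemma exists_log : ∃ δ > 0, ∃ Log : A → A, ∀ x : A, ‖x - 1‖ < δ →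
    ContDiffAt ℂ (⊤ : ℕ∞) Log x ∧ NormedSpace.exp (Log x) = x := by
  have h0 : ContDiffAt ℂ (⊤ : WithTop ℕ∞) (NormedSpace.exp : A → A) 0 :=
    (NormedSpace.exp_analytic (𝕂 := ℂ) (0 : A)).contDiffAt
  have h1 : HasFDerivAt (NormedSpace.exp : A → A)
      ((ContinuousLinearEquiv.refl ℂ A : A ≃L[ℂ] A) : A →L[ℂ] A) 0 :=
    (hasStrictFDerivAt_exp_zero (𝕂 := ℂ) (𝔸 := A)).hasFDerivAt
  have h2 := (h0.to_localInverse h1 (by simp)).analyticAt.eventually_analyticAt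
  have h3 := (h0.hasStrictFDerivAt' h1 (by simp)).eventually_right_inverse
  rw [NormedSpace.exp_zero] at h2 h3
  obtain ⟨δ, hδ, h4⟩ := Metric.eventually_nhds_iff.mp (h2.and h3)
  refine ⟨δ, hδ, h0.localInverse h1 (by simp), fun x hx => ?_⟩
  obtain ⟨h5, h6⟩ := h4 (show dist x 1 < δ by rwa [dist_eq_norm])
  exact ⟨h5.contDiffAt, h6⟩

lemma Sol0.mul {U : Set ℂ} {u v : ℂ × ℂ → A} (hu : Sol0 U u) (hv : Sol0 U v) :
    Sol0 U (fun p => u p * v p) :=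
  ⟨hu.1.mul hv.1, fun z hz s hs => by
    have h1 := hu.2 z hz s hs
    have h2 := hv.2 z hz s hs
    unfold Lop at *
    rw [firstOrder_mul (hu.1.diff hz hs) (hv.1.diff hz hs), h1, h2, zero_mul, mul_zero, add_zero]⟩

lemma Sol0.comp {E F : Type*} [NormedAddCommGroup E] [NormedSpace ℂ E] [NormedAddCommGroup F]
    [NormedSpace ℂ F] {U : Set ℂ} {u : ℂ × ℂ → E} (hu : Sol0 U u) {Φ : E → F}
    (hΦ : ∀ z ∈ U, ∀ s : ℂ, ‖s‖ ≤ 1 → ContDiffAt ℂ (⊤ : ℕ∞) Φ (u (z, s))) :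
    Sol0 U (fun p => Φ (u p)) :=
  ⟨hu.1.comp hΦ, fun z hz s hs => by
    have h1 := hu.2 z hz s hs
    unfold Lop at *
    rw [firstOrder_comp ((hΦ z hz s hs).differentiableAt (by simp)).hasFDerivAt (hu.1.diff hz hs),
      h1, map_zero]⟩

lemma Sol0.inverse {U : Set ℂ} {u : ℂ × ℂ → A} (hu : Sol0 U u)
    (h : ∀ z ∈ U, ∀ s : ℂ, ‖s‖ ≤ 1 → IsUnit (u (z, s))) :
    Sol0 U (fun p => Ring.inverse (u p)) :=
  hu.comp fun z hz s hs => by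
    obtain ⟨x, hx⟩ := h z hz s hs
    rw [← hx]
    exact contDiffAt_ringInverse ℂ x

/-- `g` is multiplicatively approximable near `K` by invertible homogeneous solutions on the unit
disc. -/
def Approx (K : Set ℂ) (g : ℂ × ℂ → A) : Prop :=
  ∃ O, IsOpen O ∧ K ⊆ O ∧ ∀ χ : ℂ → ℝ, ContDiff ℝ (⊤ : ℕ∞) χ → tsupport χ ⊆ O →
    ∀ ε : ℝ≥0∞, ε ≠ 0 → ∃ h, Sol0 (Metric.ball 0 1) h ∧
      (∀ z ∈ Metric.ball (0 : ℂ) 1, ∀ s : ℂ, ‖s‖ ≤ 1 → IsUnit (h (z, s))) ∧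
      Bd (fun q => (χ q.1 : ℂ) • (g q * Ring.inverse (h q) - 1)) ε

lemma bd_cutoff {E : Type*} [NormedAddCommGroup E] [NormedSpace ℂ E] [CompleteSpace E] {U : Set ℂ}
    {u : ℂ × ℂ → E} (hu : SmH U u) {χ : ℂ → ℝ} (hχ : ContDiff ℝ (⊤ : ℕ∞) χ)
    (hs : tsupport χ ⊆ U) (hs' : tsupport χ ⊆ Metric.ball 0 (1 / 4)) :
    ∃ a : ℝ, 0 ≤ a ∧ Bd (fun p => (χ p.1 : ℂ) • u p) (ENNReal.ofReal a) := by
  obtain ⟨ν, hν, h⟩ := exists_bd (hu.cutoff hχ hs) fun z s hz => by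
    have : χ z = 0 := image_eq_zero_of_notMem_tsupport fun h => by
      have := hs' h
      rw [mem_ball_zero_iff] at this
      linarith
    simp [this]
  exact ⟨ν.toReal, ENNReal.toReal_nonneg, by rwa [ENNReal.ofReal_toReal hν]⟩

lemma Approx.congr {K U : Set ℂ} {g g' : ℂ × ℂ → A} (h : Approx K g) (hU : IsOpen U)
    (hKU : K ⊆ U) (he : ∀ z ∈ U, ∀ s : ℂ, ‖s‖ ≤ 1 → g' (z, s) = g (z, s)) : Approx K g' := by
  obtain ⟨O, hO, hKO, h1⟩ := h
  refine ⟨O ∩ U, hO.inter hU, Set.subset_inter hKO hKU, fun χ hχ hχs ε hε => ?_⟩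
  obtain ⟨k, h2, h3, h4⟩ := h1 χ hχ (hχs.trans Set.inter_subset_left) ε hε
  refine ⟨k, h2, h3, h4.congr fun z _ s hs => ?_⟩
  by_cases hz : z ∈ U
  · simp only [he z hz s hs]
  · have : χ z = 0 := image_eq_zero_of_notMem_tsupport fun h => hz (hχs h).2
    simp [this]

lemma ball_quarter_subset : Metric.ball (0 : ℂ) (1 / 4) ⊆ Metric.ball 0 1 :=
  Metric.ball_subset_ball (by norm_num)

lemma Approx.mul {K U : Set ℂ} {g₁ g₂ : ℂ × ℂ → A} (h1 : Approx K g₁) (h2 : Approx K g₂)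
    (hK : K ⊆ Metric.ball 0 (1 / 4)) (hU : IsOpen U) (hKU : K ⊆ U) (hg : SmH U g₁) :
    Approx K (fun p => g₁ p * g₂ p) := by
  obtain ⟨O₁, hO1, hKO1, h1⟩ := h1
  obtain ⟨O₂, hO2, hKO2, h2⟩ := h2
  refine ⟨(O₁ ∩ O₂) ∩ (U ∩ Metric.ball 0 (1 / 4)), (hO1.inter hO2).inter
    (hU.inter Metric.isOpen_ball), Set.subset_inter (Set.subset_inter hKO1 hKO2)
    (Set.subset_inter hKU hK), fun χ hχ hχs ε hε => ?_⟩
  obtain ⟨χ₁, hχ1, -, hs1, O, hO, hχO, -, h11⟩ := exists_cutoff (isClosed_tsupport χ)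
    (hU.inter Metric.isOpen_ball) (hχs.trans Set.inter_subset_right)
  have hε2 : ε / 2 ≠ 0 := by simpa using hε
  obtain ⟨k₁, hk1, hu1, hb1⟩ := h1 χ hχ (fun z hz => (hχs hz).1.1) (ε / 2) hε2
  obtain ⟨a, ha, hba⟩ := bd_cutoff hg hχ1 (fun z hz => (hs1 hz).1) fun z hz => (hs1 hz).2
  obtain ⟨b, hb, hbb⟩ := bd_cutoff (hk1.inverse hu1).1 hχ1
    (fun z hz => ball_quarter_subset (hs1 hz).2) fun z hz => (hs1 hz).2
  set d : ℝ≥0∞ := ε / 2 / (ENNReal.ofReal a * ENNReal.ofReal b + 1) with hd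
  have hd0 : d ≠ 0 := by
    refine (ENNReal.div_pos hε2 ?_).ne'
    exact ENNReal.add_ne_top.mpr ⟨ENNReal.mul_ne_top (by simp) (by simp), by simp⟩
  obtain ⟨k₂, hk2, hu2, hb2⟩ := h2 χ hχ (fun z hz => (hχs hz).1.2) d hd0
  have hdle : ENNReal.ofReal a * d * ENNReal.ofReal b ≤ ε / 2 := by
    calc ENNReal.ofReal a * d * ENNReal.ofReal b
        = d * (ENNReal.ofReal a * ENNReal.ofReal b) := by ring
      _ ≤ d * (ENNReal.ofReal a * ENNReal.ofReal b + 1) := by gcongr; exact le_self_add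
      _ ≤ ε / 2 := (ENNReal.div_mul_cancel (by simp) (ENNReal.add_ne_top.mpr
        ⟨ENNReal.mul_ne_top (by simp) (by simp), by simp⟩)).le
  refine ⟨fun p => k₁ p * k₂ p, hk1.mul hk2, fun z hz s hs => (hu1 z hz s hs).mul (hu2 z hz s hs),
    ?_⟩
  rw [← ENNReal.add_halves ε]
  refine (((hba.mul hb2).mul hbb).mono hdle |>.add hb1).congr fun z hz s hs => ?_
  by_cases hχz : χ z = 0
  · simp [hχz]
  · have hz' : z ∈ tsupport χ := subset_closure hχz
    have hz1 : z ∈ Metric.ball (0 : ℂ) 1 := ball_quarter_subset (hχs hz').2.2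
    simp only [h11 z (hχO hz'), ofReal_one, one_smul]
    rw [inverse_mul_of_isUnit (hu1 z hz1 s hs) (hu2 z hz1 s hs), mul_smul_comm, smul_mul_assoc,
      ← smul_add]
    congr 1
    noncomm_ring

variable [NormOneClass A]

lemma approx_exp {K U : Set ℂ} (hK : K ⊆ Metric.ball 0 (1 / 4)) (hR : Runge A K) (hU : IsOpen U)
    (hKU : K ⊆ U) {u : ℂ × ℂ → A} (hu : Sol0 U u) : Approx K (fun p => NormedSpace.exp (u p)) := by
  obtain ⟨O, hO, hKO, hap⟩ := hR U hU hKU u hu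
  refine ⟨O ∩ (U ∩ Metric.ball 0 (1 / 4)), hO.inter (hU.inter Metric.isOpen_ball),
    Set.subset_inter hKO (Set.subset_inter hKU hK), fun χ hχ hχs ε hε => ?_⟩
  obtain ⟨χ₁, hχ1, -, hs1, O', hO', hχO', -, h11⟩ := exists_cutoff (isClosed_tsupport χ)
    (hO.inter (hU.inter Metric.isOpen_ball)) hχs
  obtain ⟨a, ha, hba⟩ := bd_cutoff hu.1 hχ1 (fun z hz => (hs1 hz).2.1) fun z hz => (hs1 hz).2.2
  obtain ⟨b, hb, hbb⟩ := bd_cutoff (SmH.const (1 : A) (U := Set.univ)) hχ (Set.subset_univ _)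
    fun z hz => (hχs hz).2.2
  set M : ℝ := b * Real.exp (a + 1) * (1 + (a + 1) * Real.exp (a + 1)) with hM
  have hM0 : 0 ≤ M := by positivity
  obtain ⟨d, hd0, hd1, hdM⟩ : ∃ d : ℝ, 0 < d ∧ d ≤ 1 ∧ ENNReal.ofReal (d * M) ≤ ε := by
    have hlim : Tendsto (fun d : ℝ => ENNReal.ofReal (d * M)) (𝓝[>] 0) (𝓝 0) := by
      have : Tendsto (fun d : ℝ => ENNReal.ofReal (d * M)) (𝓝 0) (𝓝 (ENNReal.ofReal (0 * M))) :=
        (ENNReal.continuous_ofReal.comp (continuous_mul_const M)).tendsto 0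
      rw [zero_mul, ENNReal.ofReal_zero] at this
      exact this.mono_left nhdsWithin_le_nhds
    obtain ⟨d, h1, h2⟩ := ((hlim.eventually_lt_const (pos_iff_ne_zero.mpr hε)).and
      (Ioc_mem_nhdsGT (zero_lt_one' ℝ))).exists
    exact ⟨d, h2.1, h2.2, h1.le⟩
  obtain ⟨p, hp, hbp⟩ := hap χ₁ hχ1 (fun z hz => (hs1 hz).1) (ENNReal.ofReal d) (by simpa using hd0)
  have hup : Bd (fun q => (χ₁ q.1 : ℂ) • u q - (χ₁ q.1 : ℂ) • p q) (ENNReal.ofReal d) :=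
    hbp.congr fun z _ s _ => (smul_sub _ _ _).symm
  have hpu : Bd (fun q => (χ₁ q.1 : ℂ) • p q - (χ₁ q.1 : ℂ) • u q) (ENNReal.ofReal d) :=
    hup.neg.congr fun z _ s _ => by abel
  have hpb : Bd (fun q => -((χ₁ q.1 : ℂ) • p q) - 0) (ENNReal.ofReal (a + d)) := by
    rw [ENNReal.ofReal_add ha hd0.le]
    exact (hba.add hpu).neg.congr fun z _ s _ => by abel
  have h1 := (Bd.exp_sub ha hd0.le hba hpu).neg
  have h2 := Bd.exp_sub (g := fun _ => (0 : A)) le_rfl (add_nonneg ha hd0.le)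
    (by simpa using Bd.zero) hpb
  have h3 : Bd (fun q => NormedSpace.exp (-((χ₁ q.1 : ℂ) • p q)))
      (ENNReal.ofReal (1 + (a + 1) * Real.exp (a + 1))) := by
    have h4 := (Bd.const (1 : A)).add h2
    refine (h4.mono ?_).congr fun z _ s _ => ?_
    · rw [ENNReal.ofReal_add zero_le_one (by positivity)]
      have : ‖(1 : A)‖ₑ = ENNReal.ofReal 1 := by rw [← ofReal_norm, norm_one]
      rw [this]
      refine add_le_add le_rfl (ENNReal.ofReal_le_ofReal (mul_le_mul (by linarith)
        (Real.exp_le_exp.mpr (by linarith)) (by positivity) (by positivity)))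
    · simp [NormedSpace.exp_zero]
  have h5 := (hbb.mul h1).mul h3
  refine ⟨fun q => NormedSpace.exp (p q), hp.comp fun z _ s _ => contDiffAt_exp _,
    fun z _ s _ => isUnit_exp _, (h5.mono ?_).congr fun z hz s hs => ?_⟩
  · rw [← ENNReal.ofReal_mul hb, ← ENNReal.ofReal_mul (by positivity)]
    refine le_trans (ENNReal.ofReal_le_ofReal ?_) hdM
    have h6 : Real.exp (a + d) ≤ Real.exp (a + 1) := Real.exp_le_exp.mpr (by linarith)
    calc b * (d * Real.exp (a + d)) * (1 + (a + 1) * Real.exp (a + 1))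
        ≤ b * (d * Real.exp (a + 1)) * (1 + (a + 1) * Real.exp (a + 1)) := by gcongr
      _ = d * M := by rw [hM]; ring
  · by_cases hχz : χ z = 0
    · simp [hχz]
    · have hz' : z ∈ tsupport χ := subset_closure hχz
      simp only [h11 z (hχO' hz'), ofReal_one, one_smul]
      rw [smul_mul_assoc, smul_mul_assoc, one_mul, ← inverse_exp, neg_sub, sub_mul,
        Ring.mul_inverse_cancel _ (isUnit_exp _)]

end Approximation

section Contraction
open scoped ENNReal
variable {A : Type*} [NormedRing A] [NormedAlgebra ℂ A] [CompleteSpace A]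

lemma Sol0.affine {E : Type*} [NormedAddCommGroup E] [NormedSpace ℂ E] {U : Set ℂ}
    {u : ℂ × ℂ → E} (h : Sol0 U u) (c : ℂ) (l : ℝ) :
    Sol0 ((fun z => c + (l : ℂ) * z) ⁻¹' U) (fun p => u (c + (l : ℂ) * p.1, p.2)) :=
  ⟨h.1.affine c l, fun z hz s hs => by
    rw [Lop_affine h.1 c l hz hs, h.2 _ hz s hs, smul_zero]⟩

lemma SmH.continuousOn {E : Type*} [NormedAddCommGroup E] [NormedSpace ℂ E] {U : Set ℂ}
    {u : ℂ × ℂ → E} (h : SmH U u) : ContinuousOn u (U ×ˢ Metric.closedBall 0 1) :=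
  fun _ hp => (h.contDiffAt hp.1 (mem_closedBall_zero_iff.mp hp.2)).continuousAt.continuousWithinAt

lemma approx_self {K : Set ℂ} {g : ℂ × ℂ → A} (h : Sol0 (Metric.ball 0 1) g)
    (hu : ∀ z ∈ Metric.ball (0 : ℂ) 1, ∀ s : ℂ, ‖s‖ ≤ 1 → IsUnit (g (z, s)))
    (hK : K ⊆ Metric.ball 0 1) : Approx K g := by
  refine ⟨Metric.ball 0 1, Metric.isOpen_ball, hK, fun χ hχ hχs ε hε => ⟨g, h, hu, ?_⟩⟩
  refine (Bd.zero.mono (zero_le (a := ε))).congr fun z _ s hs => ?_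
  by_cases hz : z ∈ Metric.ball (0 : ℂ) 1
  · simp [Ring.mul_inverse_cancel _ (hu z hz s hs)]
  · simp [image_eq_zero_of_notMem_tsupport fun h => hz (hχs h)]

/-- Uniform continuity of the contraction quotients. -/
lemma exists_step {V S : Set ℂ} {g : ℂ × ℂ → A} {z₀ : ℂ} (hS : IsCompact S) (hVS : V ⊆ S)
    (hg : ContinuousOn g (S ×ˢ Metric.closedBall 0 1))
    (hu : ∀ z ∈ S, ∀ s : ℂ, ‖s‖ ≤ 1 → IsUnit (g (z, s)))
    (hst : ∀ z ∈ V, ∀ τ ∈ Set.Icc (0 : ℝ) 1, ((1 - τ : ℝ) : ℂ) * z₀ + (τ : ℂ) * z ∈ V)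
    {δ : ℝ} (hδ : 0 < δ) :
    ∃ η > 0, ∀ τ ∈ Set.Icc (0 : ℝ) 1, ∀ τ' ∈ Set.Icc (0 : ℝ) 1, |τ - τ'| < η → ∀ z ∈ V,
      ∀ s : ℂ, ‖s‖ ≤ 1 → ‖g (((1 - τ : ℝ) : ℂ) * z₀ + (τ : ℂ) * z, s) *
        Ring.inverse (g (((1 - τ' : ℝ) : ℂ) * z₀ + (τ' : ℂ) * z, s)) - 1‖ < δ := by
  have hC : IsCompact (S ×ˢ Metric.closedBall (0 : ℂ) 1) := hS.prod (isCompact_closedBall _ _)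
  have hinv : ContinuousOn (fun p => Ring.inverse (g p)) (S ×ˢ Metric.closedBall 0 1) := by
    intro p hp
    obtain ⟨x, hx⟩ := hu p.1 hp.1 p.2 (mem_closedBall_zero_iff.mp hp.2)
    have := NormedRing.inverse_continuousAt x
    rw [hx] at this
    exact this.comp_continuousWithinAt (hg p hp)
  obtain ⟨M, hM⟩ := hC.exists_bound_of_continuousOn hinv
  obtain ⟨D, hD⟩ := hS.isBounded.subset_closedBall z₀
  have hunif := hC.uniformContinuousOn_of_continuous hg
  obtain ⟨η, hη, h1⟩ := Metric.uniformContinuousOn_iff.mp hunif (δ / (|M| + 1)) (by positivity)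
  refine ⟨η / (|D| + 1), by positivity, fun τ hτ τ' hτ' hd z hz s hs => ?_⟩
  have hs' : s ∈ Metric.closedBall (0 : ℂ) 1 := mem_closedBall_zero_iff.mpr hs
  have hp := hVS (hst z hz τ hτ)
  have hp' := hVS (hst z hz τ' hτ')
  have hzD : ‖z - z₀‖ ≤ |D| := (mem_closedBall_iff_norm.mp (hD (hVS hz))).trans (le_abs_self _)
  have h2 := h1 _ (Set.mk_mem_prod hp hs') _ (Set.mk_mem_prod hp' hs') (by
    rw [Prod.dist_eq, dist_self, max_lt_iff]
    refine ⟨?_, hη⟩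
    rw [dist_eq_norm]
    have : ((1 - τ : ℝ) : ℂ) * z₀ + (τ : ℂ) * z - (((1 - τ' : ℝ) : ℂ) * z₀ + (τ' : ℂ) * z) =
        ((τ - τ' : ℝ) : ℂ) * (z - z₀) := by push_cast; ring
    rw [this, norm_mul, norm_real, Real.norm_eq_abs]
    rw [lt_div_iff₀ (by positivity)] at hd
    calc |τ - τ'| * ‖z - z₀‖ ≤ |τ - τ'| * (|D| + 1) := by gcongr; linarith
      _ < η := hd)
  have hu' := hu _ hp' s hs
  have h3 := hM _ (Set.mk_mem_prod hp' hs')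
  set a := g (((1 - τ : ℝ) : ℂ) * z₀ + (τ : ℂ) * z, s)
  set b := g (((1 - τ' : ℝ) : ℂ) * z₀ + (τ' : ℂ) * z, s)
  have h4 : a * Ring.inverse b - 1 = (a - b) * Ring.inverse b := by
    rw [sub_mul, Ring.mul_inverse_cancel _ hu']
  rw [h4]
  rw [dist_eq_norm, lt_div_iff₀ (by positivity)] at h2
  calc ‖(a - b) * Ring.inverse b‖ ≤ ‖a - b‖ * ‖Ring.inverse b‖ := norm_mul_le _ _
    _ ≤ ‖a - b‖ * (|M| + 1) := by
      gcongr
      linarith [le_abs_self M, show ‖Ring.inverse b‖ ≤ M from h3]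
    _ < δ := h2

lemma approx_of_convex [NormOneClass A] {K U : Set ℂ} {g : ℂ × ℂ → A} (hKc : IsCompact K)
    (hKv : Convex ℝ K) (hK : K ⊆ Metric.ball 0 (1 / 4)) (hR : Runge A K) (hU : IsOpen U)
    (hKU : K ⊆ U) (hg : Sol0 U g) (hu : ∀ z ∈ U, ∀ s : ℂ, ‖s‖ ≤ 1 → IsUnit (g (z, s))) :
    Approx K g := by
  rcases K.eq_empty_or_nonempty with rfl | ⟨z₀, hz₀⟩
  · exact ⟨∅, isOpen_empty, subset_rfl, fun χ _ hχs ε _ => ⟨fun _ => 1,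
      ⟨SmH.const 1, fun z _ s _ => by simp [Lop, firstOrder_const]⟩, fun _ _ _ _ => isUnit_one,
      (Bd.zero.mono (zero_le (a := ε))).congr fun z _ s _ => by
        simp [image_eq_zero_of_notMem_tsupport fun h => hχs h]⟩⟩
  obtain ⟨r, hr, hrU⟩ := hKc.exists_cthickening_subset_open hU hKU
  have hVo : IsOpen (Metric.thickening r K) := Metric.isOpen_thickening
  have hKV : K ⊆ Metric.thickening r K := Metric.self_subset_thickening hr K
  have hVS := Metric.thickening_subset_cthickening r K
  have hst : ∀ z ∈ Metric.thickening r K, ∀ τ ∈ Set.Icc (0 : ℝ) 1,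
      ((1 - τ : ℝ) : ℂ) * z₀ + (τ : ℂ) * z ∈ Metric.thickening r K := fun z hz τ hτ => by
    have := (hKv.thickening r) (hKV hz₀) hz (sub_nonneg.mpr hτ.2) hτ.1 (by ring)
    simpa only [real_smul] using this
  obtain ⟨δ, hδ, Log, hLog⟩ := exists_log (A := A)
  obtain ⟨η, hη, hstep⟩ := exists_step (z₀ := z₀) hKc.cthickening hVS
    (hg.1.continuousOn.mono (Set.prod_mono hrU le_rfl))
    (fun z hz => hu z (hrU hz)) hst hδ
  obtain ⟨n, hn⟩ := exists_nat_one_div_lt hη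
  set N : ℝ := (n : ℝ) + 1 with hN
  have hNpos : 0 < N := by positivity
  have hτ : ∀ j : ℕ, j ≤ n + 1 → (j : ℝ) / N ∈ Set.Icc (0 : ℝ) 1 := fun j hj => by
    refine ⟨by positivity, (div_le_one hNpos).mpr ?_⟩
    rw [hN]
    exact_mod_cast hj
  let G : ℝ → ℂ × ℂ → A := fun τ p => g (((1 - τ : ℝ) : ℂ) * z₀ + (τ : ℂ) * p.1, p.2)
  have hG : ∀ τ ∈ Set.Icc (0 : ℝ) 1, Sol0 (Metric.thickening r K) (G τ) := fun τ hτ =>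
    (hg.affine _ _).mono fun z hz => hrU (hVS (hst z hz τ hτ))
  have hGu : ∀ τ ∈ Set.Icc (0 : ℝ) 1, ∀ z ∈ Metric.thickening r K, ∀ s : ℂ, ‖s‖ ≤ 1 →
      IsUnit (G τ (z, s)) := fun τ hτ z hz s hs => hu _ (hrU (hVS (hst z hz τ hτ))) s hs
  have key : ∀ j : ℕ, j ≤ n + 1 → Approx K (G (j / N)) := by
    intro j
    induction j with
    | zero =>
      intro _
      have h0 : ∀ z : ℂ, ((1 - ((0 : ℕ) / N) : ℝ) : ℂ) * z₀ + (((0 : ℕ) / N : ℝ) : ℂ) * z = z₀ :=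
        fun z => by simp
      refine approx_self ((hg.affine _ _).mono fun z _ => ?_) (fun z _ s hs => ?_)
        (hK.trans ball_quarter_subset)
      · rw [Set.mem_preimage, h0]
        exact hKU hz₀
      · simp only [G]
        rw [h0]
        exact hu _ (hKU hz₀) s hs
    | succ j ih =>
      intro hj
      have hj' := hτ j (by omega)
      have hj1 := hτ (j + 1) hj
      have hclose : |((j + 1 : ℕ) : ℝ) / N - j / N| < η := by
        have : ((j + 1 : ℕ) : ℝ) / N - j / N = 1 / N := by push_cast; ring
        rwa [this, abs_of_pos (by positivity)]
      have hlog := hstep _ hj1 _ hj' hclose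
      have hF : Sol0 (Metric.thickening r K)
          (fun p => G ((j + 1 : ℕ) / N) p * Ring.inverse (G (j / N) p)) :=
        (hG _ hj1).mul ((hG _ hj').inverse (hGu _ hj'))
      have hLF := hF.comp (Φ := Log) fun z hz s hs => (hLog _ (hlog z hz s hs)).1
      have hex : ∀ z ∈ Metric.thickening r K, ∀ s : ℂ, ‖s‖ ≤ 1 → NormedSpace.exp
          (Log (G ((j + 1 : ℕ) / N) (z, s) * Ring.inverse (G (j / N) (z, s)))) =
          G ((j + 1 : ℕ) / N) (z, s) * Ring.inverse (G (j / N) (z, s)) :=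
        fun z hz s hs => (hLog _ (hlog z hz s hs)).2
      refine ((approx_exp hK hR hVo hKV hLF).mul (ih (by omega)) hK hVo hKV
        (hLF.comp fun _ _ _ _ => contDiffAt_exp _).1).congr hVo hKV fun z hz s hs => ?_
      rw [hex z hz s hs, Ring.inverse_mul_cancel_right _ _ (hGu _ hj' z hz s hs)]
  refine (key (n + 1) le_rfl).congr hVo hKV fun z _ s _ => ?_
  have : ((n + 1 : ℕ) : ℝ) / N = 1 := by rw [hN]; push_cast; exact div_self hNpos.ne'
  simp only [G]
  rw [this]
  simp

end Contraction

section Gluing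
open scoped ENNReal
variable {A : Type*} [NormedRing A] [NormedAlgebra ℂ A] [CompleteSpace A]

/-- `u` is an invertible solution of `Lop u = B u + u D` over `U`. -/
def Twist (B D : ℂ × ℂ → A) (U : Set ℂ) (u : ℂ × ℂ → A) : Prop :=
  SmH U u ∧ ∀ z ∈ U, ∀ s : ℂ, ‖s‖ ≤ 1 →
    Lop u (z, s) = B (z, s) * u (z, s) + u (z, s) * D (z, s) ∧ IsUnit (u (z, s))

/-- The equation `Lop c = B c` has an invertible solution near `K`. -/
def Good (B : ℂ × ℂ → A) (K : Set ℂ) : Prop :=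
  ∃ O, IsOpen O ∧ K ⊆ O ∧ ∃ c, Twist B 0 O c

lemma Good.mono {B : ℂ × ℂ → A} {K K' : Set ℂ} (h : Good B K) (hK : K' ⊆ K) : Good B K' := by
  obtain ⟨O, hO, hKO, c, hc⟩ := h
  exact ⟨O, hO, hK.trans hKO, c, hc⟩

lemma Twist.mono {B D : ℂ × ℂ → A} {U V : Set ℂ} {u : ℂ × ℂ → A} (h : Twist B D U u)
    (hV : V ⊆ U) : Twist B D V u := ⟨h.1.mono hV, fun z hz => h.2 z (hV hz)⟩

lemma Twist.congr {B D : ℂ × ℂ → A} {U : Set ℂ} {u u' : ℂ × ℂ → A} (h : Twist B D U u)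
    (he : ∀ z ∈ U, ∀ s : ℂ, ‖s‖ ≤ 1 → u' =ᶠ[𝓝 (z, s)] u) : Twist B D U u' :=
  ⟨h.1.congr_of_eventuallyEq he, fun z hz s hs => by
    have h1 : Lop u' (z, s) = Lop u (z, s) := firstOrder_congr (he z hz s hs).fderiv_eq
    rw [h1, (he z hz s hs).eq_of_nhds]
    exact h.2 z hz s hs⟩

lemma Twist.union {B D : ℂ × ℂ → A} {U V : Set ℂ} {u : ℂ × ℂ → A} (h : Twist B D U u)
    (h' : Twist B D V u) : Twist B D (U ∪ V) u := by
  refine ⟨h.1.union h'.1, ?_⟩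
  rintro z (hz | hz) s hs
  · exact h.2 z hz s hs
  · exact h'.2 z hz s hs

lemma Twist.mul {B : ℂ × ℂ → A} {U : Set ℂ} {u v D D' : ℂ × ℂ → A} (h : Twist B D U u)
    (hv : SmH U v) (he : ∀ z ∈ U, ∀ s : ℂ, ‖s‖ ≤ 1 →
      D (z, s) * v (z, s) + Lop v (z, s) = v (z, s) * D' (z, s) ∧ IsUnit (v (z, s))) :
    Twist B D' U (fun p => u p * v p) :=
  ⟨h.1.mul hv, fun z hz s hs => by
    obtain ⟨h1, h2⟩ := h.2 z hz s hs
    obtain ⟨h3, h4⟩ := he z hz s hs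
    refine ⟨?_, h2.mul h4⟩
    unfold Lop at *
    rw [firstOrder_mul (h.1.diff hz hs) (hv.diff hz hs), h1, mul_assoc, ← h3]
    noncomm_ring⟩

lemma Twist.inverse_mul {B : ℂ × ℂ → A} {U : Set ℂ} {u v : ℂ × ℂ → A} (hU : IsOpen U)
    (h : Twist B 0 U u) (h' : Twist B 0 U v) : Sol0 U (fun p => Ring.inverse (u p) * v p) := by
  have hi : SmH U (fun p => Ring.inverse (u p)) := h.1.inverse fun z hz s hs => (h.2 z hz s hs).2
  refine ⟨hi.mul h'.1, fun z hz s hs => ?_⟩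
  obtain ⟨h1, h2⟩ := h.2 z hz s hs
  obtain ⟨h3, -⟩ := h'.2 z hz s hs
  simp only [Pi.zero_apply, mul_zero, add_zero] at h1 h3
  have h4 : Lop (fun p => u p * Ring.inverse (u p)) (z, s) = 0 := by
    rw [Lop_eq_of_eqOn (u' := fun _ => 1) hU hz hs ((h.1.mul hi).diff hz hs)
      (differentiableAt_const _) fun z hz s hs => Ring.mul_inverse_cancel _ (h.2 z hz s hs).2]
    exact firstOrder_const _
  unfold Lop at *
  rw [firstOrder_mul (h.1.diff hz hs) (hi.diff hz hs), h1, mul_assoc,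
    Ring.mul_inverse_cancel _ h2, mul_one] at h4
  have h5 := congrArg (fun x => Ring.inverse (u (z, s)) * x) h4
  simp only [mul_add, ← mul_assoc, Ring.inverse_mul_cancel _ h2, one_mul, mul_zero] at h5
  rw [firstOrder_mul (hi.diff hz hs) (h'.1.diff hz hs), h3, ← mul_assoc, ← add_mul, add_comm, h5,
    zero_mul]

lemma smH_ofReal {κ : ℂ → ℝ} (hκ : ContDiff ℝ (⊤ : ℕ∞) κ) (U : Set ℂ) :
    SmH U (fun p => (κ p.1 : ℂ)) :=
  SmH.of_fst (contDiff_ofReal_comp hκ)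

lemma ball_quarter_subset_Qs : Metric.ball (0 : ℂ) (1 / 4) ⊆ Qs := fun z hz =>
  mem_Qs (by rw [mem_ball_zero_iff] at hz; linarith)

variable [NormOneClass A]

lemma isUnit_one_add_of_norm_lt {x : A} (h : ‖x‖ < 1) : IsUnit (1 + x) := by
  rw [← sub_neg_eq_add]
  exact isUnit_one_sub_of_norm_lt_one (by rwa [norm_neg])

lemma Bd.inverse_one_add {f : ℂ × ℂ → A} (h : Bd f (1 / 2)) :
    Bd (fun p => Ring.inverse (1 + f p)) 2 := by
  have hs : ∑' k : ℕ, (1 / 2 : ℝ≥0∞) ^ k = 2 := by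
    rw [ENNReal.tsum_geometric]
    simp
  rw [← hs]
  refine Bd.tsum (F := fun k p => (-f p) ^ k) (fun k => h.neg.pow k) (by rw [hs]; simp)
    fun z hz s hs => ?_
  have h1 : ‖f (z, s)‖ < 1 := by
    have := h.norm_le hz hs
    rw [← ofReal_norm, ENNReal.ofReal_le_iff_le_toReal (by simp)] at this
    norm_num at this
    linarith
  have h2 : ‖-f (z, s)‖ < 1 := by rwa [norm_neg]
  have h3 : Ring.inverse (1 + f (z, s)) = ∑' k : ℕ, (-f (z, s)) ^ k := by
    rw [geom_series_eq_inverse _ h2, sub_neg_eq_add]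
  rw [h3]
  exact (summable_geometric_of_norm_lt_one h2).hasSum

/-- Removing a small right-hand twist. -/
lemma exists_untwist : ∃ ε₁ : ℝ≥0∞, ε₁ ≠ 0 ∧ ∀ (B D : ℂ × ℂ → A) (U : Set ℂ) (u : ℂ × ℂ → A),
    Twist B D U u → U ⊆ Metric.ball 0 (1 / 4) → SmH Set.univ D →
    (∀ z s : ℂ, 3 / 8 < ‖z‖ → D (z, s) = 0) → Bd D ε₁ → ∃ c, Twist B 0 U c := by
  obtain ⟨C, ε₀, hC, hε₀, hsolve⟩ := exists_solve (A := A)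
  obtain ⟨ε, hε, h1⟩ := ENNReal.exists_nnreal_pos_mul_lt hC one_ne_zero
  refine ⟨min ε ε₀, by simp [hε₀.ne', hε.ne'], fun B D U u hu hU hD hD0 hb => ?_⟩
  have hD' : SmH Set.univ (fun p => -D p) := by
    simpa using (SmH.const (0 : A)).sub hD
  have hD0' : ∀ z s : ℂ, 3 / 8 < ‖z‖ → -D (z, s) = 0 := fun z s hz => by rw [hD0 z s hz, neg_zero]
  obtain ⟨v, hv, hLv, hvb⟩ := hsolve _ _ hD' hD' hD0' hD0' (hb.neg.mono (min_le_right _ _)) _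
    (hb.neg.mono (min_le_left _ _))
  have h1v : SmH U (fun p => 1 + v p) := ((SmH.const 1).add hv).mono (Set.subset_univ _)
  refine ⟨_, hu.mul h1v fun z hz s hs => ⟨?_, isUnit_one_add_of_norm_lt ?_⟩⟩
  · have h2 := hLv z (hU hz) s hs
    have h3 : Lop (fun p => 1 + v p) (z, s) = Lop v (z, s) := by
      unfold Lop
      rw [firstOrder_add (differentiableAt_const _) (hv.diff (Set.mem_univ _) hs),
        firstOrder_const, zero_add]
    rw [h3, h2, Pi.zero_apply]
    noncomm_ring
  · have h2 := (hvb z (ball_quarter_subset_Qs (hU hz)) s hs).trans_lt ((mul_comm _ _).trans_lt h1)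
    rwa [← ofReal_norm, ENNReal.ofReal_lt_one] at h2

theorem Good.union {B : ℂ × ℂ → A} {K₁ K₂ : Set ℂ} (hK1 : IsClosed K₁) (hK2 : IsClosed K₂)
    (hb1 : K₁ ⊆ Metric.ball 0 (1 / 4)) (hb2 : K₂ ⊆ Metric.ball 0 (1 / 4))
    (happ : ∀ (U : Set ℂ) (g : ℂ × ℂ → A), IsOpen U → K₁ ∩ K₂ ⊆ U → Sol0 U g →
      (∀ z ∈ U, ∀ s : ℂ, ‖s‖ ≤ 1 → IsUnit (g (z, s))) → Approx (K₁ ∩ K₂) g)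
    (h1 : Good B K₁) (h2 : Good B K₂) : Good B (K₁ ∪ K₂) := by
  obtain ⟨O₁, hO1, hKO1, c₁, hc1⟩ := h1
  obtain ⟨O₂, hO2, hKO2, c₂, hc2⟩ := h2
  set g : ℂ × ℂ → A := fun p => Ring.inverse (c₁ p) * c₂ p with hg_def
  have hO12 := hO1.inter hO2
  have hg : Sol0 (O₁ ∩ O₂) g :=
    (hc1.mono Set.inter_subset_left).inverse_mul hO12 (hc2.mono Set.inter_subset_right)
  have hgu : ∀ z ∈ O₁ ∩ O₂, ∀ s : ℂ, ‖s‖ ≤ 1 → IsUnit (g (z, s)) := fun z hz s hs =>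
    (isUnit_inverse (hc1.2 z hz.1 s hs).2).mul (hc2.2 z hz.2 s hs).2
  have hK12 : K₁ ∩ K₂ ⊆ O₁ ∩ O₂ := Set.inter_subset_inter hKO1 hKO2
  obtain ⟨O, hO, hKO, hap⟩ := happ _ g hO12 hK12 hg hgu
  obtain ⟨κ, χ, hκ, hχ, hκ1, hχU, U₀, N₁, N₂, hU₀, hN1, hN2, hU₀U, hKN1, hKN2, hχ1, h01, h02⟩ :=
    exists_splitting hK1 hK2 ((hO.inter hO12).inter Metric.isOpen_ball)
      (Set.subset_inter (Set.subset_inter hKO hK12) (Set.inter_subset_left.trans hb1))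
  obtain ⟨χ₁, hχ1s, hχ11, hχ1U, O', hO', hχO', hO'U, hχ1O'⟩ := exists_cutoff (isClosed_tsupport χ)
    ((hO.inter hO12).inter Metric.isOpen_ball) hχU
  have hχ0 : ∀ z : ℂ, 3 / 8 < ‖z‖ → χ z = 0 := fun z hz =>
    image_eq_zero_of_notMem_tsupport fun h => by
      have := (hχU h).2
      rw [mem_ball_zero_iff] at this
      linarith
  obtain ⟨ε₁, hε1, huntwist⟩ := exists_untwist (A := A)
  obtain ⟨a, ha, hba⟩ := bd_cutoff (smH_ofReal hκ Set.univ) hχ1s (Set.subset_univ _)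
    (hχ1U.trans Set.inter_subset_right)
  obtain ⟨b, hb, hbb⟩ := bd_cutoff (smH_Lfst hκ Set.univ) hχ (Set.subset_univ _)
    (hχU.trans Set.inter_subset_right)
  obtain ⟨ε, hε, hεlt⟩ := ENNReal.exists_nnreal_pos_mul_lt
    (a := ENNReal.ofReal a + ENNReal.ofReal b * 2) (b := min (1 / 2) ε₁)
    (ENNReal.add_ne_top.mpr ⟨by simp, ENNReal.mul_ne_top (by simp) (by simp)⟩)
    (by simp [hε1])
  have hεa : ENNReal.ofReal a * ε ≤ 1 / 2 := by
    refine le_trans ?_ (hεlt.le.trans (min_le_left _ _))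
    rw [mul_comm]
    gcongr
    exact le_self_add
  have hεb : ENNReal.ofReal b * (2 * ε) ≤ ε₁ := by
    refine le_trans ?_ (hεlt.le.trans (min_le_right _ _))
    rw [← mul_assoc, mul_comm]
    gcongr
    exact le_add_self
  obtain ⟨h, hh, hhu, hbh⟩ := hap χ₁ hχ1s (fun z hz => (hχ1U hz).1.1) ε (by exact_mod_cast hε.ne')
  set w : ℂ × ℂ → A := fun p => g p * Ring.inverse (h p) - 1 with hw_def
  have hball : ∀ {z : ℂ}, z ∈ Metric.ball (0 : ℂ) (1 / 4) → z ∈ Metric.ball (0 : ℂ) 1 :=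
    fun hz => ball_quarter_subset hz
  have hhi := hh.inverse hhu
  have hw : Sol0 ((O ∩ (O₁ ∩ O₂)) ∩ Metric.ball 0 (1 / 4)) w :=
    ((hg.mono fun z hz => hz.1.2).mul (hhi.mono fun z hz => hball hz.2)).sub
      ⟨SmH.const 1, fun _ _ _ _ => firstOrder_const _⟩
  set y : ℂ × ℂ → A := fun p => ((χ₁ p.1 : ℂ) • (κ p.1 : ℂ)) • ((χ₁ p.1 : ℂ) • w p) with hy_def
  have hy : SmH Set.univ y :=
    ((smH_ofReal hκ Set.univ).cutoff hχ1s (Set.subset_univ _)).smul (hw.1.cutoff hχ1s hχ1U)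
  have hby : Bd y (1 / 2) := (hba.smul hbh).mono hεa
  set e : ℂ × ℂ → A := fun p => 1 + y p with he_def
  have he : SmH Set.univ e := (SmH.const 1).add hy
  have heu : ∀ z ∈ Metric.ball (0 : ℂ) (1 / 4), ∀ s : ℂ, ‖s‖ ≤ 1 → IsUnit (e (z, s)) :=
    fun z hz s hs => isUnit_one_add_of_norm_lt (by
      have := hby.norm_le (ball_quarter_subset_Qs hz) hs
      rw [← ofReal_norm, ENNReal.ofReal_le_iff_le_toReal (by simp)] at this
      norm_num at this
      linarith)
  set D : ℂ × ℂ → A := fun p =>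
    (χ p.1 : ℂ) • (Lfst κ p • (Ring.inverse (e p) * ((χ₁ p.1 : ℂ) • w p))) with hD_def
  have hD : SmH Set.univ D :=
    ((smH_Lfst hκ _).smul (((he.mono (Set.subset_univ _)).inverse heu).mul
      ((hw.1.cutoff hχ1s hχ1U).mono (Set.subset_univ _)))).cutoff hχ
      (hχU.trans Set.inter_subset_right)
  have hbD : Bd D ε₁ := ((hbb.smul (hby.inverse_one_add.mul hbh)).mono hεb).congr
    fun z _ s _ => (smul_assoc _ _ _).symm
  have hU0e : ∀ z ∈ U₀, ∀ s, e (z, s) = 1 + (κ z : ℂ) • w (z, s) := fun z hz s => by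
    have : χ₁ z = 1 := hχ1O' z (hχO' (subset_closure (by simp [hχ1 z hz])))
    simp [he_def, hy_def, this]
  have hN1e : ∀ z ∈ N₁, ∀ s, e (z, s) = 1 := fun z hz s => by
    simp [he_def, hy_def, h01 z hz]
  have hdis : ∀ z ∈ N₁, z ∉ N₂ := fun z h1 h2 => by
    have := h01 z h1
    rw [h02 z h2] at this
    exact one_ne_zero this
  have hLe0 : ∀ z ∈ U₀, ∀ s : ℂ, ‖s‖ ≤ 1 → Lop e (z, s) = Lfst κ (z, s) • w (z, s) := by
    intro z hz s hs
    have hwz := hw.1.diff (hU₀U hz) hs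
    have hκw : DifferentiableAt ℝ (fun p : ℂ × ℂ => (κ p.1 : ℂ) • w p) (z, s) :=
      ((smH_ofReal hκ _).smul hw.1).diff (hU₀U hz) hs
    rw [Lop_eq_of_open (v := fun p => 1 + (κ p.1 : ℂ) • w p) hU₀ hz hU0e]
    have h3 : Lop (fun p => 1 + (κ p.1 : ℂ) • w p) (z, s) =
        Lop (fun p => (κ p.1 : ℂ) • w p) (z, s) := by
      unfold Lop
      rw [firstOrder_add (differentiableAt_const _) hκw, firstOrder_const, zero_add]
    rw [h3, Lop_fst_smul hκ hwz, hw.2 z (hU₀U hz) s hs, smul_zero, add_zero]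
  have hLe1 : ∀ z ∈ N₁, ∀ s : ℂ, Lop e (z, s) = 0 := fun z hz s => by
    rw [Lop_eq_of_open (v := fun _ => 1) hN1 hz hN1e]
    exact firstOrder_const _
  set W₁ : Set ℂ := (U₀ ∪ (N₁ ∩ O₁)) ∩ Metric.ball 0 (1 / 4) with hW1
  set W₂ : Set ℂ := (N₂ ∩ O₂) ∩ Metric.ball 0 (1 / 4) with hW2
  have hW1o : IsOpen W₁ := (hU₀.union (hN1.inter hO1)).inter Metric.isOpen_ball
  have hW2o : IsOpen W₂ := (hN2.inter hO2).inter Metric.isOpen_ball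
  have hW1O : W₁ ⊆ O₁ := by
    rintro z ⟨hz | hz, -⟩
    · exact (hU₀U hz).1.2.1
    · exact hz.2
  have hT1 : Twist B D W₁ (fun p => c₁ p * e p) := by
    refine (hc1.mono hW1O).mul (he.mono (Set.subset_univ _)) fun z hz s hs =>
      ⟨?_, heu z hz.2 s hs⟩
    rw [Pi.zero_apply, zero_mul, zero_add]
    rcases hz.1 with hz0 | hz1
    · have : χ₁ z = 1 := hχ1O' z (hχO' (subset_closure (by simp [hχ1 z hz0])))
      simp only [hD_def, this, hχ1 z hz0, ofReal_one, one_smul]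
      rw [hLe0 z hz0 s hs, mul_smul_comm, Ring.mul_inverse_cancel_left _ _ (heu z hz.2 s hs)]
    · simp only [hD_def]
      rw [hLe1 z hz1.1 s, Lfst_eq_zero hN1 h01 hz1.1 s, zero_smul, smul_zero, mul_zero]
  have hT2 : Twist B D W₂ (fun p => c₂ p * Ring.inverse (h p)) := by
    refine (hc2.mono fun z hz => hz.1.2).mul (hhi.1.mono fun z hz => hball hz.2)
      fun z hz s hs => ⟨?_, isUnit_inverse (hhu z (hball hz.2) s hs)⟩
    simp only [hD_def]
    rw [Pi.zero_apply, zero_mul, zero_add, hhi.2 z (hball hz.2) s hs,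
      Lfst_eq_zero hN2 h02 hz.1.1 s, zero_smul, smul_zero, mul_zero]
  classical
  set T : ℂ × ℂ → A := fun p => if p.1 ∈ N₂ then c₂ p * Ring.inverse (h p) else c₁ p * e p
    with hT_def
  have hT2' : Twist B D W₂ T := hT2.congr fun z hz s _ => by
    filter_upwards [(hW2o.preimage continuous_fst).mem_nhds (show (z, s).1 ∈ W₂ from hz)] with q hq
    simp [hT_def, show q.1 ∈ N₂ from hq.1.1]
  have hT1' : Twist B D W₁ T := hT1.congr fun z hz s hs => by
    have hcont := (hc1.1.contDiffAt (hW1O hz) hs).continuousAt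
    filter_upwards [(hW1o.preimage continuous_fst).mem_nhds (show (z, s).1 ∈ W₁ from hz),
      hcont.eventually_mem (Units.isOpen.mem_nhds (hc1.2 z (hW1O hz) s hs).2)] with q hq hqu
    by_cases hq2 : q.1 ∈ N₂
    · rcases hq.1 with hq0 | hq1
      · simp only [hT_def, hq2, if_true]
        rw [show e q = _ from hU0e q.1 hq0 q.2, h02 _ hq2]
        simp only [hw_def, hg_def, ofReal_one, one_smul, add_sub_cancel]
        rw [mul_assoc, Ring.mul_inverse_cancel_left _ _ hqu]
      · exact absurd hq2 (hdis _ hq1.1)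
    · simp [hT_def, hq2]
  obtain ⟨c, hc⟩ := huntwist B D (W₁ ∪ W₂) T (hT1'.union hT2')
    (Set.union_subset Set.inter_subset_right Set.inter_subset_right) hD
    (fun z s hz => by simp [hD_def, hχ0 z hz]) hbD
  refine ⟨W₁ ∪ W₂, hW1o.union hW2o, ?_, c, hc⟩
  rintro z (hz | hz)
  · left
    refine ⟨?_, hb1 hz⟩
    rcases hKN1 hz with h | h
    · exact Or.inl h
    · exact Or.inr ⟨h, hKO1 hz⟩
  · rcases hKN2 hz with h | h
    · exact Or.inl ⟨Or.inl h, hb2 hz⟩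
    · exact Or.inr ⟨⟨h, hKO2 hz⟩, hb2 hz⟩

end Gluing

section Covering
open scoped ENNReal
variable {E : Type*} [NormedAddCommGroup E] [NormedSpace ℂ E] [CompleteSpace E]
variable {A : Type*} [NormedRing A] [NormedAlgebra ℂ A] [CompleteSpace A]

/-- Coefficient bounds of dilates are uniform. -/
lemma exists_bd_dilate {B : ℂ × ℂ → E} (hB : SmH Set.univ B) {χ : ℂ → ℝ}
    (hχ : ContDiff ℝ (⊤ : ℕ∞) χ) (hχs : tsupport χ ⊆ Metric.ball 0 (1 / 4)) (z₀ : ℂ) :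
    ∃ ν : ℝ≥0∞, ν ≠ ∞ ∧ ∀ r : ℝ, 0 ≤ r → r ≤ 1 →
      Bd (fun p => (χ p.1 : ℂ) • B (z₀ + (r : ℂ) * p.1, p.2)) ν := by
  set f : ℝ → ℂ × ℂ → E := fun a p =>
    (χ p.1 : ℂ) • B (z₀ + (Real.sin (2 * Real.pi * a) : ℂ) * p.1, p.2) with hf
  have hχ0 : ∀ z : ℂ, 3 / 8 < ‖z‖ → χ z = 0 := fun z hz =>
    image_eq_zero_of_notMem_tsupport fun h => by
      have := hχs h
      rw [mem_ball_zero_iff] at this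
      linarith
  have hχc : ContDiff ℝ (⊤ : ℕ∞) fun q : ℝ × (ℂ × ℂ) => ((χ q.2.1 : ℝ) : ℂ) :=
    (contDiff_ofReal_comp hχ).comp (contDiff_fst.comp contDiff_snd)
  have hsin : ContDiff ℝ (⊤ : ℕ∞)
      fun q : ℝ × (ℂ × ℂ) => ((Real.sin (2 * Real.pi * q.1) : ℝ) : ℂ) :=
    ofRealCLM.contDiff.comp (Real.contDiff_sin.comp (contDiff_const.mul contDiff_fst))
  have hm : ContDiff ℝ (⊤ : ℕ∞) fun q : ℝ × (ℂ × ℂ) =>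
      (z₀ + ((Real.sin (2 * Real.pi * q.1) : ℝ) : ℂ) * q.2.1, q.2.2) :=
    (contDiff_const.add (hsin.mul (contDiff_fst.comp contDiff_snd))).prodMk
      (contDiff_snd.comp contDiff_snd)
  obtain ⟨V, h1, h2⟩ := exists_expansion (f := f)
    (fun a z s hs => hχc.contDiffAt.smul (ContDiffAt.comp (g := B)
      (f := fun q : ℝ × (ℂ × ℂ) =>
        (z₀ + ((Real.sin (2 * Real.pi * q.1) : ℝ) : ℂ) * q.2.1, q.2.2)) (a, (z, s))
      (hB.contDiffAt (Set.mem_univ _) hs) hm.contDiffAt))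
    (fun a => (smH_ofReal hχ _).smul (hB.affine _ _)) (fun a z s hz => by simp [hf, hχ0 z hz])
    (fun a => by
      have : 2 * Real.pi * (a + 1) = 2 * Real.pi * a + 2 * Real.pi := by ring
      simp only [hf, this, Real.sin_add_two_pi])
  refine ⟨∑' j : ℤ × Idx, ‖V j.1 j.2‖ₑ, by simpa using h1 0, fun r hr hr1 => ?_⟩
  set a : ℝ := Real.arcsin r / (2 * Real.pi) with ha
  have hsa : Real.sin (2 * Real.pi * a) = r := by
    rw [ha, mul_div_cancel₀ _ (by positivity), Real.sin_arcsin (by linarith) hr1]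
  have hl : ∑' j : ℤ × Idx, ‖ex (j.1 * a) • V j.1 j.2‖ₑ = ∑' j : ℤ × Idx, ‖V j.1 j.2‖ₑ := by
    refine tsum_congr fun j => ?_
    rw [← ofReal_norm, norm_smul, norm_ex, one_mul, ofReal_norm]
  have hle : l1 (push (fun j : ℤ × Idx => j.2) fun j => ex (j.1 * a) • V j.1 j.2) ≤
      ∑' j : ℤ × Idx, ‖V j.1 j.2‖ₑ := by
    rw [← hl]
    simpa [l1] using tsum_push_le (fun j : ℤ × Idx => j.2)
      (fun j => ex (j.1 * a) • V j.1 j.2) fun _ => 1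
  have hne : ∑' j : ℤ × Idx, ‖V j.1 j.2‖ₑ ≠ ∞ := by simpa using h1 0
  refine ⟨_, hle, ne_top_of_le_ne_top hne hle, fun z hz s hs => ?_⟩
  refine hasSum_push (g := fun n => em n (z, s)) ?_ ?_
  · rw [← hl] at hne
    simpa using hne
  · have := h2 a z hz s hs
    simp only [hf, hsa] at this
    refine this.congr_fun fun j => ?_
    rw [smul_smul, mul_comm]

lemma Good.affine {B : ℂ × ℂ → A} {K : Set ℂ} (a : ℂ) {l : ℝ} (hl : l ≠ 0)
    (h : Good (fun p => (l : ℂ) • B (a + (l : ℂ) * p.1, p.2)) ((fun z => a + (l : ℂ) * z) ⁻¹' K)) :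
    Good B K := by
  obtain ⟨O, hO, hKO, c, hc, hc'⟩ := h
  have hlc : (l : ℂ) ≠ 0 := by exact_mod_cast hl
  have hinv : ∀ z : ℂ, a + (l : ℂ) * (-a / l + ((l⁻¹ : ℝ) : ℂ) * z) = z := fun z => by
    push_cast
    field_simp
    ring
  refine ⟨(fun z => -a / l + ((l⁻¹ : ℝ) : ℂ) * z) ⁻¹' O, hO.preimage (by fun_prop), fun z hz =>
    hKO (by rwa [Set.mem_preimage, hinv]), _, hc.affine (-a / l) ((l⁻¹ : ℝ) : ℂ),
    fun z hz s hs => ?_⟩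
  obtain ⟨h1, h2⟩ := hc' _ hz s hs
  refine ⟨?_, h2⟩
  rw [Lop_affine hc _ _ hz hs, h1]
  simp only [Pi.zero_apply, mul_zero, add_zero]
  rw [hinv, smul_mul_assoc, smul_smul, ofReal_inv, inv_mul_cancel₀ hlc, one_smul]

lemma Twist.congr_left {B B' : ℂ × ℂ → A} {U : Set ℂ} {u : ℂ × ℂ → A} (h : Twist B 0 U u)
    (he : ∀ z ∈ U, ∀ s : ℂ, ‖s‖ ≤ 1 → B' (z, s) = B (z, s)) : Twist B' 0 U u :=
  ⟨h.1, fun z hz s hs => by rw [he z hz s hs]; exact h.2 z hz s hs⟩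

lemma good_empty (B : ℂ × ℂ → A) : Good B ∅ :=
  ⟨∅, isOpen_empty, subset_rfl, 0, fun z hz => absurd hz (Set.notMem_empty z),
    fun z hz => absurd hz (Set.notMem_empty z)⟩

variable [NormOneClass A]

lemma exists_good_ball {B : ℂ × ℂ → A} (hB : SmH Set.univ B) (z₀ : ℂ) :
    ∃ r > 0, Good B (Metric.ball z₀ r) := by
  obtain ⟨χ, hχ, -, hχs, O, hO, hKO, -, hχ1⟩ := exists_cutoff
    (Metric.isClosed_closedBall (x := (0 : ℂ)) (ε := 1 / 8)) Metric.isOpen_ball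
    (Metric.closedBall_subset_ball (show (1 / 8 : ℝ) < 1 / 4 by norm_num))
  obtain ⟨ν, hν, hb⟩ := exists_bd_dilate hB hχ hχs z₀
  obtain ⟨ε₁, hε1, huntwist⟩ := exists_untwist (A := A)
  obtain ⟨l, hl, hlt⟩ := ENNReal.exists_nnreal_pos_mul_lt hν hε1
  set r : ℝ := min l 1 with hr_def
  have hr : 0 < r := lt_min hl one_pos
  have hr1 : r ≤ 1 := min_le_right _ _
  set D : ℂ × ℂ → A := fun p => (-(r : ℂ)) • (χ p.1 : ℂ) • B (z₀ + (r : ℂ) * p.1, p.2) with hD_def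
  have hD : SmH Set.univ D :=
    (SmH.const (-(r : ℂ))).smul ((smH_ofReal hχ _).smul (hB.affine z₀ r))
  have hbD : Bd D ε₁ := ((hb r hr.le hr1).const_smul (-(r : ℂ))).mono (by
    refine le_trans ?_ hlt.le
    gcongr
    rw [← ofReal_norm, norm_neg, norm_real, Real.norm_eq_abs, abs_of_pos hr, hr_def]
    exact ENNReal.ofReal_le_of_le_toReal (min_le_left _ _))
  have hD0 : ∀ z s : ℂ, 3 / 8 < ‖z‖ → D (z, s) = 0 := fun z s hz => by
    have : χ z = 0 := image_eq_zero_of_notMem_tsupport fun h => by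
      have := hχs h
      rw [mem_ball_zero_iff] at this
      linarith
    simp [hD_def, this]
  obtain ⟨c, hc⟩ := huntwist (fun p => -D p) D (Metric.ball 0 (1 / 4)) (fun _ => 1)
    ⟨SmH.const 1, fun z _ s _ => ⟨by simp [Lop, firstOrder_const], isUnit_one⟩⟩ subset_rfl hD hD0
    hbD
  refine ⟨r / 8, by positivity, Good.affine z₀ hr.ne' ⟨O ∩ Metric.ball 0 (1 / 4),
    hO.inter Metric.isOpen_ball, fun z hz => ?_, c,
    (hc.mono Set.inter_subset_right).congr_left fun z hz s _ => ?_⟩⟩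
  · have h1 : ‖z‖ < 1 / 8 := by
      rw [Set.mem_preimage, mem_ball_iff_norm, add_sub_cancel_left, norm_mul, norm_real,
        Real.norm_eq_abs, abs_of_pos hr] at hz
      by_contra! h
      nlinarith
    exact ⟨hKO (mem_closedBall_zero_iff.mpr h1.le), mem_ball_zero_iff.mpr (by linarith)⟩
  · simp [hD_def, hχ1 z hz.1]

variable (A) in
/-- Compact convex sets near the origin on which homogeneous solutions can be approximated. -/
def Cell (K : Set ℂ) : Prop :=
  IsCompact K ∧ Convex ℝ K ∧ K ⊆ Metric.ball 0 (1 / 4) ∧ Runge A K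

lemma Cell.inter {K K' : Set ℂ} (h : Cell A K) (h' : Cell A K') : Cell A (K ∩ K') :=
  ⟨h.1.inter h'.1, h.2.1.inter h'.2.1, Set.inter_subset_left.trans h.2.2.1,
    h.2.2.2.inter h.1.isClosed h'.1.isClosed h.2.2.1 h'.2.2.1 h'.2.2.2⟩

lemma cell_closedBall {z₀ : ℂ} {r : ℝ} (hr : 0 < r) (h : ‖z₀‖ + r < 1 / 4) :
    Cell A (Metric.closedBall z₀ r) := by
  have h1 : Metric.closedBall z₀ r ⊆ Metric.ball 0 (1 / 4) := fun z hz => by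
    rw [mem_closedBall_iff_norm] at hz
    rw [mem_ball_zero_iff]
    have := norm_sub_norm_le z z₀
    linarith
  exact ⟨isCompact_closedBall _ _, convex_closedBall _ _, h1, runge_disc hr h1⟩

lemma Good.union_cell {B : ℂ × ℂ → A} {K₁ K₂ : Set ℂ} (hK1 : Cell A K₁) (hK2 : Cell A K₂)
    (h1 : Good B K₁) (h2 : Good B K₂) : Good B (K₁ ∪ K₂) :=
  h1.union hK1.1.isClosed hK2.1.isClosed hK1.2.2.1 hK2.2.2.1 (fun _ _ hU hKU hg hu =>
    have h := hK1.inter hK2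
    approx_of_convex h.1 h.2.1 h.2.2.1 h.2.2.2 hU hKU hg hu) h2

/-- A rotated rectangle. -/
def Rect (e a : ℂ) (s t : ℝ) : Set ℂ := {z | |(e * (z - a)).re| ≤ s ∧ |(e * (z - a)).im| ≤ t}

/-- All cells of a fixed small disc inside `s × t` rectangles are good. -/
def GoodRect (B : ℂ × ℂ → A) (e : ℂ) (s t : ℝ) : Prop :=
  ∀ K a, Cell A K → K ⊆ Metric.closedBall 0 (1 / 200) → K ⊆ Rect e a s t → Good B K

lemma exists_half_cell {B : ℂ × ℂ → A} {e : ℂ} (he : ‖e‖ = 1) {s t : ℝ} (hs : 0 < s)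
    (hs1 : s ≤ 1 / 100) (ht1 : t ≤ 1 / 50) (hst : t ^ 2 ≤ 4 / 25 * s)
    (h : GoodRect B e s t) {K : Set ℂ} {a : ℂ} (hK : Cell A K)
    (hKT : K ⊆ Metric.closedBall 0 (1 / 200)) (hKR : K ⊆ Rect e a (6 / 5 * s) t) :
    ∃ K' ⊆ K, Cell A K' ∧ Good B K' ∧ ∀ z ∈ K, (e * (z - a)).re ≤ 0 → z ∈ K' := by
  rcases K.eq_empty_or_nonempty with rfl | ⟨z₀, hz₀⟩
  · exact ⟨∅, subset_rfl, hK, good_empty B, fun z hz => absurd hz (Set.notMem_empty z)⟩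
  have he0 : e ≠ 0 := norm_ne_zero_iff.mp (by rw [he]; exact one_ne_zero)
  have ha : ‖a‖ ≤ 1 / 200 + (6 / 5 * s + t) := by
    have h1 := hKR hz₀
    have h2 := mem_closedBall_zero_iff.mp (hKT hz₀)
    have h3 : ‖z₀ - a‖ ≤ 6 / 5 * s + t := by
      have := norm_le_abs_re_add_abs_im (e * (z₀ - a))
      rw [norm_mul, he, one_mul] at this
      exact this.trans (add_le_add h1.1 h1.2)
    have h4 := norm_sub_norm_le a z₀
    rw [norm_sub_rev] at h4
    linarith
  have hmem : ∀ z, z ∈ Metric.closedBall (a - 1 / 10 * e⁻¹) (1 / 10 + 4 / 5 * s) ↔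
      ‖e * (z - a) + (1 / 10 : ℝ)‖ ≤ 1 / 10 + 4 / 5 * s := fun z => by
    have h1 : ‖z - (a - 1 / 10 * e⁻¹)‖ = ‖e * (z - (a - 1 / 10 * e⁻¹))‖ := by
      rw [norm_mul, he, one_mul]
    have : e * (z - (a - 1 / 10 * e⁻¹)) = e * (z - a) + (1 / 10 : ℝ) := by
      push_cast
      field_simp
      ring
    rw [mem_closedBall_iff_norm, h1, this]
  have hD : Cell A (Metric.closedBall (a - 1 / 10 * e⁻¹) (1 / 10 + 4 / 5 * s)) := by
    refine cell_closedBall (by positivity) ?_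
    have h1 : ‖a - 1 / 10 * e⁻¹‖ ≤ ‖a‖ + 1 / 10 := by
      refine (norm_sub_le _ _).trans (by simp [he])
    linarith
  refine ⟨K ∩ Metric.closedBall (a - 1 / 10 * e⁻¹) (1 / 10 + 4 / 5 * s), Set.inter_subset_left,
    hK.inter hD, h _ (a - (s / 5 : ℝ) * e⁻¹) (hK.inter hD) (Set.inter_subset_left.trans hKT) ?_,
    fun z hz hre => ⟨hz, (hmem z).mpr ?_⟩⟩
  · rintro z ⟨hz, hzD⟩
    rw [hmem] at hzD
    obtain ⟨h1, h2⟩ := hKR hz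
    have h3 : e * (z - (a - (s / 5 : ℝ) * e⁻¹)) = e * (z - a) + (s / 5 : ℝ) := by
      field_simp
      ring
    have h4 := (le_abs_self _).trans ((abs_re_le_norm _).trans hzD)
    rw [add_re, ofReal_re] at h4
    rw [abs_le] at h1
    refine ⟨?_, ?_⟩
    · rw [h3, add_re, ofReal_re, abs_le]
      constructor <;> linarith [h1.1]
    · rw [h3, add_im, ofReal_im, add_zero]
      exact h2
  · obtain ⟨h1, h2⟩ := hKR hz
    rw [abs_le] at h1
    have h3 : (e * (z - a)).im ^ 2 ≤ t ^ 2 := sq_le_sq' (abs_le.mp h2).1 (abs_le.mp h2).2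
    refine abs_le_of_sq_le_sq' ?_ (by positivity) |>.2
    rw [← normSq_eq_norm_sq, normSq_apply, add_re, add_im, ofReal_re, ofReal_im]
    nlinarith [h1.1]

lemma GoodRect.step {B : ℂ × ℂ → A} {e : ℂ} (he : ‖e‖ = 1) {s t : ℝ} (hs : 0 < s)
    (hs1 : s ≤ 1 / 100) (ht1 : t ≤ 1 / 50) (hst : t ^ 2 ≤ 4 / 25 * s)
    (h : GoodRect B e s t) : GoodRect B e (6 / 5 * s) t := by
  have hneg : ∀ (a : ℂ) (s t : ℝ), Rect (-e) a s t = Rect e a s t := fun a s t => by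
    ext z
    simp only [Rect, Set.mem_ofPred_eq, neg_mul, neg_re, neg_im, abs_neg]
  intro K a hK hKT hKR
  obtain ⟨K₁, hK1, hc1, hg1, h1⟩ := exists_half_cell he hs hs1 ht1 hst h hK hKT hKR
  obtain ⟨K₂, hK2, hc2, hg2, h2⟩ := exists_half_cell (e := -e) (by rwa [norm_neg]) hs hs1 ht1 hst
    (fun K a hK hKT hKR => h K a hK hKT (by rwa [hneg] at hKR)) hK hKT (by rwa [hneg])
  refine (hg1.union_cell hc1 hc2 hg2).mono fun z hz => ?_
  rcases le_total (e * (z - a)).re 0 with h3 | h3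
  · exact Or.inl (h1 z hz h3)
  · exact Or.inr (h2 z hz (by rw [neg_mul, neg_re]; linarith))

lemma rect_neg_I (a : ℂ) (s t : ℝ) : Rect (-I) a s t = Rect 1 a t s := by
  ext z
  simp only [Rect, Set.mem_ofPred_eq, neg_mul, neg_re, neg_im, abs_neg, one_mul, I_mul_re, I_mul_im]
  exact and_comm

lemma GoodRect.square_step {B : ℂ × ℂ → A} {s : ℝ} (hs : 0 < s) (hs1 : s ≤ 1 / 100)
    (h : GoodRect B 1 s s) : GoodRect B 1 (6 / 5 * s) (6 / 5 * s) := by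
  have h1 := h.step norm_one hs hs1 (by linarith) (by nlinarith)
  have h2 : GoodRect B (-I) s (6 / 5 * s) := fun K a hK hKT hKR =>
    h1 K a hK hKT (by rwa [rect_neg_I] at hKR)
  have h3 := h2.step (by simp) hs hs1 (by linarith) (by nlinarith)
  exact fun K a hK hKT hKR => h3 K a hK hKT (by rwa [rect_neg_I])

lemma GoodRect.mono {B : ℂ × ℂ → A} {e : ℂ} {s t s' t' : ℝ} (h : GoodRect B e s t) (hs : s' ≤ s)
    (ht : t' ≤ t) : GoodRect B e s' t' := fun K a hK hKT hKR =>
  h K a hK hKT fun _ hz => ⟨(hKR hz).1.trans hs, (hKR hz).2.trans ht⟩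

lemma exists_goodRect {B : ℂ × ℂ → A} (hB : SmH Set.univ B) : ∃ s > 0, GoodRect B 1 s s := by
  choose r hr hg using exists_good_ball hB
  obtain ⟨δ, hδ, h1⟩ := lebesgue_number_lemma_of_metric (s := Metric.closedBall (0 : ℂ) (1 / 200))
    (c := fun z₀ => Metric.ball z₀ (r z₀)) (isCompact_closedBall _ _)
    (fun _ => Metric.isOpen_ball) fun z _ => Set.mem_iUnion.mpr ⟨z, Metric.mem_ball_self (hr z)⟩
  refine ⟨δ / 5, by positivity, fun K a _ hKT hKR => ?_⟩
  rcases K.eq_empty_or_nonempty with rfl | ⟨z₀, hz₀⟩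
  · exact good_empty B
  obtain ⟨w, hw⟩ := h1 z₀ (hKT hz₀)
  have h2 : ∀ z ∈ K, ‖z - a‖ ≤ δ / 5 + δ / 5 := fun z hz => by
    have := norm_le_abs_re_add_abs_im (1 * (z - a))
    rw [one_mul] at this
    exact this.trans (add_le_add (by simpa using (hKR hz).1) (by simpa using (hKR hz).2))
  refine (hg w).mono fun z hz => hw ?_
  rw [mem_ball_iff_norm]
  have h3 := norm_sub_le_norm_sub_add_norm_sub z a z₀
  have h4 := h2 z hz
  have h5 := h2 z₀ hz₀
  rw [norm_sub_rev] at h5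
  linarith

/-- Smooth potentials admit invertible solutions near every disc. -/
theorem good_closedBall {B : ℂ × ℂ → A} (hB : SmH Set.univ B) {R : ℝ} (hR : 0 < R) :
    Good B (Metric.closedBall 0 R) := by
  have hl : 0 < 200 * R := by positivity
  refine Good.affine 0 hl.ne' ?_
  have hB' : SmH Set.univ
      (fun p => ((200 * R : ℝ) : ℂ) • B (0 + ((200 * R : ℝ) : ℂ) * p.1, p.2)) :=
    (SmH.const _).smul (hB.affine 0 _)
  obtain ⟨s, hs, h⟩ := exists_goodRect hB'
  have key : ∀ n : ℕ, GoodRect (fun p => ((200 * R : ℝ) : ℂ) • B (0 + ((200 * R : ℝ) : ℂ) * p.1, p.2))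
      1 (min ((6 / 5) ^ n * s) (1 / 100)) (min ((6 / 5) ^ n * s) (1 / 100)) := by
    intro n
    induction n with
    | zero => exact h.mono (by simp) (by simp)
    | succ n ih =>
      have h1 := ih.square_step (lt_min (by positivity) (by norm_num)) (min_le_right _ _)
      have h2 : min ((6 / 5) ^ (n + 1) * s) (1 / 100) ≤
          6 / 5 * min ((6 / 5) ^ n * s) (1 / 100) := by
        rw [mul_min_of_nonneg _ _ (by norm_num)]
        refine min_le_min (by rw [pow_succ]; linarith) (by norm_num)
      exact h1.mono h2 h2
  obtain ⟨n, hn⟩ := pow_unbounded_of_one_lt (1 / 100 / s) (show (1 : ℝ) < 6 / 5 by norm_num)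
  have h1 := key n
  rw [min_eq_right (by rw [div_lt_iff₀ hs] at hn; exact hn.le)] at h1
  refine (h1 (Metric.closedBall 0 (1 / 200)) 0 (cell_closedBall (by norm_num) (by norm_num))
    subset_rfl fun z hz => ?_).mono fun z hz => ?_
  · rw [mem_closedBall_zero_iff] at hz
    simp only [Rect, Set.mem_ofPred_eq, one_mul, sub_zero]
    exact ⟨(abs_re_le_norm z).trans (by linarith), (abs_im_le_norm z).trans (by linarith)⟩
  · rw [Set.mem_preimage, mem_closedBall_zero_iff, zero_add, norm_mul, norm_real, Real.norm_eq_abs,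
      abs_of_pos hl] at hz
    rw [mem_closedBall_zero_iff]
    by_contra! h
    nlinarith

end Covering

section Planar
attribute [local instance] Matrix.linftyOpNormedRing Matrix.linftyOpNormedAlgebra
variable {m : ℕ}

/-- The coordinate `x₁ + i ε x₂` as a continuous linear map. -/
def coordCLM (ε : ℝ) : R2 →L[ℝ] ℂ :=
  Complex.ofRealCLM.comp (EuclideanSpace.proj 0) +
    (ε * I) • Complex.ofRealCLM.comp (EuclideanSpace.proj 1)

lemma coordCLM_apply (ε : ℝ) (x : R2) : coordCLM ε x = (x 0 : ℂ) + ε * I * (x 1 : ℂ) := rfl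

lemma coordCLM_e1 (ε : ℝ) : coordCLM ε e1 = 1 := by
  simp [coordCLM_apply, e1, mk2]

lemma coordCLM_e2 (ε : ℝ) : coordCLM ε e2 = ε * I := by
  simp [coordCLM_apply, e2, mk2]

lemma norm_coordCLM {ε : ℝ} (hε : ε ^ 2 = 1) (x : R2) : ‖coordCLM ε x‖ = ‖x‖ := by
  rw [EuclideanSpace.norm_eq, coordCLM_apply, Complex.norm_def, Complex.normSq_apply]
  congr 1
  simp [Fin.sum_univ_two]
  linear_combination (x 1) ^ 2 * hε

/-- The inverse of `coordCLM`. -/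
def pointOf (ε : ℝ) (z : ℂ) : R2 := mk2 z.re (ε * z.im)

lemma pointOf_coordCLM {ε : ℝ} (hε : ε ^ 2 = 1) (x : R2) : pointOf ε (coordCLM ε x) = x := by
  ext i
  fin_cases i
  · simp [pointOf, mk2, coordCLM_apply]
  · simp [pointOf, mk2, coordCLM_apply]
    linear_combination (x 1) * hε

lemma contDiff_pointOf (ε : ℝ) : ContDiff ℝ (⊤ : ℕ∞) (pointOf ε) := by
  rw [contDiff_euclidean]
  intro i
  fin_cases i
  · exact reCLM.contDiff
  · exact contDiff_const.mul imCLM.contDiff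

/-- The entry of a matrix as a continuous linear functional. -/
def entryCLM (i j : Fin m) : Mat m →L[ℂ] ℂ :=
  LinearMap.toContinuousLinearMap (Matrix.entryLinearMap ℂ ℂ i j)

lemma entryCLM_apply (i j : Fin m) (M : Mat m) : entryCLM i j M = M i j := rfl

lemma _root_.MatSmooth.contDiff {A : R2 → Mat m} (h : MatSmooth A) : ContDiff ℝ (⊤ : ℕ∞) A := by
  have h1 : A = fun x => ∑ i, ∑ j, A x i j • Matrix.single i j (1 : ℂ) := by
    funext x
    conv_lhs => rw [Matrix.matrix_eq_sum_single (A x)]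
    simp
  rw [h1]
  exact ContDiff.sum fun i _ => ContDiff.sum fun j _ => (h i j).smul contDiff_const

lemma zDirM_smul (k z1 z2 : ℂ) (c : R2 → Mat m) (x : R2) :
    zDirM (k * z1) (k * z2) c x = k • zDirM z1 z2 c x := by
  ext i j
  simp only [zDirM, Matrix.of_apply, Matrix.smul_apply, smul_eq_mul]
  ring

lemma zDirM_coordCLM {u : ℂ × ℂ → Mat m} {ε : ℝ} {x : R2} {s : ℂ}
    (hu : DifferentiableAt ℝ u (coordCLM ε x, s)) (hε : ε ^ 2 = 1) :
    zDirM ((1 + s ^ 2) / 2) (ε * (I * (1 - s ^ 2) / 2)) (fun y => u (coordCLM ε y, s)) x =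
      Lop u (coordCLM ε x, s) := by
  have h1 : HasFDerivAt (fun y : R2 => (coordCLM ε y, s)) ((coordCLM ε).prod 0) x :=
    (coordCLM ε).hasFDerivAt.prodMk (hasFDerivAt_const s x)
  ext i j
  have h2 := ((entryCLM i j).restrictScalars ℝ).hasFDerivAt.comp x
    (HasFDerivAt.comp x hu.hasFDerivAt h1)
  have h3 : ∀ v, fderiv ℝ (fun y => u (coordCLM ε y, s) i j) x v =
      entryCLM i j (fderiv ℝ u (coordCLM ε x, s) (coordCLM ε v, 0)) := fun v =>
    DFunLike.congr_fun (show fderiv ℝ (fun y => u (coordCLM ε y, s) i j) x = _ from h2.fderiv) v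
  have h4 : fderiv ℝ u (coordCLM ε x, s) (ε * I, 0) =
      (ε : ℂ) • fderiv ℝ u (coordCLM ε x, s) (I, 0) := by
    rw [Complex.coe_smul, ← map_smul, Prod.smul_mk, Complex.real_smul, smul_zero]
  rw [← entryCLM_apply i j (Lop _ _)]
  simp only [zDirM, Matrix.of_apply, pdv, h3, coordCLM_e1, coordCLM_e2, h4, Lop, firstOrder,
    map_add, map_smul, smul_eq_mul]
  have h5 : (ε : ℂ) ^ 2 = 1 := by exact_mod_cast hε
  have h6 : ∀ P Q : ℂ, (1 + s ^ 2) / 2 * P + ε * (I * (1 - s ^ 2) / 2) * (ε * Q) =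
      (1 + s ^ 2) / 2 * P + I * (1 - s ^ 2) / 2 * Q := fun P Q => by
    linear_combination (I * (1 - s ^ 2) / 2) * Q * h5
  exact h6 _ _

/-- Invertible solutions on a disc, holomorphic in the spectral parameter. -/
theorem exists_disc_solution (hm : 1 ≤ m) {R ε : ℝ} (hR : 0 < R) (hε : ε ^ 2 = 1)
    {A0 A1 A2 : R2 → Mat m} (h0 : MatSmooth A0) (h1 : MatSmooth A1) (h2 : MatSmooth A2) :
    ∃ c : R2 → ℂ → Mat m, ∀ x : R2, ‖x‖ ≤ R → ∀ s : ℂ, ‖s‖ ≤ 1 →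
      (∀ i j, ContDiffAt ℝ (⊤ : ℕ∞) (fun p : R2 × ℂ => c p.1 p.2 i j) (x, s)) ∧
      (∀ i j, DifferentiableAt ℂ (fun s => c x s i j) s) ∧ (c x s).det ≠ 0 ∧
      zDirM ((1 + s ^ 2) / 2) (ε * (I * (1 - s ^ 2) / 2)) (fun y => c y s) x =
        (((1 + s ^ 2) / 2) • A1 x + (ε * (I * (1 - s ^ 2) / 2)) • A2 x + s • A0 x) * c x s := by
  have : Nonempty (Fin m) := ⟨⟨0, hm⟩⟩
  have : NormOneClass (Mat m) := Matrix.linfty_opNormOneClass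
  have hA : ∀ {A : R2 → Mat m}, MatSmooth A → SmH Set.univ fun p : ℂ × ℂ => A (pointOf ε p.1) :=
    fun {A} h => SmH.of_fst (g := fun z => A (pointOf ε z)) (h.contDiff.comp (contDiff_pointOf ε))
  have hs : SmH Set.univ fun p : ℂ × ℂ => p.2 := smH_snd
  have hs2 : SmH Set.univ fun p : ℂ × ℂ => p.2 ^ 2 := by
    simp only [pow_two]
    exact hs.mul hs
  have hc1 : SmH Set.univ fun p : ℂ × ℂ => (1 + p.2 ^ 2) / 2 := by
    simp only [div_eq_mul_inv]
    exact ((SmH.const 1).add hs2).mul (SmH.const _)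
  have hc2 : SmH Set.univ fun p : ℂ × ℂ => (ε * (I * (1 - p.2 ^ 2) / 2) : ℂ) := by
    simp only [div_eq_mul_inv]
    exact (SmH.const _).mul (((SmH.const I).mul ((SmH.const 1).sub hs2)).mul (SmH.const _))
  obtain ⟨O, -, hO, u, hu, hu'⟩ := good_closedBall
    (((hc1.smul (hA h1)).add (hc2.smul (hA h2))).add (hs.smul (hA h0))) hR
  refine ⟨fun x s => u (coordCLM ε x, s), fun x hx s hs => ?_⟩
  have hxO : coordCLM ε x ∈ O :=
    hO (mem_closedBall_zero_iff.mpr ((norm_coordCLM hε x).trans_le hx))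
  obtain ⟨hL, hun⟩ := hu' _ hxO s hs
  refine ⟨fun i j => ?_, fun i j => ?_, ?_, ?_⟩
  · have h3 : ContDiffAt ℝ (⊤ : ℕ∞) (fun p : R2 × ℂ => (coordCLM ε p.1, p.2)) (x, s) :=
      (((coordCLM ε).contDiff.comp contDiff_fst).prodMk contDiff_snd).contDiffAt
    exact ((entryCLM i j).restrictScalars ℝ).contDiff.contDiffAt.comp (x, s)
      (ContDiffAt.comp (g := u) (f := fun p : R2 × ℂ => (coordCLM ε p.1, p.2)) (x, s)
        (hu.contDiffAt hxO hs) h3)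
  · exact (entryCLM i j).differentiableAt.comp s (hu.differentiableAt_snd hxO hs)
  · exact ((Matrix.isUnit_iff_isUnit_det _).mp hun).ne_zero
  · rw [zDirM_coordCLM (hu.diff hxO hs) hε, hL]
    simp only [pointOf_coordCLM hε, Pi.zero_apply, mul_zero, add_zero]

end Planar
end PlanarTransport

/-- Lemma 2.1: existence of matrix solutions c₊, c₋ on closure(B_{2R})×closure(D^±). -/
theorem exists_cpm (m : ℕ) (hm : 1 ≤ m) (R : ℝ) (hR : 0 < R)
    (A0 A1 A2 : R2 → Mat m)
    (hsm0 : MatSmooth A0) (hsm1 : MatSmooth A1) (hsm2 : MatSmooth A2)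
    (hsupp0 : SuppIn A0 R) (hsupp1 : SuppIn A1 R) (hsupp2 : SuppIn A2 R) :
    ∃ cp cm : R2 → ℂ → Mat m, ∃ cpinf : R2 → Mat m,
      -- (a) c₊ solves the equation on closure(B_{2R})×closure(D⁺)
      (∀ x : R2, ‖x‖ ≤ 2*R → ∀ t : ℂ, 1 ≤ ‖t‖ →
        zDirM (zeta1 t) (zeta2 t) (fun y => cp y t) x =
          Acomb A0 A1 A2 (zeta1 t) (zeta2 t) x * cp x t) ∧
      -- and c₋ solves it on closure(B_{2R})×(closure(D⁻)∖{0})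
      (∀ x : R2, ‖x‖ ≤ 2*R → ∀ t : ℂ, t ≠ 0 → ‖t‖ ≤ 1 →
        zDirM (zeta1 t) (zeta2 t) (fun y => cm y t) x =
          Acomb A0 A1 A2 (zeta1 t) (zeta2 t) x * cm x t) ∧
      -- (b) smoothness and nonvanishing determinant
      (∀ i j, ContDiffOn ℝ (⊤ : ℕ∞) (fun p : R2 × ℂ => cp p.1 p.2 i j)
        {p : R2 × ℂ | ‖p.1‖ ≤ 2*R ∧ 1 ≤ ‖p.2‖}) ∧
      (∀ (x : R2) (t : ℂ), ‖x‖ ≤ 2*R → 1 ≤ ‖t‖ → (cp x t).det ≠ 0) ∧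
      (∀ i j, ContDiffOn ℝ (⊤ : ℕ∞) (fun p : R2 × ℂ => cm p.1 p.2 i j)
        {p : R2 × ℂ | ‖p.1‖ ≤ 2*R ∧ ‖p.2‖ ≤ 1}) ∧
      (∀ (x : R2) (t : ℂ), ‖x‖ ≤ 2*R → ‖t‖ ≤ 1 → (cm x t).det ≠ 0) ∧
      -- (c) analyticity in t
      (∀ x : R2, ‖x‖ ≤ 2*R → ∀ i j,
        DifferentiableOn ℂ (fun t => cp x t i j) {t : ℂ | 1 < ‖t‖}) ∧
      (∀ x : R2, ‖x‖ ≤ 2*R → ∀ i j,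
        AnalyticAt ℂ (fun s => extInf (cp x) (cpinf x) s i j) 0) ∧
      (∀ x : R2, ‖x‖ ≤ 2*R → (cpinf x).det ≠ 0) ∧
      (∀ x : R2, ‖x‖ ≤ 2*R → ∀ i j,
        DifferentiableOn ℂ (fun t => cm x t i j) {t : ℂ | ‖t‖ < 1}) ∧
      (∀ x : R2, ‖x‖ ≤ 2*R → (cm x 0).det ≠ 0) := by
  obtain ⟨d, hd⟩ := PlanarTransport.exists_disc_solution (ε := 1) hm (by positivity : 0 < 2 * R)
    (by norm_num) hsm0 hsm1 hsm2
  obtain ⟨c, hc⟩ := PlanarTransport.exists_disc_solution (ε := -1) hm (by positivity : 0 < 2 * R)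
    (by norm_num) hsm0 hsm1 hsm2
  have ne : ∀ {t : ℂ}, 1 ≤ ‖t‖ → t ≠ 0 := fun h =>
    norm_pos_iff.mp (one_pos.trans_le h)
  have inv : ∀ {t : ℂ}, 1 ≤ ‖t‖ → ‖t⁻¹‖ ≤ 1 := fun h => by
    rw [norm_inv]
    exact inv_le_one_of_one_le₀ h
  have z0 : ‖(0 : ℂ)‖ ≤ 1 := by simp
  refine ⟨fun x t => c x t⁻¹, d, fun x => c x 0, fun x hx t ht => ?_, fun x hx t ht0 ht => ?_,
    fun i j p hp => ?_, fun x t hx ht => (hc x hx _ (inv ht)).2.2.1,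
    fun i j p hp => ((hd p.1 hp.1 p.2 hp.2).1 i j).contDiffWithinAt,
    fun x t hx ht => (hd x hx t ht).2.2.1, fun x hx i j t ht => ?_, fun x hx i j => ?_,
    fun x hx => (hc x hx 0 z0).2.2.1,
    fun x hx i j t ht => ((hd x hx t (le_of_lt ht)).2.1 i j).differentiableWithinAt,
    fun x hx => (hd x hx 0 z0).2.2.1⟩
  · have h := (hc x hx _ (inv ht)).2.2.2
    have h1 : zeta1 t = t * ((1 + t⁻¹ ^ 2) / 2) := by
      unfold zeta1
      field_simp [ne ht]
    have h2 : zeta2 t = t * (((-1 : ℝ) : ℂ) * (I * (1 - t⁻¹ ^ 2) / 2)) := by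
      unfold zeta2
      have := ne ht
      push_cast
      field_simp
      linear_combination (t ^ 2 - 1) * I_sq
    rw [h1, h2, PlanarTransport.zDirM_smul, h, ← smul_mul_assoc]
    simp only [Acomb, smul_add, smul_smul, mul_inv_cancel₀ (ne ht), one_smul]
  · have h := (hd x hx t ht).2.2.2
    have h1 : zeta1 t = t⁻¹ * ((1 + t ^ 2) / 2) := by
      unfold zeta1
      field_simp
      ring
    have h2 : zeta2 t = t⁻¹ * (((1 : ℝ) : ℂ) * (I * (1 - t ^ 2) / 2)) := by
      unfold zeta2
      push_cast
      field_simp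
      linear_combination (t ^ 2 - 1) * I_sq
    rw [h1, h2, PlanarTransport.zDirM_smul, h, ← smul_mul_assoc]
    simp only [Acomb, smul_add, smul_smul, inv_mul_cancel₀ ht0, one_smul]
  · have h := (hc p.1 hp.1 _ (inv hp.2)).1 i j
    have h1 : ContDiffAt ℝ (⊤ : ℕ∞) (fun q : R2 × ℂ => (q.1, q.2⁻¹)) p :=
      contDiffAt_fst.prodMk (contDiffAt_snd.inv (ne hp.2))
    exact (ContDiffAt.comp (g := fun q : R2 × ℂ => c q.1 q.2 i j)
      (f := fun q : R2 × ℂ => (q.1, q.2⁻¹)) p h h1).contDiffWithinAt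
  · have ht' : 1 ≤ ‖t‖ := le_of_lt ht
    exact (((hc x hx _ (inv ht')).2.1 i j).comp t
      (differentiableAt_inv (ne ht'))).differentiableWithinAt
  · have h1 : (fun s => extInf (fun t => c x t⁻¹) (c x 0) s i j) = fun s => c x s i j := by
      funext s
      by_cases hs : s = 0 <;> simp [extInf, hs]
    rw [h1]
    refine DifferentiableOn.analyticAt (s := Metric.ball 0 1) (fun s hs => ?_)
      (Metric.ball_mem_nhds 0 one_pos)
    exact ((hc x hx s (mem_ball_zero_iff.mp hs).le).2.1 i j).differentiableWithinAt
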